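/- Let (R,m) be a Cohen–Macaulay Noetherian local ring and M a finite unmixed R-module with dim M = dim R = d. If e_1(J,M) = 0 for some parameter ideal J for M, then M is Cohen–Macaulay. -/

import Mathlib

/-- `HasLength R M n` : the `R`-module `M` has finite length `n`. -/
def HasLength (R M : Type*) [Ring R] [AddCommGroup M] [Module R M] (n : ℕ) : Prop :=
  ∃ s : CompositionSeries (Submodule R M), s.head = ⊥ ∧ s.last = ⊤ ∧ s.length = n

/-- `M` is a Cohen–Macaulay module of dimension `n`: its dimension is `n` and (since
`depth ≤ dim` always) it has an `M`-regular sequence of length `n` in the maximal ideal. -/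
def IsCMofDim (R : Type*) [CommRing R] [IsLocalRing R] (M : Type*) [AddCommGroup M]
    [Module R M] (n : ℕ) : Prop :=
  ringKrullDim (R ⧸ Module.annihilator R M) = n ∧
    ∃ rs : List R, rs.length = n ∧ (∀ r ∈ rs, r ∈ IsLocalRing.maximalIdeal R) ∧
      RingTheory.Sequence.IsRegular M rs

section part_1
open Filter
namespace CM

/-- forward difference -/
def fd (f : ℕ → ℤ) : ℕ → ℤ := fun n => f (n + 1) - f n

/-- `Lead s f c`: the `s`-th difference of `f` is eventually `c`. -/
def Lead : ℕ → (ℕ → ℤ) → ℤ → Prop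
  | 0, f, c => ∀ᶠ n in atTop, f n = c
  | s + 1, f, c => Lead s (fd f) c

abbrev EvP (s : ℕ) (f : ℕ → ℤ) : Prop := Lead s f 0

lemma Lead.congr {s : ℕ} {f g : ℕ → ℤ} {c : ℤ} (h : Lead s f c) (hfg : ∀ᶠ n in atTop, f n = g n) :
    Lead s g c := by
  induction s generalizing f g with
  | zero =>
    filter_upwards [h, hfg] with n h1 h2
    rw [← h2, h1]
  | succ s ih =>
    refine ih (f := fd f) h ?_
    filter_upwards [hfg, (tendsto_add_atTop_nat 1).eventually hfg] with n h1 h2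
    simp [fd, h1, h2]

lemma Lead.add {s : ℕ} {f g : ℕ → ℤ} {c e : ℤ} (h : Lead s f c) (h' : Lead s g e) :
    Lead s (fun n => f n + g n) (c + e) := by
  induction s generalizing f g with
  | zero =>
    filter_upwards [h, h'] with n h1 h2
    rw [h1, h2]
  | succ s ih =>
    refine Lead.congr (s := s) (ih (f := fd f) (g := fd g) h h') (Eventually.of_forall fun n => ?_)
    simp only [fd]; ring

lemma Lead.mul {s : ℕ} {f : ℕ → ℤ} {c : ℤ} (a : ℤ) (h : Lead s f c) :
    Lead s (fun n => a * f n) (a * c) := by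
  induction s generalizing f with
  | zero =>
    filter_upwards [h] with n h1
    rw [h1]
  | succ s ih =>
    refine Lead.congr (s := s) (ih (f := fd f) h) (Eventually.of_forall fun n => ?_)
    simp only [fd]; ring

lemma Lead.sub {s : ℕ} {f g : ℕ → ℤ} {c e : ℤ} (h : Lead s f c) (h' : Lead s g e) :
    Lead s (fun n => f n - g n) (c - e) := by
  have := h.add (h'.mul (-1))
  have e1 : c - e = c + -1 * e := by ring
  rw [e1]
  exact this.congr (Eventually.of_forall fun n => by ring)

lemma lead_zero (s : ℕ) : Lead s (fun _ => (0 : ℤ)) 0 := by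
  induction s with
  | zero => exact Eventually.of_forall fun _ => rfl
  | succ s ih => exact Lead.congr (s := s) ih (Eventually.of_forall fun n => by simp [fd])

lemma Lead.sum {ι : Type*} {s : ℕ} {f : ι → ℕ → ℤ} {c : ι → ℤ} (S : Finset ι)
    (h : ∀ i ∈ S, Lead s (f i) (c i)) : Lead s (fun n => ∑ i ∈ S, f i n) (∑ i ∈ S, c i) := by
  classical
  induction S using Finset.induction_on with
  | empty =>
    simp only [Finset.sum_empty]
    exact lead_zero s
  | insert a S ha ih =>
    simp only [Finset.sum_insert ha]
    exact (h a (by simp)).add (ih fun i hi => h i (by simp [hi]))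

lemma Lead.shift {s : ℕ} {f : ℕ → ℤ} {c : ℤ} (k : ℕ) (h : Lead s f c) :
    Lead s (fun n => f (n + k)) c := by
  induction s generalizing f with
  | zero => exact (tendsto_add_atTop_nat k).eventually h
  | succ s ih =>
    refine Lead.congr (s := s) (ih (f := fd f) h) (Eventually.of_forall fun n => ?_)
    simp only [fd]
    rw [show n + k + 1 = n + 1 + k by ring]

lemma Lead.unshift {s : ℕ} {f : ℕ → ℤ} {c : ℤ} (k : ℕ) (h : Lead s (fun n => f (n + k)) c) :
    Lead s f c := by
  induction s generalizing f with
  | zero =>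
    obtain ⟨N, hN⟩ := eventually_atTop.1 h
    refine eventually_atTop.2 ⟨N + k, fun n hn => ?_⟩
    have := hN (n - k) (by omega)
    simpa [show n - k + k = n by omega] using this
  | succ s ih =>
    refine ih (f := fd f) (Lead.congr h (Eventually.of_forall fun n => ?_))
    simp only [fd]
    rw [show n + k + 1 = n + 1 + k by ring]

lemma Lead.evP {s : ℕ} {f : ℕ → ℤ} {c : ℤ} (h : Lead s f c) : EvP (s + 1) f := by
  induction s generalizing f with
  | zero =>
    show ∀ᶠ n in atTop, fd f n = 0
    filter_upwards [h, (tendsto_add_atTop_nat 1).eventually h] with n h1 h2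
    simp [fd, h1, h2]
  | succ s ih => exact ih (f := fd f) h

lemma EvP.exists_lead {s : ℕ} {f : ℕ → ℤ} (h : EvP (s + 1) f) : ∃ c, Lead s f c := by
  induction s generalizing f with
  | zero =>
    obtain ⟨N, hN⟩ := eventually_atTop.1 (show ∀ᶠ n in atTop, fd f n = 0 from h)
    refine ⟨f N, eventually_atTop.2 ⟨N, fun n hn => ?_⟩⟩
    induction n, hn using Nat.le_induction with
    | base => rfl
    | succ n hn ih => have := hN n hn; simp only [fd] at this; linarith
  | succ s ih => exact ih (f := fd f) h

lemma EvP.succ {s : ℕ} {f : ℕ → ℤ} (h : EvP s f) : EvP (s + 1) f := Lead.evP h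

lemma EvP.mono {s t : ℕ} {f : ℕ → ℤ} (h : EvP s f) (hst : s ≤ t) : EvP t f := by
  induction t, hst using Nat.le_induction with
  | base => exact h
  | succ n hn ih => exact ih.succ

lemma EvP.add {s : ℕ} {f g : ℕ → ℤ} (h : EvP s f) (h' : EvP s g) :
    EvP s (fun n => f n + g n) := by simpa [EvP] using Lead.add h h'

lemma EvP.sub {s : ℕ} {f g : ℕ → ℤ} (h : EvP s f) (h' : EvP s g) :
    EvP s (fun n => f n - g n) := by simpa [EvP] using Lead.sub h h'

lemma EvP.fd {s : ℕ} {f : ℕ → ℤ} (h : EvP (s + 1) f) : EvP s (CM.fd f) := h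

lemma EvP.diff {s : ℕ} {f : ℕ → ℤ} (h : EvP (s + 1) f) (k : ℕ) :
    EvP s (fun n => f (n + k) - f n) := by
  induction k with
  | zero =>
    have : EvP s (fun n => CM.fd f n - CM.fd f n) := EvP.sub h h
    exact this.congr (Eventually.of_forall fun n => by simp)
  | succ k ih =>
    have := EvP.add ih (Lead.shift k (EvP.fd h))
    exact this.congr (Eventually.of_forall fun n => by simp only [CM.fd]; ring_nf)

/-- a negative eventual leading difference forces eventual negativity -/
lemma neg_of_lead {f : ℕ → ℤ}
    (h : ∀ᶠ n in atTop, fd f n ≤ -1) : ∀ᶠ n in atTop, f n ≤ -1 := by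
  obtain ⟨N, hN⟩ := eventually_atTop.1 h
  have key : ∀ k : ℕ, f (N + k) ≤ f N - k := by
    intro k
    induction k with
    | zero => simp
    | succ k ih =>
      have := hN (N + k) (by omega)
      simp only [fd] at this
      push_cast
      rw [← add_assoc]
      linarith
  refine eventually_atTop.2 ⟨N + (f N + 1).toNat, fun n hn => ?_⟩
  have := key (n - N)
  rw [show N + (n - N) = n by omega] at this
  omega

lemma Lead.nonneg {s : ℕ} {f : ℕ → ℤ} {c : ℤ} (h : Lead s f c) (hf : ∀ᶠ n in atTop, 0 ≤ f n) :
    0 ≤ c := by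
  by_contra hc
  have key : ∀ (s : ℕ) (f : ℕ → ℤ), Lead s f c → ∀ᶠ n in atTop, f n ≤ -1 := by
    intro s
    induction s with
    | zero =>
      intro f h
      filter_upwards [h] with n hn
      omega
    | succ s ih => intro f h; exact neg_of_lead (ih _ h)
  obtain ⟨n, h1, h2⟩ := ((key s f h).and hf).exists
  omega

lemma EvP.of_le {t s : ℕ} {f g : ℕ → ℤ} (hf : EvP t f) (hg : EvP s g)
    (h0 : ∀ᶠ n in atTop, 0 ≤ f n) (h : ∀ᶠ n in atTop, f n ≤ g n) : EvP s f := by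
  by_cases hts : t ≤ s
  · exact hf.mono hts
  push Not at hts
  have : ∀ j, s + j ≤ t → EvP (t - j) f := by
    intro j
    induction j with
    | zero => intro _; exact hf
    | succ j ih =>
      intro hj
      have h1 := ih (by omega)
      rw [show t - j = (t - (j + 1)) + 1 by omega] at h1
      obtain ⟨c, hc⟩ := h1.exists_lead
      have hc0 := hc.nonneg h0
      have hgt : EvP (t - (j + 1)) g := hg.mono (by omega)
      have h2 := (Lead.sub hgt hc).nonneg (by filter_upwards [h] with n hn; linarith)
      have : c = 0 := by omega
      rw [this] at hc
      exact hc
  have := this (t - s) (by omega)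
  rwa [show t - (t - s) = s by omega] at this

lemma Lead.unique {s : ℕ} {f : ℕ → ℤ} {c e : ℤ} (h : Lead s f c) (h' : Lead s f e) : c = e := by
  have h1 : Lead s (fun n => f n - f n) (c - e) := Lead.sub h h'
  have h2 : Lead s (fun n => f n - f n) (e - c) := Lead.sub h' h
  have := h1.nonneg (by simp)
  have := h2.nonneg (by simp)
  omega

lemma lead_choose (s : ℕ) : Lead s (fun n => ((n + s).choose s : ℤ)) 1 := by
  induction s with
  | zero => exact Eventually.of_forall fun n => by simp
  | succ s ih =>
    show Lead s _ _
    refine Lead.congr (ih.shift 1) (Eventually.of_forall fun n => ?_)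
    simp only [fd]
    rw [show n + 1 + (s + 1) = (n + 1 + s) + 1 by ring, Nat.choose_succ_succ,
      show n + (s + 1) = n + 1 + s by ring]
    push_cast; ring

lemma Lead.sub_choose {s : ℕ} {f : ℕ → ℤ} {c : ℤ} (h : Lead s f c) :
    EvP s (fun n => f n - c * ((n + s).choose s : ℤ)) := by
  have := h.sub ((lead_choose s).mul c)
  simpa [EvP] using this

end CM
end part_1

section part_2
open Filter
namespace CM
universe u v w

section rl
variable (k : Type u) {A : Type v} [CommRing k] [CommRing A] [Algebra k A]
variable {M : Type w} [AddCommGroup M] [Module A M] [Module k M] [IsScalarTower k A M]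
variable {M' : Type*} [AddCommGroup M'] [Module A M'] [Module k M'] [IsScalarTower k A M']

/-- relative length of `Q` over `P` -/
noncomputable def rl (P Q : Submodule A M) : ℕ∞ := Module.length k ↥(Q.map P.mkQ)

variable {k}

lemma rl_mono {P Q Q' : Submodule A M} (h : Q ≤ Q') : rl k P Q ≤ rl k P Q' :=
  Module.length_le_of_injective
    ((Submodule.inclusion (Submodule.map_mono (f := P.mkQ) h)).restrictScalars k)
    (Submodule.inclusion_injective (Submodule.map_mono (f := P.mkQ) h))

lemma rl_comap (f : M →ₗ[A] M') (P : Submodule A M') (Q : Submodule A M) :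
    rl k (P.comap f) Q = rl k P (Q.map f) := by
  let g : (M ⧸ P.comap f) →ₗ[A] (M' ⧸ P) := Submodule.mapQ _ _ f le_rfl
  have hg : Function.Injective g := by
    rw [← LinearMap.ker_eq_bot, Submodule.ker_mapQ, Submodule.mkQ_map_self]
  have : (Q.map f).map P.mkQ = (Q.map (P.comap f).mkQ).map g := by
    rw [← Submodule.map_comp, ← Submodule.map_comp]
    rfl
  unfold rl
  rw [this]
  exact ((Submodule.equivMapOfInjective g hg _).restrictScalars k).length_eq

lemma rl_top (P : Submodule A M) : rl k P ⊤ = Module.length k (M ⧸ P) := by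
  unfold rl
  have : (⊤ : Submodule A M).map P.mkQ = ⊤ := by
    rw [Submodule.map_top, Submodule.range_mkQ]
  rw [this]
  exact (((Submodule.topEquiv (R := A) (M := M ⧸ P))).restrictScalars k).length_eq

lemma rl_bot_top : rl k (⊥ : Submodule A M) ⊤ = Module.length k M := by
  rw [rl_top]
  exact ((Submodule.quotEquivOfEqBot (⊥ : Submodule A M) rfl).restrictScalars k).length_eq

lemma rl_eq_zero {P Q : Submodule A M} : rl k P Q = 0 ↔ Q ≤ P := by
  unfold rl
  rw [Module.length_eq_zero_iff, Submodule.subsingleton_iff_eq_bot, ← LinearMap.le_ker_iff_map,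
    Submodule.ker_mkQ]

lemma rl_bot {P : Submodule A M} : rl k P ⊥ = 0 := rl_eq_zero.2 bot_le

lemma rl_self {P : Submodule A M} : rl k P P = 0 := rl_eq_zero.2 le_rfl

lemma rl_add_le {P Q S : Submodule A M} (h : P ≤ Q) :
    rl k P S = rl k P (Q ⊓ S) + rl k Q S := by
  let g : (M ⧸ P) →ₗ[A] (M ⧸ Q) := Submodule.factor h
  have hgm : g ∘ₗ P.mkQ = Q.mkQ := by ext; rfl
  have key : ∀ m ∈ S.map P.mkQ, g m ∈ S.map Q.mkQ := by
    rintro _ ⟨m, hm, rfl⟩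
    exact ⟨m, hm, rfl⟩
  let p : ↥(S.map P.mkQ) →ₗ[A] ↥(S.map Q.mkQ) := g.restrict key
  have hle : (Q ⊓ S).map P.mkQ ≤ S.map P.mkQ := Submodule.map_mono inf_le_right
  refine Module.length_eq_add_of_exact ((Submodule.inclusion hle).restrictScalars k)
    (p.restrictScalars k) (Submodule.inclusion_injective hle) ?_ ?_
  · rintro ⟨_, m, hm, rfl⟩
    exact ⟨⟨P.mkQ m, m, hm, rfl⟩, rfl⟩
  · rintro ⟨_, m, hm, rfl⟩
    constructor
    · intro h0
      have h1 : Q.mkQ m = 0 := congrArg Subtype.val h0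
      have h2 : m ∈ Q := by simpa using h1
      exact ⟨⟨P.mkQ m, m, ⟨h2, hm⟩, rfl⟩, rfl⟩
    · rintro ⟨⟨_, m', hm', rfl⟩, h0⟩
      have h1 : P.mkQ m' = P.mkQ m := congrArg Subtype.val h0
      apply Subtype.ext
      change g (P.mkQ m) = 0
      rw [← h1]
      change Q.mkQ m' = 0
      simpa using hm'.1

lemma rl_add {P Q S : Submodule A M} (h : P ≤ Q) (h' : Q ≤ S) :
    rl k P S = rl k P Q + rl k Q S := by
  rw [rl_add_le h, inf_eq_left.2 h']

lemma rl_anti {P P' Q : Submodule A M} (h : P ≤ P') : rl k P' Q ≤ rl k P Q := by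
  rw [rl_add_le (S := Q) h]; exact le_add_self

lemma rl_inf {P Q : Submodule A M} : rl k (P ⊓ Q) Q = rl k P Q := by
  rw [rl_add_le (S := Q) (inf_le_left : P ⊓ Q ≤ P), rl_self, zero_add]

lemma rl_sup {P Q : Submodule A M} : rl k P (P ⊔ Q) = rl k P Q := by
  unfold rl
  rw [Submodule.map_sup, Submodule.mkQ_map_self, bot_sup_eq]

lemma rl_sup' {P Q : Submodule A M} : rl k P (Q ⊔ P) = rl k P Q := by
  rw [sup_comm, rl_sup]

lemma rl_sup_le {P Q Q' : Submodule A M} : rl k P (Q ⊔ Q') ≤ rl k P Q + rl k P Q' := by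
  rw [← rl_sup (P := P) (Q := Q ⊔ Q'), rl_add (P := P) (Q := P ⊔ Q) le_sup_left
    (sup_le le_sup_left (le_sup_left.trans le_sup_right)), rl_sup]
  gcongr
  have : P ⊔ (Q ⊔ Q') = (P ⊔ Q) ⊔ Q' := by rw [sup_assoc]
  rw [this, rl_sup]
  exact rl_anti le_sup_left

/-- triangle inequality -/
lemma rl_tri (P Q S : Submodule A M) : rl k P S ≤ rl k P Q + rl k Q S := by
  rw [← rl_inf (P := P) (Q := S)]
  calc rl k (P ⊓ S) S ≤ rl k (P ⊓ Q ⊓ S) S := rl_anti (le_inf (inf_le_left.trans inf_le_left) inf_le_right)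
    _ = rl k (P ⊓ Q) S := rl_inf
    _ = rl k (P ⊓ Q) (Q ⊓ S) + rl k Q S := rl_add_le inf_le_right
    _ ≤ rl k (P ⊓ Q) Q + rl k Q S := by gcongr; exact rl_mono inf_le_left
    _ = _ := by rw [rl_inf]

lemma rl_map (f : M →ₗ[A] M') (hf : Function.Injective f) (P Q : Submodule A M) :
    rl k (P.map f) (Q.map f) = rl k P Q := by
  rw [← rl_comap, Submodule.comap_map_eq_of_injective hf]

lemma rl_map_le (f : M →ₗ[A] M') (P Q : Submodule A M) :
    rl k (P.map f) (Q.map f) ≤ rl k P Q := by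
  rw [← rl_comap]
  exact rl_anti (Submodule.le_comap_map f P)

variable (k) in
/-- integer valued relative length -/
noncomputable def zl (P Q : Submodule A M) : ℤ := ((rl k P Q).toNat : ℤ)

lemma zl_nonneg (P Q : Submodule A M) : 0 ≤ zl k P Q := Int.natCast_nonneg _

lemma zl_eq {P Q : Submodule A M} (h : rl k P Q ≠ ⊤) : ∃ n : ℕ, rl k P Q = n ∧ zl k P Q = n :=
  ⟨(rl k P Q).toNat, (ENat.natCast_toNat h).symm, rfl⟩

lemma zl_add {P Q S : Submodule A M} (h : P ≤ Q) (h' : Q ≤ S) (hf : rl k P S ≠ ⊤) :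
    zl k P S = zl k P Q + zl k Q S := by
  unfold zl
  rw [rl_add h h'] at hf ⊢
  rw [ENat.toNat_add (ne_top_of_le_ne_top hf le_self_add) (ne_top_of_le_ne_top hf le_add_self)]
  push_cast; rfl

lemma zl_le {P Q : Submodule A M} {P' Q' : Submodule A M'} (h : rl k P Q ≤ rl k P' Q')
    (hf : rl k P' Q' ≠ ⊤) : zl k P Q ≤ zl k P' Q' := by
  unfold zl
  exact_mod_cast ENat.toNat_le_toNat h hf

lemma zl_congr {P Q : Submodule A M} {P' Q' : Submodule A M'} (h : rl k P Q = rl k P' Q') :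
    zl k P Q = zl k P' Q' := by
  unfold zl; rw [h]

lemma zl_eq_zero {P Q : Submodule A M} (h : Q ≤ P) : zl k P Q = 0 := by
  unfold zl; rw [rl_eq_zero.2 h]; rfl

lemma le_of_zl {P Q : Submodule A M} (hf : rl k P Q ≠ ⊤) (h : zl k P Q = 0) : Q ≤ P := by
  obtain ⟨n, h1, h2⟩ := zl_eq hf
  rw [h] at h2
  have : n = 0 := by exact_mod_cast h2.symm
  subst this
  exact rl_eq_zero.1 (by simpa using h1)

end rl
end CM
end part_2

section part_3
open Filter
namespace CM
universe u v w

section hilbert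
variable {k : Type u} {A : Type v} [CommRing k] [CommRing A] [Algebra k A]
variable {M : Type w} [AddCommGroup M] [Module A M] [Module k M] [IsScalarTower k A M]

/-- multiplication by an element -/
noncomputable abbrev mx (M : Type w) [AddCommGroup M] [Module A M] (x : A) : M →ₗ[A] M :=
  LinearMap.lsmul A M x

lemma map_mx_le {J : Ideal A} {x : A} (hx : x ∈ J) (N : Submodule A M) :
    N.map (mx M x) ≤ J • N := by
  rintro _ ⟨m, hm, rfl⟩
  exact Submodule.smul_mem_smul hx hm

lemma map_mx_eq (x : A) (N : Submodule A M) :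
    N.map (mx M x) = Ideal.span {x} • N := by
  apply le_antisymm (map_mx_le (Ideal.mem_span_singleton_self x) N)
  rw [Submodule.ideal_span_singleton_smul]
  rintro _ ⟨m, hm, rfl⟩
  exact ⟨m, hm, rfl⟩

lemma smul_map_mx_le (I : Ideal A) {x : A} (N : Submodule A M) :
    I • N.map (mx M x) = (I • N).map (mx M x) := by
  rw [Submodule.map_smul'']

/-- kernel filtration -/
noncomputable def kerFilt {J : Ideal A} (x : A) (F F' : J.Filtration M) : J.Filtration M where
  N n := F.N n ⊓ (F'.N (n + 1)).comap (mx M x)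
  mono n := inf_le_inf (F.mono n) (Submodule.comap_mono (F'.mono (n + 1)))
  smul_le n := by
    apply le_inf
    · exact (Submodule.smul_mono le_rfl inf_le_left).trans (F.smul_le n)
    · rw [← Submodule.map_le_iff_le_comap, Submodule.map_smul'']
      refine le_trans (Submodule.smul_mono le_rfl ?_) (F'.smul_le (n + 1))
      rw [Submodule.map_le_iff_le_comap]
      exact inf_le_right

/-- shifted filtration -/
def shiftFilt {J : Ideal A} (F : J.Filtration M) : J.Filtration M where
  N n := F.N (n + 1)
  mono n := F.mono (n + 1)
  smul_le n := F.smul_le (n + 1)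

/-- multiplied filtration -/
noncomputable def mulFilt {J : Ideal A} (x : A) (F : J.Filtration M) : J.Filtration M where
  N n := (F.N n).map (mx M x)
  mono n := Submodule.map_mono (F.mono n)
  smul_le n := by
    rw [smul_map_mx_le]; exact Submodule.map_mono (F.smul_le n)

theorem hilbert [IsNoetherianRing A] [Module.Finite A M] {J : Ideal A} (y : List A) :
    ∀ (𝔟 : Ideal A), (∀ a ∈ y, a ∈ J) → J ≤ Ideal.ofList y ⊔ 𝔟 → 
    ∀ (F F' : J.Filtration M), F.Stable → (∀ n, F'.N n ≤ F.N n) →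
    (∀ n, rl k (F'.N n) (F.N n) ≠ ⊤) → (∀ n, 𝔟 • F.N n ≤ F'.N (n + 1)) →
    EvP y.length (fun n => zl k (F'.N n) (F.N n)) := by
  induction y with
  | nil =>
    intro 𝔟 hy hJ F F' hF hle hfin hb
    obtain ⟨n0, hn0⟩ := hF
    simp only [Ideal.ofList_nil, bot_sup_eq] at hJ
    refine eventually_atTop.2 ⟨n0 + 1, fun n hn => ?_⟩
    obtain ⟨m, rfl⟩ : ∃ m, n = m + 1 := ⟨n - 1, by omega⟩
    apply zl_eq_zero
    rw [← hn0 m (by omega)]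
    exact (Submodule.smul_mono hJ le_rfl).trans (hb m)
  | cons x y ih =>
    intro 𝔟 hy hJ F F' hF hle hfin hb
    have hxJ : x ∈ J := hy x (by simp)
    have hy' : ∀ a ∈ y, a ∈ J := fun a ha => hy a (by simp [ha])
    have hJ' : J ≤ Ideal.ofList y ⊔ (Ideal.span {x} ⊔ 𝔟) := by
      refine hJ.trans (le_of_eq ?_)
      rw [Ideal.ofList_cons, ← sup_assoc]
      congr 1
      rw [sup_comm]
    have hxF' : ∀ n, F'.N n ≤ (F'.N (n + 1)).comap (mx M x) := fun n => by
      rw [← Submodule.map_le_iff_le_comap]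
      exact (map_mx_le hxJ _).trans (F'.smul_le n)
    have hK := ih (Ideal.span {x} ⊔ 𝔟) hy' hJ' (kerFilt x F F') F'
      (hF.of_le (fun n => inf_le_left)) (fun n => le_inf (hle n) (hxF' n))
      (fun n => ne_top_of_le_ne_top (hfin n) (rl_mono inf_le_left)) (fun n => by
        rw [Submodule.sup_smul]
        apply sup_le
        · rw [← map_mx_eq, Submodule.map_le_iff_le_comap]; exact inf_le_right
        · exact (Submodule.smul_mono le_rfl inf_le_left).trans (hb n))
    have hC := ih (Ideal.span {x} ⊔ 𝔟) hy' hJ' (shiftFilt F) (shiftFilt F' ⊔ mulFilt x F)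
      (hF.of_le (fun n => F.mono n))
      (fun n => sup_le (hle (n + 1)) ((map_mx_le hxJ _).trans (F.smul_le n)))
      (fun n => ne_top_of_le_ne_top (hfin (n + 1)) (rl_anti le_sup_left)) (fun n => by
        rw [Submodule.sup_smul]
        apply sup_le
        · rw [← map_mx_eq]; exact le_sup_right
        · exact (hb _).trans le_sup_left)
    refine Lead.congr (s := y.length) (hC.sub hK) (Eventually.of_forall fun n => ?_)
    have e1 : zl k (F'.N (n + 1)) (F.N (n + 1)) = 
        zl k (F'.N (n + 1)) (F'.N (n + 1) ⊔ (F.N n).map (mx M x)) + 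
        zl k (F'.N (n + 1) ⊔ (F.N n).map (mx M x)) (F.N (n + 1)) := 
      zl_add le_sup_left (sup_le (hle (n + 1)) ((map_mx_le hxJ _).trans (F.smul_le n))) (hfin _)
    have e2 : zl k (F'.N n) (F.N n) = 
        zl k (F'.N n) (F.N n ⊓ (F'.N (n + 1)).comap (mx M x)) + 
        zl k (F.N n ⊓ (F'.N (n + 1)).comap (mx M x)) (F.N n) := 
      zl_add (le_inf (hle n) (hxF' n)) inf_le_left (hfin _)
    have e3 : zl k (F'.N (n + 1)) (F'.N (n + 1) ⊔ (F.N n).map (mx M x)) = 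
        zl k (F.N n ⊓ (F'.N (n + 1)).comap (mx M x)) (F.N n) := by
      apply zl_congr
      rw [rl_sup, ← rl_comap, inf_comm, rl_inf]
    simp only [fd]
    change zl k (F'.N (n + 1) ⊔ (F.N n).map (mx M x)) (F.N (n + 1)) - 
      zl k (F'.N n) (F.N n ⊓ (F'.N (n + 1)).comap (mx M x)) = _
    rw [e1, e2, e3]; ring

end hilbert
end CM
end part_3

section part_4
open Filter
namespace CM
universe u v w

section small
variable {k : Type u} {A : Type v} [CommRing k] [CommRing A] [Algebra k A]
variable {M : Type w} [AddCommGroup M] [Module A M] [Module k M] [IsScalarTower k A M]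
variable {M' : Type*} [AddCommGroup M'] [Module A M'] [Module k M'] [IsScalarTower k A M']

lemma rl_smul_ne_top (I : Ideal A) (hI : I.FG) {P Q : Submodule A M} (h : rl k P Q ≠ ⊤) :
    rl k (I • P) (I • Q) ≠ ⊤ := by
  induction I, hI using Submodule.fg_induction with
  | singleton a =>
    have e : ∀ N : Submodule A M, (Submodule.span A {a} : Ideal A) • N = N.map (mx M a) :=
      fun N => (map_mx_eq a N).symm
    rw [e, e]
    exact ne_top_of_le_ne_top h (rl_map_le _ _ _)
  | sup I₁ I₂ _ _ h1 h2 =>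
    rw [Submodule.sup_smul, Submodule.sup_smul]
    refine ne_top_of_le_ne_top ?_ rl_sup_le
    exact WithTop.add_ne_top.2 ⟨ne_top_of_le_ne_top h1 (rl_anti le_sup_left),
      ne_top_of_le_ne_top h2 (rl_anti le_sup_right)⟩

/-- finiteness of length -/
class FL (k : Type u) {A : Type v} [CommRing k] [CommRing A] [Algebra k A] (J : Ideal A)
    (M : Type w) [AddCommGroup M] [Module A M] [Module k M] [IsScalarTower k A M] : Prop where
  out : rl k (J • ⊤ : Submodule A M) ⊤ ≠ ⊤

variable (J : Ideal A)

lemma fl_pow_step [IsNoetherianRing A] [FL k J M] (n : ℕ) :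
    rl k (J ^ (n + 1) • ⊤ : Submodule A M) (J ^ n • ⊤) ≠ ⊤ := by
  rw [pow_succ, mul_smul]
  exact rl_smul_ne_top _ (IsNoetherian.noetherian _) FL.out

lemma pow_smul_anti (P : Submodule A M) {m n : ℕ} (h : m ≤ n) : J ^ n • P ≤ J ^ m • P :=
  Submodule.smul_mono (Ideal.pow_le_pow_right h) le_rfl

lemma fl_pow [IsNoetherianRing A] [FL k J M] (n : ℕ) :
    rl k (J ^ n • ⊤ : Submodule A M) ⊤ ≠ ⊤ := by
  induction n with
  | zero => simp [rl_self]
  | succ n ih =>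
    rw [rl_add (pow_smul_anti J ⊤ (Nat.le_succ n)) le_top]
    exact WithTop.add_ne_top.2 ⟨fl_pow_step J n, ih⟩

lemma fl_pow' [IsNoetherianRing A] [FL k J M] (n : ℕ) (Q : Submodule A M) :
    rl k (J ^ n • ⊤ : Submodule A M) Q ≠ ⊤ :=
  ne_top_of_le_ne_top (fl_pow J n) (rl_mono le_top)

lemma artin_rees [IsNoetherianRing A] [Module.Finite A M] (W : Submodule A M) :
    ∃ c, ∀ n, J ^ (n + c) • ⊤ ⊓ W ≤ J ^ n • W := by
  obtain ⟨c, hc⟩ := Ideal.exists_pow_inf_eq_pow_smul J W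
  refine ⟨c, fun n => ?_⟩
  rw [hc (n + c) (by omega), Nat.add_sub_cancel]
  exact Submodule.smul_mono le_rfl inf_le_right

lemma fl_sub [IsNoetherianRing A] [Module.Finite A M] [FL k J M] (W : Submodule A M) (n : ℕ) :
    rl k (J ^ n • W) W ≠ ⊤ := by
  obtain ⟨c, hc⟩ := artin_rees J W
  refine ne_top_of_le_ne_top ?_ (rl_anti (hc n))
  rw [rl_inf]
  exact fl_pow' J _ _

lemma map_subtype_smul (I : Ideal A) (W : Submodule A M) (Q : Submodule A W) :
    (I • Q).map W.subtype = I • Q.map W.subtype := Submodule.map_smul'' _ _ _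

instance [IsNoetherianRing A] [Module.Finite A M] [FL k J M] (W : Submodule A M) : FL k J W where
  out := by
    rw [← rl_map W.subtype W.injective_subtype, Submodule.map_smul'', Submodule.map_subtype_top]
    have := fl_sub (k := k) J W 1
    rwa [pow_one] at this

lemma fl_surj (f : M →ₗ[A] M') (hf : Function.Surjective f) [FL k J M] : FL k J M' where
  out := by
    have : (⊤ : Submodule A M') = (⊤ : Submodule A M).map f := by
      rw [Submodule.map_top, LinearMap.range_eq_top.2 hf]
    rw [this, ← Submodule.map_smul'']
    exact ne_top_of_le_ne_top FL.out (rl_map_le _ _ _)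

instance [FL k J M] (W : Submodule A M) : FL k J (M ⧸ W) :=
  fl_surj J W.mkQ W.mkQ_surjective

variable (k)

/-- `W` has dimension `< s`. -/
def Small (s : ℕ) (W : Submodule A M) : Prop := EvP s (fun n => zl k (J ^ n • W) W)

variable {k}

lemma Small.mono {s t : ℕ} {W : Submodule A M} (h : Small k J s W) (hst : s ≤ t) : 
    Small k J t W := EvP.mono h hst

/-- a crude bound -/
lemma exists_list : ∀ (_ : J.FG), ∃ y : List A, (∀ a ∈ y, a ∈ J) ∧ J ≤ Ideal.ofList y := by
  rintro ⟨s, hs⟩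
  refine ⟨s.toList, fun a ha => ?_, ?_⟩
  · rw [← hs]; exact Submodule.subset_span (by simpa using ha)
  · rw [← hs]; apply Submodule.span_mono; intro a ha; simpa using ha

lemma evP_filt [IsNoetherianRing A] [Module.Finite A M] [FL k J M] (y : List A) (hy : ∀ a ∈ y, a ∈ J) 
    (𝔟 : Ideal A) (hJ : J ≤ Ideal.ofList y ⊔ 𝔟) (W : Submodule A M) (hb : 𝔟 • W = ⊥) :
    EvP (y.length + 1) (fun n => zl k (J ^ n • ⊤) W) := by
  let F : J.Filtration M := J.stableFiltration ⊤ ⊓ J.trivialFiltration W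
  have hFN : ∀ n, F.N n = J ^ n • ⊤ ⊓ W := fun n => rfl
  have := hilbert (k := k) y 𝔟 hy hJ F (shiftFilt F)
    ((J.stableFiltration_stable ⊤).of_le (fun n => inf_le_left)) (fun n => F.mono n)
    (fun n => by
      change rl k (F.N (n + 1)) (F.N n) ≠ ⊤
      rw [hFN, hFN]
      refine ne_top_of_le_ne_top (fl_pow' (k := k) J (n + 1) W) ?_
      rw [← rl_inf (P := J ^ (n + 1) • ⊤) (Q := W)]
      exact rl_mono inf_le_right)
    (fun n => by
      refine (Submodule.smul_mono le_rfl (inf_le_right : F.N n ≤ W)).trans ?_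
      exact hb.le.trans bot_le)
  refine Lead.congr (s := y.length) this (Eventually.of_forall fun n => ?_)
  simp only [fd]
  change zl k (F.N (n + 1)) (F.N n) = _
  rw [hFN, hFN]
  have h1 : zl k (J ^ (n + 1) • ⊤ ⊓ W) W = zl k (J ^ (n + 1) • ⊤ ⊓ W) (J ^ n • ⊤ ⊓ W) + 
      zl k (J ^ n • ⊤ ⊓ W) W := zl_add (inf_le_inf_right _ (pow_smul_anti J ⊤ (Nat.le_succ n)))
        inf_le_right (by rw [rl_inf]; exact fl_pow' J _ _)
  have h2 : ∀ m, zl k (J ^ m • ⊤ ⊓ W) W = zl k (J ^ m • ⊤) W := fun m => zl_congr rl_inf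
  rw [h2, h2] at h1
  rw [h1]; ring

lemma evP_self [IsNoetherianRing A] [Module.Finite A M] [FL k J M] (W : Submodule A M) :
    ∃ t, EvP t (fun n => zl k (J ^ n • W) W) := by
  obtain ⟨y, hy, hJ⟩ := exists_list J (IsNoetherian.noetherian _)
  refine ⟨_, (evP_filt (k := k) (M := W) J y hy ⊥ (by simpa using hJ) ⊤ (by simp)).congr
    (Eventually.of_forall fun n => zl_congr ?_)⟩
  rw [← rl_map W.subtype W.injective_subtype, Submodule.map_smul'', Submodule.map_subtype_top]

lemma small_of_le [IsNoetherianRing A] [Module.Finite A M] [FL k J M] {s : ℕ} {W : Submodule A M} 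
    {g : ℕ → ℤ} (hg : EvP s g) (h : ∀ᶠ n in atTop, zl k (J ^ n • W) W ≤ g n) : Small k J s W := by
  obtain ⟨t, ht⟩ := evP_self (k := k) J W
  refine EvP.of_le ht hg ?_ h
  exact (Eventually.of_forall fun n => zl_nonneg _ _)

lemma Small.map [IsNoetherianRing A] [Module.Finite A M] [FL k J M] 
    [Module.Finite A M'] [FL k J M'] {s : ℕ} {W : Submodule A M} (h : Small k J s W) 
    (f : M →ₗ[A] M') : Small k J s (W.map f) := by
  refine small_of_le J h (Eventually.of_forall fun n => zl_le ?_ (fl_sub J W n))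
  rw [← Submodule.map_smul'']
  exact rl_map_le _ _ _

lemma small_map_iff {s : ℕ} {W : Submodule A M} 
    (f : M →ₗ[A] M') (hf : Function.Injective f) : Small k J s (W.map f) ↔ Small k J s W := by
  unfold Small
  simp only [← Submodule.map_smul'']
  have : ∀ n, zl k ((J ^ n • W).map f) (W.map f) = zl k (J ^ n • W) W := 
    fun n => zl_congr (rl_map _ hf _ _)
  simp only [this]

lemma Small.le [IsNoetherianRing A] [Module.Finite A M] [FL k J M] {s : ℕ} {W W' : Submodule A M}
    (h : Small k J s W) (hle : W' ≤ W) : Small k J s W' := by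
  obtain ⟨c, hc⟩ := artin_rees (M := W) J (W'.submoduleOf W)
  refine small_of_le J (Lead.shift c h) (Eventually.of_forall fun n => zl_le ?_ (fl_sub J W _))
  have h1 := Submodule.map_mono (f := W.subtype) (hc n)
  have e : (W'.submoduleOf W).map W.subtype = W' := by
    rw [Submodule.submoduleOf, Submodule.map_comap_subtype, inf_eq_right.2 hle]
  rw [Submodule.map_inf _ W.injective_subtype, Submodule.map_smul'', Submodule.map_smul'', e,
    Submodule.map_subtype_top] at h1
  calc rl k (J ^ n • W') W' ≤ rl k (J ^ (n + c) • W ⊓ W') W' := rl_anti h1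
    _ = rl k (J ^ (n + c) • W) W' := rl_inf
    _ ≤ _ := rl_mono hle

lemma zl_le_add {P Q P' Q' P'' Q'' : Submodule A M} (h : rl k P Q ≤ rl k P' Q' + rl k P'' Q'') 
    (h' : rl k P' Q' ≠ ⊤) (h'' : rl k P'' Q'' ≠ ⊤) : zl k P Q ≤ zl k P' Q' + zl k P'' Q'' := by
  unfold zl
  have := ENat.toNat_le_toNat h (WithTop.add_ne_top.2 ⟨h', h''⟩)
  rw [ENat.toNat_add h' h''] at this
  exact_mod_cast this

lemma Small.sup [IsNoetherianRing A] [Module.Finite A M] [FL k J M] {s : ℕ} {W W' : Submodule A M}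
    (h : Small k J s W) (h' : Small k J s W') : Small k J s (W ⊔ W') := by
  refine small_of_le J (EvP.add h h') (Eventually.of_forall fun n => 
    zl_le_add ?_ (fl_sub J W n) (fl_sub J W' n))
  refine rl_sup_le.trans (add_le_add (rl_anti ?_) (rl_anti ?_)) <;> 
    rw [Submodule.smul_sup]
  exacts [le_sup_left, le_sup_right]

lemma small_bot (s : ℕ) : Small k J s (⊥ : Submodule A M) := 
  Lead.congr (lead_zero s) (Eventually.of_forall fun n => (zl_eq_zero bot_le).symm)

/-- largest small submodule -/
lemma exists_largest [IsNoetherianRing A] [Module.Finite A M] [FL k J M] (s : ℕ) (M₀ : Submodule A M) :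
    ∃ U : Submodule A M, U ≤ M₀ ∧ Small k J s U ∧ ∀ W ≤ M₀, Small k J s W → W ≤ U := by
  have hw : WellFoundedGT (Submodule A M) := inferInstance
  obtain ⟨U, ⟨hU, hU'⟩, hmax⟩ := hw.wf.has_min {W : Submodule A M | W ≤ M₀ ∧ Small k J s W} 
    ⟨⊥, bot_le, small_bot J s⟩
  refine ⟨U, hU, hU', fun W hW hW' => ?_⟩
  by_contra hcon
  apply hmax (U ⊔ W) ⟨sup_le hU hW, hU'.sup J hW'⟩
  exact lt_of_le_of_ne le_sup_left (fun h => hcon (h ▸ le_sup_right))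

lemma Small.ext [IsNoetherianRing A] [Module.Finite A M] [FL k J M] {s : ℕ} {U W : Submodule A M} 
    (h : Small k J s U) (h' : Small k J s (W.map U.mkQ)) (hle : U ≤ W) : Small k J s W := by
  refine small_of_le J (EvP.add h h') (Eventually.of_forall fun n => ?_)
  have : zl k (J ^ n • W.map U.mkQ) (W.map U.mkQ) = zl k (J ^ n • W ⊔ U) W := by
    apply zl_congr
    rw [← Submodule.map_smul'', ← rl_comap, Submodule.comap_map_mkQ, sup_comm]
  rw [this]
  have hle' : J ^ n • W ⊔ U ≤ W := sup_le Submodule.smul_le_right hle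
  have hfin := fl_sub (k := k) J W n
  rw [zl_add (le_sup_left : _ ≤ J ^ n • W ⊔ U) hle' hfin]
  gcongr
  refine zl_le ?_ (fl_sub J U n)
  rw [rl_sup]
  exact rl_anti (Submodule.smul_mono le_rfl hle)

lemma Small.eq_bot [IsNoetherianRing A] [Module.Finite A M] [FL k J M] (hJ : J ≤ Ideal.jacobson ⊥) 
    {W : Submodule A M} (h : Small k J 0 W) : W = ⊥ := by
  obtain ⟨n, hn⟩ := eventually_atTop.1 (show ∀ᶠ n in atTop, zl k (J ^ n • W) W = 0 from h)
  have h1 := le_of_zl (fl_sub J W (n + 1)) (hn (n + 1) (by omega))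
  refine Submodule.eq_bot_of_le_smul_of_le_jacobson_bot J W (IsNoetherian.noetherian _) ?_ hJ
  refine h1.trans (Submodule.smul_mono (Ideal.pow_le_self (by omega)) le_rfl)

lemma zl_quot {U W : Submodule A M} (n : ℕ) (_hle : U ≤ W) : 
    zl k (J ^ n • W.map U.mkQ) (W.map U.mkQ) = zl k (J ^ n • W ⊔ U) W := by
  apply zl_congr
  rw [← Submodule.map_smul'', ← rl_comap, Submodule.comap_map_mkQ, sup_comm]

lemma mx_ar [IsNoetherianRing A] [Module.Finite A M] (y : A) (hy : Function.Injective (mx M y)) :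
    ∃ c, ∀ n, (J ^ (n + c) • ⊤ : Submodule A M).comap (mx M y) ≤ J ^ n • ⊤ := by
  obtain ⟨c, hc⟩ := artin_rees J ((⊤ : Submodule A M).map (mx M y))
  refine ⟨c, fun n m hm => ?_⟩
  have h1 := hc n ⟨hm, ⟨m, trivial, rfl⟩⟩
  rw [← Submodule.map_smul''] at h1
  obtain ⟨m', hm', h⟩ := h1
  rw [← hy h]; exact hm'

lemma Small.quot_regular [IsNoetherianRing A] [Module.Finite A M] [FL k J M] {s : ℕ} (y : A) 
    (hy : Function.Injective (mx M y)) (h : Small k J (s + 1) (⊤ : Submodule A M)) : 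
    Small k J s (⊤ : Submodule A (M ⧸ (⊤ : Submodule A M).map (mx M y))) := by
  obtain ⟨c, hc⟩ := mx_ar J y hy
  obtain ⟨t, ht⟩ := evP_self (k := k) (M := M ⧸ (⊤ : Submodule A M).map (mx M y)) J ⊤
  refine Lead.unshift c ?_
  refine EvP.of_le (Lead.shift c ht) (EvP.diff h c) (Eventually.of_forall fun n => zl_nonneg _ _) 
    (Eventually.of_forall fun n => ?_)
  set Y := (⊤ : Submodule A M).map (mx M y)
  have e : (⊤ : Submodule A (M ⧸ Y)) = (⊤ : Submodule A M).map Y.mkQ := by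
    rw [Submodule.map_top, Submodule.range_mkQ]
  simp only [e]
  rw [zl_quot J _ le_top, zl_add (le_sup_left : J ^ (n + c) • ⊤ ≤ J ^ (n + c) • ⊤ ⊔ Y) le_top 
    (fl_pow J _)]
  have : zl k (J ^ n • ⊤ : Submodule A M) ⊤ ≤ zl k (J ^ (n + c) • ⊤) (J ^ (n + c) • ⊤ ⊔ Y) := by
    refine zl_le ?_ (fl_pow' J _ _)
    rw [rl_sup, ← rl_comap]
    exact rl_anti (hc n)
  linarith

lemma Small.of_quot [IsNoetherianRing A] [Module.Finite A M] [FL k J M] {s : ℕ} (x : A) 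
    (hx : x ∈ J) (h : Small k J s (⊤ : Submodule A (M ⧸ (⊤ : Submodule A M).map (mx M x)))) : 
    Small k J (s + 1) (⊤ : Submodule A M) := by
  obtain ⟨t, ht⟩ := evP_self (k := k) (M := M) J ⊤
  have key : EvP s (fd (fun n => zl k (J ^ n • ⊤) (⊤ : Submodule A M))) := by
    refine EvP.of_le (EvP.fd ht.succ) (Lead.shift 1 h) (Eventually.of_forall fun n => ?_)
      (Eventually.of_forall fun n => ?_)
    · simp only [fd]
      have := zl_le (rl_anti (Q := (⊤ : Submodule A M)) (pow_smul_anti J ⊤ (Nat.le_succ n))) 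
        (fl_pow (k := k) J (n + 1))
      linarith
    set Y := (⊤ : Submodule A M).map (mx M x)
    have e : (⊤ : Submodule A (M ⧸ Y)) = (⊤ : Submodule A M).map Y.mkQ := by
      rw [Submodule.map_top, Submodule.range_mkQ]
    simp only [e, fd]
    rw [zl_quot J _ le_top, zl_add (le_sup_left : J ^ (n + 1) • ⊤ ≤ J ^ (n + 1) • ⊤ ⊔ Y) le_top 
      (fl_pow J _)]
    have : zl k (J ^ (n + 1) • ⊤) (J ^ (n + 1) • ⊤ ⊔ Y) ≤ zl k (J ^ n • ⊤ : Submodule A M) ⊤ := by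
      refine zl_le ?_ (fl_pow J _)
      rw [rl_sup, ← rl_comap]
      apply rl_anti
      rw [← Submodule.map_le_iff_le_comap]
      refine (map_mx_le hx _).trans ?_
      rw [pow_succ', mul_smul]
    linarith
  exact key

end small
end CM
end part_4

section part_5
open Filter
namespace CM
universe u v w

section cmn
variable {k : Type u} {A : Type v} [CommRing k] [CommRing A] [Algebra k A]
variable {M : Type w} [AddCommGroup M] [Module A M] [Module k M] [IsScalarTower k A M]
variable (J : Ideal A)

lemma upper_bound (y : List A) : ∀ (𝔟 : Ideal A), (∀ a ∈ y, a ∈ J) → J ≤ Ideal.ofList y ⊔ 𝔟 → 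
    ∀ (F' : ℕ → Submodule A M), (∀ n, J • F' n ≤ F' (n + 1)) → 
    (∀ n, 𝔟 • (J ^ n • ⊤ : Submodule A M) ≤ F' (n + 1)) → 
    ∀ n, rl k (F' n) (J ^ n • ⊤) ≤ rl k (F' 0) ⊤ * (Nat.multichoose y.length n : ℕ) := by
  induction y with
  | nil =>
    intro 𝔟 hy hJ F' hF' hb n
    cases n with
    | zero => simp
    | succ n =>
      simp only [List.length_nil, Nat.multichoose_zero_succ, Nat.cast_zero, mul_zero, nonpos_iff_eq_zero]
      rw [rl_eq_zero, pow_succ', mul_smul]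
      simp only [Ideal.ofList_nil, bot_sup_eq] at hJ
      exact (Submodule.smul_mono hJ le_rfl).trans (hb n)
  | cons x y ih =>
    intro 𝔟 hy hJ F' hF' hb n
    have hxJ : x ∈ J := hy x (by simp)
    have hy' : ∀ a ∈ y, a ∈ J := fun a ha => hy a (by simp [ha])
    have hJ' : J ≤ Ideal.ofList y ⊔ (Ideal.span {x} ⊔ 𝔟) := by
      refine hJ.trans (le_of_eq ?_)
      rw [Ideal.ofList_cons, ← sup_assoc]
      congr 1
      rw [sup_comm]
    induction n with
    | zero => simp
    | succ n ihn =>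
      let F'' : ℕ → Submodule A M := fun n => Nat.casesOn n (F' 0) 
        (fun n => F' (n + 1) ⊔ (J ^ n • ⊤ : Submodule A M).map (mx M x))
      have h2 := ih (Ideal.span {x} ⊔ 𝔟) hy' hJ' F'' (by
        intro n
        cases n with
        | zero => exact (hF' 0).trans le_sup_left
        | succ n => 
          change J • (F' (n + 1) ⊔ (J ^ n • ⊤ : Submodule A M).map (mx M x)) ≤ 
            F' (n + 2) ⊔ (J ^ (n + 1) • ⊤ : Submodule A M).map (mx M x)
          rw [Submodule.smul_sup, ← Submodule.map_smul'', pow_succ', mul_smul]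
          exact sup_le_sup (hF' _) le_rfl) (by
        intro n
        rw [Submodule.sup_smul, ← map_mx_eq]
        exact sup_le le_sup_right ((hb n).trans le_sup_left)) (n + 1)
      calc rl k (F' (n + 1)) (J ^ (n + 1) • ⊤) 
          ≤ rl k (F' (n + 1)) (F'' (n + 1)) + rl k (F'' (n + 1)) (J ^ (n + 1) • ⊤) := rl_tri _ _ _
        _ ≤ rl k (F' n) (J ^ n • ⊤) + rl k (F' 0) ⊤ * (Nat.multichoose y.length (n + 1) : ℕ) := by
            refine add_le_add ?_ h2
            change rl k (F' (n + 1)) (F' (n + 1) ⊔ (J ^ n • ⊤ : Submodule A M).map (mx M x)) ≤ _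
            rw [rl_sup, ← rl_comap]
            apply rl_anti
            rw [← Submodule.map_le_iff_le_comap]
            exact (map_mx_le hxJ _).trans (hF' n)
        _ ≤ rl k (F' 0) ⊤ * (Nat.multichoose (y.length + 1) n : ℕ) + 
            rl k (F' 0) ⊤ * (Nat.multichoose y.length (n + 1) : ℕ) := by gcongr; exact ihn
        _ = _ := by
          rw [List.length_cons, Nat.multichoose_succ_succ, ← mul_add, add_comm]; push_cast; rfl

/-- Hilbert function of Cohen-Macaulay type -/
def CMn (k : Type u) {A : Type v} [CommRing k] [CommRing A] [Algebra k A] (J : Ideal A)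
    (M : Type w) [AddCommGroup M] [Module A M] [Module k M] [IsScalarTower k A M] (r : ℕ) : Prop := ∀ n, rl k (J ^ (n + 1) • ⊤ : Submodule A M) (J ^ n • ⊤) = 
    rl k (J • ⊤ : Submodule A M) ⊤ * (Nat.multichoose r n : ℕ)

lemma le_of_rl_eq {P P' Q : Submodule A M} (h : P ≤ P') (hf : rl k P Q ≠ ⊤) 
    (he : rl k P Q ≤ rl k P' Q) : P' ⊓ Q ≤ P := by
  rw [rl_add_le (S := Q) h] at he hf
  have h1 := (WithTop.add_ne_top.1 hf).2
  rw [← rl_eq_zero (k := k)]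
  have h2 : rl k P (P' ⊓ Q) + rl k P' Q ≤ 0 + rl k P' Q := by simpa using he
  exact nonpos_iff_eq_zero.1 ((WithTop.add_le_add_iff_right h1).1 h2)

/-- the filtration modulo `x` -/
noncomputable def Fx (M : Type w) [AddCommGroup M] [Module A M] (x : A) (n : ℕ) : Submodule A M :=
  Nat.casesOn n (J • ⊤) (fun n => J ^ (n + 2) • ⊤ ⊔ (J ^ n • ⊤ : Submodule A M).map (mx M x))

lemma Fx_bound (x : A) (y : List A) (hy : ∀ a ∈ y, a ∈ J) (𝔟 : Ideal A) 
    (hJ : J ≤ Ideal.ofList (x :: y) ⊔ 𝔟) (hb : 𝔟 • (⊤ : Submodule A M) = ⊥) (n : ℕ) : 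
    rl k (Fx J M x n) (J ^ n • ⊤) ≤ 
      rl k (J • ⊤ : Submodule A M) ⊤ * (Nat.multichoose y.length n : ℕ) := by
  have hJ' : J ≤ Ideal.ofList y ⊔ (Ideal.span {x} ⊔ 𝔟) := by
      refine hJ.trans (le_of_eq ?_)
      rw [Ideal.ofList_cons, ← sup_assoc]
      congr 1
      rw [sup_comm]
  refine upper_bound J y (Ideal.span {x} ⊔ 𝔟) hy hJ' (Fx J M x) ?_ ?_ n
  · intro n
    cases n with
    | zero => 
      change J • J • ⊤ ≤ J ^ 2 • ⊤ ⊔ _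
      rw [pow_two, mul_smul]; exact le_sup_left
    | succ n => 
      change J • (J ^ (n + 2) • ⊤ ⊔ (J ^ n • ⊤ : Submodule A M).map (mx M x)) ≤ 
        J ^ (n + 3) • ⊤ ⊔ (J ^ (n + 1) • ⊤ : Submodule A M).map (mx M x)
      rw [Submodule.smul_sup, ← Submodule.map_smul'', pow_succ' J n, mul_smul J (J ^ n), 
        pow_succ' J (n + 2), mul_smul J (J ^ (n + 2))]
  · intro n
    rw [Submodule.sup_smul, ← map_mx_eq]
    refine sup_le le_sup_right ?_
    refine le_trans (Submodule.smul_mono le_rfl le_top) ?_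
    rw [hb]; exact bot_le

lemma rl_step (x : A) (hx : x ∈ J) (n : ℕ) : 
    rl k (J ^ (n + 2) • ⊤ : Submodule A M) (J ^ (n + 1) • ⊤) = 
    rl k ((J ^ (n + 2) • ⊤ : Submodule A M).comap (mx M x)) (J ^ n • ⊤) + 
    rl k (Fx J M x (n + 1)) (J ^ (n + 1) • ⊤) := by
  have e : rl k ((J ^ (n + 2) • ⊤ : Submodule A M).comap (mx M x)) (J ^ n • ⊤) = 
      rl k (J ^ (n + 2) • ⊤ : Submodule A M) (Fx J M x (n + 1)) := by
    rw [rl_comap]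
    exact rl_sup.symm
  rw [e]
  apply rl_add
  · exact le_sup_left (a := (J ^ (n + 2) • ⊤ : Submodule A M))
  · apply sup_le (pow_smul_anti J ⊤ (by omega))
    refine (map_mx_le hx _).trans ?_
    rw [pow_succ', mul_smul]

lemma enat_aux {l p q : ℕ} {X Y : ℕ∞} (h1 : (l : ℕ∞) * ((p + q : ℕ) : ℕ∞) = X + Y) 
    (h2 : Y ≤ l * p) (h3 : X ≤ l * q) : l * q ≤ X ∧ Y = l * p := by
  obtain ⟨a, rfl⟩ := ENat.ne_top_iff_exists.1 (ne_top_of_le_ne_top (by 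
      exact_mod_cast WithTop.coe_ne_top) h3)
  obtain ⟨b, rfl⟩ := ENat.ne_top_iff_exists.1 (ne_top_of_le_ne_top (by 
      exact_mod_cast WithTop.coe_ne_top) h2)
  norm_cast at *
  constructor <;> nlinarith

lemma comap_mx_ge (x : A) (hx : x ∈ J) (n : ℕ) : 
    (J ^ n • ⊤ : Submodule A M) ≤ (J ^ (n + 1) • ⊤ : Submodule A M).comap (mx M x) := by
  rw [← Submodule.map_le_iff_le_comap]
  refine (map_mx_le hx _).trans ?_
  rw [pow_succ', mul_smul]

lemma quot_rl (x : A) (n : ℕ) : 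
    rl k (J ^ (n + 1) • ⊤ : Submodule A (M ⧸ (⊤ : Submodule A M).map (mx M x))) (J ^ n • ⊤) = 
    rl k (J ^ (n + 1) • ⊤ ⊔ (⊤ : Submodule A M).map (mx M x)) (J ^ n • ⊤) := by
  set Y := (⊤ : Submodule A M).map (mx M x)
  have e : (⊤ : Submodule A (M ⧸ Y)) = (⊤ : Submodule A M).map Y.mkQ := by
    rw [Submodule.map_top, Submodule.range_mkQ]
  rw [e, ← Submodule.map_smul'', ← Submodule.map_smul'', ← rl_comap, Submodule.comap_map_mkQ, 
    sup_comm]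

lemma quot_rl0 (x : A) (hx : x ∈ J) : 
    rl k (J • ⊤ : Submodule A (M ⧸ (⊤ : Submodule A M).map (mx M x))) ⊤ = 
    rl k (J • ⊤ : Submodule A M) ⊤ := by
  have := quot_rl (k := k) (M := M) J x 0
  simp only [zero_add, pow_one, pow_zero, Ideal.one_eq_top, Submodule.top_smul] at this
  rw [this, sup_eq_left.2 (map_mx_le hx _)]

lemma Fx_inf (x : A) (hx : x ∈ J) 
    (h : ∀ n, (J ^ (n + 1) • ⊤ : Submodule A M).comap (mx M x) = J ^ n • ⊤) (n : ℕ) :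
    (J ^ (n + 1) • ⊤ ⊔ (⊤ : Submodule A M).map (mx M x)) ⊓ (J ^ n • ⊤) = 
      Fx J M x n := by
  cases n with
  | zero =>
    simp only [zero_add, pow_one, pow_zero, Ideal.one_eq_top, Submodule.top_smul, inf_top_eq]
    rw [sup_eq_left.2 (map_mx_le hx _)]; rfl
  | succ n =>
    have e : (⊤ : Submodule A M).map (mx M x) ⊓ J ^ (n + 1) • ⊤ = (J ^ n • ⊤ : Submodule A M).map (mx M x) := by
      rw [inf_comm, ← h n, Submodule.map_comap_eq, ← Submodule.map_top, inf_comm]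
    rw [sup_inf_assoc_of_le _ (pow_smul_anti J ⊤ (Nat.le_succ _)), e]; rfl

variable [IsNoetherianRing A] [Module.Finite A M] [FL k J M]

lemma CMn.colon {x : A} (hx : x ∈ J) {y : List A} (hy : ∀ a ∈ y, a ∈ J) {𝔟 : Ideal A} 
    (hJ : J ≤ Ideal.ofList (x :: y) ⊔ 𝔟) (hb : 𝔟 • (⊤ : Submodule A M) = ⊥) 
    (h : CMn k J M (y.length + 1)) : 
    (∀ n, (J ^ (n + 1) • ⊤ : Submodule A M).comap (mx M x) = J ^ n • ⊤) ∧ 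
    (∀ n, rl k (Fx J M x n) (J ^ n • ⊤) = 
      rl k (J • ⊤ : Submodule A M) ⊤ * (Nat.multichoose y.length n : ℕ)) := by
  have hl := FL.out (k := k) (J := J) (M := M)
  obtain ⟨l, hl'⟩ := ENat.ne_top_iff_exists.1 hl
  have hbd := Fx_bound (k := k) J x y hy 𝔟 hJ hb
  have hle := fun n => rl_anti (k := k) (Q := (J ^ n • ⊤ : Submodule A M)) 
    (comap_mx_ge (M := M) J x hx (n + 1))
  have key : ∀ n, rl k (J ^ (n + 1) • ⊤ : Submodule A M) (J ^ n • ⊤) ≤ 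
      rl k ((J ^ (n + 2) • ⊤ : Submodule A M).comap (mx M x)) (J ^ n • ⊤) ∧ 
      rl k (Fx J M x (n + 1)) (J ^ (n + 1) • ⊤) = 
      rl k (J • ⊤ : Submodule A M) ⊤ * (Nat.multichoose y.length (n + 1) : ℕ) := by
    intro n
    have h1 := rl_step (k := k) (M := M) J x hx n
    have h2 := hbd (n + 1)
    have h3 := hle n
    rw [h, Nat.multichoose_succ_succ] at h1
    rw [h] at h3 ⊢
    rw [← hl'] at h1 h2 h3 ⊢
    exact enat_aux h1 h2 h3
  have col : ∀ n, (J ^ (n + 1) • ⊤ : Submodule A M).comap (mx M x) ⊓ (J ^ n • ⊤) = (J ^ n • ⊤) ∧ 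
      (J ^ (n + 2) • ⊤ : Submodule A M).comap (mx M x) ⊓ (J ^ n • ⊤) ≤ (J ^ (n + 1) • ⊤) := by
    intro n
    exact ⟨inf_eq_right.2 (comap_mx_ge J x hx n), 
      le_of_rl_eq (comap_mx_ge J x hx (n + 1)) (fl_pow_step J n) (key n).1⟩
  constructor
  · intro n
    refine le_antisymm ?_ (comap_mx_ge J x hx n)
    have : ∀ j ≤ n, (J ^ (n + 1) • ⊤ : Submodule A M).comap (mx M x) ≤ J ^ j • ⊤ := by
      intro j hj
      induction j with
      | zero => simp
      | succ j ih =>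
        refine le_trans (le_inf (Submodule.comap_mono (pow_smul_anti J ⊤ (by omega))) (ih (by omega)))
          (col j).2
    exact this n le_rfl
  · intro n
    cases n with
    | zero => simp [Fx]
    | succ n => exact (key n).2

lemma krull (hJJ : J ≤ Ideal.jacobson ⊥) {m : M} (h : ∀ n, m ∈ (J ^ n • ⊤ : Submodule A M)) : m = 0 := by
  have := Ideal.iInf_pow_smul_eq_bot_of_le_jacobson (M := M) J hJJ
  have h1 : m ∈ (⨅ i, J ^ i • ⊤ : Submodule A M) := by
    rw [Submodule.mem_iInf]; exact h
  rw [this] at h1; simpa using h1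

lemma CMn.regular (hJJ : J ≤ Ideal.jacobson ⊥) {x : A} (hx : x ∈ J) {y : List A} (hy : ∀ a ∈ y, a ∈ J) {𝔟 : Ideal A} 
    (hJ : J ≤ Ideal.ofList (x :: y) ⊔ 𝔟) (hb : 𝔟 • (⊤ : Submodule A M) = ⊥) 
    (h : CMn k J M (y.length + 1)) : Function.Injective (mx M x) ∧ 
    CMn k J (M ⧸ (⊤ : Submodule A M).map (mx M x)) y.length := by
  obtain ⟨h1, h2⟩ := h.colon J hx hy hJ hb
  constructor
  · rw [← LinearMap.ker_eq_bot, eq_bot_iff]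
    intro m hm
    refine krull J hJJ fun n => ?_
    rw [← h1 n]
    change mx M x m ∈ (J ^ (n + 1) • ⊤ : Submodule A M)
    rw [LinearMap.mem_ker.1 hm]
    exact zero_mem _
  · intro n
    rw [quot_rl, quot_rl0 J x hx, ← h2 n, ← Fx_inf J x hx h1, rl_inf]

lemma CMn.of_quot {x : A} (hx : x ∈ J) {y : List A} (hy : ∀ a ∈ y, a ∈ J) {𝔟 : Ideal A} 
    (hJ : J ≤ Ideal.ofList (x :: y) ⊔ 𝔟) (hb : 𝔟 • (⊤ : Submodule A M) = ⊥) 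
    (hreg : Function.Injective (mx M x)) 
    (h : CMn k J (M ⧸ (⊤ : Submodule A M).map (mx M x)) y.length) : 
    CMn k J M (y.length + 1) := by
  have hl := FL.out (k := k) (J := J) (M := M)
  have hbd := Fx_bound (k := k) J x y hy 𝔟 hJ hb
  set Y := (⊤ : Submodule A M).map (mx M x) with hY
  have hle : ∀ n, Fx J M x n ≤ J ^ (n + 1) • ⊤ ⊔ Y := by
    intro n
    cases n with
    | zero => simp [Fx]
    | succ n => exact sup_le_sup le_rfl (Submodule.map_mono le_top)
  have heq : ∀ n, rl k (J ^ (n + 1) • ⊤ ⊔ Y) (J ^ n • ⊤) = 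
      rl k (J • ⊤ : Submodule A M) ⊤ * (Nat.multichoose y.length n : ℕ) := by
    intro n
    have := h n
    rwa [quot_rl, quot_rl0 J x hx] at this
  have h1 : ∀ n, (J ^ (n + 1) • ⊤ ⊔ Y) ⊓ (J ^ n • ⊤) ≤ Fx J M x n := by
    intro n
    refine le_of_rl_eq (k := k) (hle n) ?_ ((hbd n).trans (heq n).ge)
    refine ne_top_of_le_ne_top ?_ (hbd n)
    obtain ⟨l, hl'⟩ := ENat.ne_top_iff_exists.1 hl
    rw [← hl']
    exact_mod_cast WithTop.coe_ne_top
  have h2 : ∀ n, rl k (Fx J M x n) (J ^ n • ⊤) = 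
      rl k (J • ⊤ : Submodule A M) ⊤ * (Nat.multichoose y.length n : ℕ) := fun n => 
    le_antisymm (hbd n) ((heq n).ge.trans (rl_anti (hle n)))
  obtain ⟨c, hc⟩ := artin_rees J Y
  have h3 : ∀ n p, Y ⊓ J ^ (n + 1) • ⊤ ≤ J ^ (n + 1 + p) • ⊤ ⊔ (J ^ n • ⊤ : Submodule A M).map (mx M x) := by
    intro n p
    induction p with
    | zero => exact inf_le_right.trans le_sup_left
    | succ p ih =>
      intro m hm
      obtain ⟨a, ha, b, hb, hab⟩ := Submodule.mem_sup.1 (ih hm)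
      have hbY : b ∈ Y := Submodule.map_mono le_top hb
      have haY : a ∈ Y := by
        have : a = m - b := by rw [← hab]; abel
        rw [this]; exact sub_mem hm.1 hbY
      have ha' := h1 (n + 1 + p) ⟨Submodule.mem_sup_right haY, ha⟩
      have : Fx J M x (n + 1 + p) ≤ J ^ (n + 1 + (p + 1)) • ⊤ ⊔ (J ^ n • ⊤ : Submodule A M).map (mx M x) := by
        rw [show n + 1 + p = n + p + 1 by omega]
        refine sup_le_sup (le_of_eq ?_) (Submodule.map_mono (pow_smul_anti J ⊤ (by omega)))
        congr 2; omega
      rw [← hab]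
      exact add_mem (this ha') (Submodule.mem_sup_right hb)
  have h4 : ∀ n, Y ⊓ J ^ (n + 1) • ⊤ ≤ (J ^ n • ⊤ : Submodule A M).map (mx M x) := by
    intro n m hm
    obtain ⟨a, ha, b, hb, hab⟩ := Submodule.mem_sup.1 (h3 n c hm)
    have hbY : b ∈ Y := Submodule.map_mono le_top hb
    have haY : a ∈ Y := by
      have : a = m - b := by rw [← hab]; abel
      rw [this]; exact sub_mem hm.1 hbY
    have ha' := hc n ⟨pow_smul_anti J ⊤ (by omega) ha, haY⟩
    rw [hY, ← Submodule.map_smul''] at ha'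
    rw [← hab]; exact add_mem ha' hb
  have h5 : ∀ n, (J ^ (n + 1) • ⊤ : Submodule A M).comap (mx M x) ≤ J ^ n • ⊤ := by
    intro n m hm
    obtain ⟨m', hm', he⟩ := h4 n ⟨⟨m, trivial, rfl⟩, hm⟩
    rw [← hreg he]; exact hm'
  intro n
  induction n with
  | zero => simp
  | succ n ih =>
    rw [rl_step J x hx, h2, le_antisymm (h5 (n + 1)) (comap_mx_ge J x hx (n + 1)), ih, 
      Nat.multichoose_succ_succ, ← mul_add, add_comm]
    push_cast; rfl

end cmn
end CM
end part_5

section part_6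
open Filter
namespace CM
universe u v w

lemma coset_avoid {A : Type v} [CommRing A] (x : A) (I : Ideal A) (S : Finset (Ideal A)) 
    (hp : ∀ P ∈ S, P.IsPrime) (h : ∀ P ∈ S, ¬ (x ∈ P ∧ I ≤ P)) : ∃ i ∈ I, ∀ P ∈ S, x + i ∉ P := by
  classical
  induction hn : S.card generalizing S with
  | zero =>
    rw [Finset.card_eq_zero] at hn
    subst hn
    exact ⟨0, zero_mem _, by simp⟩
  | succ n ih =>
    have hne : S.Nonempty := Finset.card_pos.1 (by omega)
    obtain ⟨P, hP, hmin⟩ := S.exists_minimal hne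
    obtain ⟨i, hi, hi'⟩ := ih (S.erase P) (fun Q hQ => hp Q (Finset.mem_of_mem_erase hQ)) 
      (fun Q hQ => h Q (Finset.mem_of_mem_erase hQ)) (by rw [Finset.card_erase_of_mem hP, hn]; rfl)
    by_cases hxi : x + i ∈ P
    · have hIP : ¬ I ≤ P := fun hle => h P hP ⟨by 
        have := sub_mem hxi (hle hi); simpa using this, hle⟩
      have := hp P hP
      have h2 : ¬ (I ⊓ (S.erase P).inf id) ≤ P := by
        intro hle
        rcases (Ideal.IsPrime.inf_le (hp P hP)).1 hle with h3 | h3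
        · exact hIP h3
        · obtain ⟨Q, hQ, hQP⟩ := (Ideal.IsPrime.inf_le' (hp P hP)).1 h3
          have := hmin (Finset.mem_of_mem_erase hQ) hQP
          exact (Finset.ne_of_mem_erase hQ) (le_antisymm hQP this)
      obtain ⟨j, hj, hjP⟩ := SetLike.not_le_iff_exists.1 h2
      refine ⟨i + j, add_mem hi hj.1, fun Q hQ hmem => ?_⟩
      by_cases hQP : Q = P
      · subst hQP
        apply hjP
        have := sub_mem hmem hxi
        rwa [show x + (i + j) - (x + i) = j by ring] at this
      · have hQ' : Q ∈ S.erase P := Finset.mem_erase.2 ⟨hQP, hQ⟩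
        have hjQ : j ∈ Q := (Finset.inf_le (f := id) hQ') hj.2
        apply hi' Q hQ'
        have := sub_mem hmem hjQ
        rwa [show x + (i + j) - j = x + i by ring] at this
    · refine ⟨i, hi, fun Q hQ => ?_⟩
      by_cases hQP : Q = P
      · rw [hQP]; exact hxi
      · exact hi' Q (Finset.mem_erase.2 ⟨hQP, hQ⟩)

section pure
variable {k : Type u} {A : Type v} [CommRing k] [CommRing A] [Algebra k A]
variable {M : Type w} [AddCommGroup M] [Module A M] [Module k M] [IsScalarTower k A M]
variable {M' : Type*} [AddCommGroup M'] [Module A M'] [Module k M'] [IsScalarTower k A M']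
variable (J : Ideal A)

/-- no nonzero submodules of dimension `< s` -/
def Pure (k : Type u) {A : Type v} [CommRing k] [CommRing A] [Algebra k A] (J : Ideal A)
    (M : Type w) [AddCommGroup M] [Module A M] [Module k M] [IsScalarTower k A M] (s : ℕ) : Prop :=
  ∀ W : Submodule A M, Small k J s W → W = ⊥

/-- multiples of `x` in the module -/
noncomputable abbrev xM (M : Type w) [AddCommGroup M] [Module A M] (x : A) : Submodule A M :=
  (⊤ : Submodule A M).map (mx M x)

lemma mem_xM {x : A} {m : M} : m ∈ xM M x ↔ ∃ m', x • m' = m := by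
  simp [xM]

lemma Pure.of_injective {s : ℕ} (f : M →ₗ[A] M') (hf : Function.Injective f) (h : Pure k J M' s) : 
    Pure k J M s := by
  intro W hW
  have := h (W.map f) ((small_map_iff J f hf).2 hW)
  exact Submodule.map_injective_of_injective hf (this.trans (Submodule.map_bot f).symm)

lemma inj_iff {a : A} : Function.Injective (mx M a) ↔ ∀ m : M, a • m = 0 → m = 0 := by
  rw [← LinearMap.ker_eq_bot, LinearMap.ker_eq_bot']; rfl

lemma inj_iff_ass [IsNoetherianRing A] {a : A} : Function.Injective (mx M a) ↔ 
    ∀ P ∈ associatedPrimes A M, a ∉ P := by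
  have h := biUnion_associatedPrimes_eq_compl_regular A M
  have h1 : a ∈ (⋃ p ∈ associatedPrimes A M, (p : Set A)) ↔ ¬ IsSMulRegular M a := by
    rw [h]; rfl
  have h2 : IsSMulRegular M a ↔ Function.Injective (mx M a) := Iff.rfl
  rw [← h2, ← not_iff_not, ← h1]
  simp

lemma Pure.of_quot [IsNoetherianRing A] [Module.Finite A M] [FL k J M] (hJJ : J ≤ Ideal.jacobson ⊥) 
    {y : A} (hy : y ∈ J) {s : ℕ} (hreg : Function.Injective (mx M y)) 
    (h : Pure k J (M ⧸ xM M y) s) : Pure k J M (s + 1) := by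
  obtain ⟨K, -, hK, hmax⟩ := exists_largest (k := k) (M := M) J (s + 1) ⊤
  suffices K = ⊥ by
    intro W hW
    rw [eq_bot_iff, ← this]; exact hmax W le_top hW
  have hsat : K.comap (mx M y) ≤ K := by
    apply hmax _ le_top
    rw [← small_map_iff J (mx M y) hreg]
    exact hK.le J (Submodule.map_comap_le _ _)
  have hKs : Small k J (s + 1) (⊤ : Submodule A K) := by
    rw [← small_map_iff J K.subtype K.injective_subtype, Submodule.map_subtype_top]; exact hK
  have hregK : Function.Injective (mx K y) := by
    rw [inj_iff] at hreg ⊢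
    intro m hm
    exact Subtype.ext (hreg m (congrArg Subtype.val hm))
  have h1 := hKs.quot_regular J y hregK
  let g : (K ⧸ xM K y) →ₗ[A] (M ⧸ xM M y) := Submodule.mapQ _ _ K.subtype (by
    rw [← Submodule.map_le_iff_le_comap]
    rintro _ ⟨_, ⟨m, -, rfl⟩, rfl⟩
    exact ⟨m, trivial, rfl⟩)
  have h2 := h _ (h1.map J g)
  have h3 : K ≤ xM M y := by
    intro m hm
    have : g (Submodule.Quotient.mk ⟨m, hm⟩) ∈ (⊥ : Submodule A (M ⧸ xM M y)) := by
      rw [← h2]; exact ⟨_, trivial, rfl⟩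
    have h4 : (Submodule.Quotient.mk m : M ⧸ xM M y) = 0 := (Submodule.mem_bot A).1 this
    exact (Submodule.Quotient.mk_eq_zero _).1 h4
  refine Submodule.eq_bot_of_le_smul_of_le_jacobson_bot J K (IsNoetherian.noetherian _) ?_ hJJ
  intro m hm
  obtain ⟨m', rfl⟩ := mem_xM.1 (h3 hm)
  exact Submodule.smul_mem_smul hy (hsat hm)

lemma smul_top_quot {𝔟 : Ideal A} (hb : 𝔟 • (⊤ : Submodule A M) = ⊥) (W : Submodule A M) : 
    𝔟 • (⊤ : Submodule A (M ⧸ W)) = ⊥ := by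
  have e : (⊤ : Submodule A (M ⧸ W)) = (⊤ : Submodule A M).map W.mkQ := by
    rw [Submodule.map_top, Submodule.range_mkQ]
  rw [e, ← Submodule.map_smul'', hb, Submodule.map_bot]

lemma smul_top_quot_x {𝔟 : Ideal A} (hb : 𝔟 • (⊤ : Submodule A M) = ⊥) (x : A) : 
    (Ideal.span {x} ⊔ 𝔟) • (⊤ : Submodule A (M ⧸ xM M x)) = ⊥ := by
  rw [Submodule.sup_smul, smul_top_quot hb, sup_bot_eq, ← map_mx_eq, eq_bot_iff]
  rintro _ ⟨m, -, rfl⟩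
  obtain ⟨m, rfl⟩ := Submodule.mkQ_surjective _ m
  change x • Submodule.mkQ _ m ∈ _
  rw [← map_smul, Submodule.mem_bot, Submodule.mkQ_apply, Submodule.Quotient.mk_eq_zero]
  exact ⟨m, trivial, rfl⟩

lemma le_cons {x : A} {y : List A} {𝔟 : Ideal A} (hJ : J ≤ Ideal.ofList (x :: y) ⊔ 𝔟) : 
    J ≤ Ideal.ofList y ⊔ (Ideal.span {x} ⊔ 𝔟) := by
  refine hJ.trans (le_of_eq ?_)
  rw [Ideal.ofList_cons, ← sup_assoc]
  congr 1
  rw [sup_comm]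

lemma CMn.pure [IsNoetherianRing A] (hJJ : J ≤ Ideal.jacobson ⊥) (y : List A) : 
    ∀ (M : Type w) [AddCommGroup M] [Module A M] [Module k M] [IsScalarTower k A M] 
    [Module.Finite A M] [FL k J M] (𝔟 : Ideal A) (_ : ∀ a ∈ y, a ∈ J) 
    (_ : J ≤ Ideal.ofList y ⊔ 𝔟) (_ : 𝔟 • (⊤ : Submodule A M) = ⊥) 
    (_ : CMn k J M y.length), Pure k J M y.length := by
  induction y with
  | nil =>
    intro M _ _ _ _ _ _ 𝔟 hy hJ hb h W hW
    exact hW.eq_bot J hJJ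
  | cons x y ih =>
    intro M _ _ _ _ _ _ 𝔟 hy hJ hb h
    have hx : x ∈ J := hy x (by simp)
    have hy' : ∀ a ∈ y, a ∈ J := fun a ha => hy a (by simp [ha])
    obtain ⟨h1, h2⟩ := CMn.regular J hJJ hx hy' hJ hb h
    exact Pure.of_quot J hJJ hx h1 (ih _ (Ideal.span {x} ⊔ 𝔟) hy' (le_cons J hJ) 
      (smul_top_quot_x hb x) h2)

/-- swapping of quotients -/
noncomputable def swapEquiv (M : Type w) [AddCommGroup M] [Module A M] (a y : A) : 
    ((M ⧸ xM M a) ⧸ xM (M ⧸ xM M a) y) ≃ₗ[A] ((M ⧸ xM M y) ⧸ xM (M ⧸ xM M y) a) := by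
  have key : ∀ a y : A, xM (M ⧸ xM M a) y = (xM M y).map (xM M a).mkQ := by
    intro a y
    ext m
    constructor
    · rintro ⟨m, -, rfl⟩
      obtain ⟨m, rfl⟩ := Submodule.mkQ_surjective _ m
      exact ⟨y • m, ⟨m, trivial, rfl⟩, rfl⟩
    · rintro ⟨_, ⟨m, -, rfl⟩, rfl⟩
      exact ⟨Submodule.mkQ _ m, trivial, rfl⟩
  exact (Submodule.quotEquivOfEq _ _ (key a y)).trans 
    ((Submodule.quotientQuotientEquivQuotientSup _ _).trans 
    ((Submodule.quotEquivOfEq _ _ (sup_comm _ _)).trans 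
    ((Submodule.quotientQuotientEquivQuotientSup _ _).symm.trans 
    (Submodule.quotEquivOfEq _ _ (key y a).symm))))

lemma regular_swap {a y : A} (ha : Function.Injective (mx M a)) 
    (hy : Function.Injective (mx (M ⧸ xM M a) y)) : Function.Injective (mx (M ⧸ xM M y) a) := by
  rw [inj_iff] at ha hy ⊢
  intro m hm
  obtain ⟨u, rfl⟩ := Submodule.mkQ_surjective _ m
  rw [← map_smul, Submodule.mkQ_apply, Submodule.Quotient.mk_eq_zero, mem_xM] at hm
  obtain ⟨v, hv⟩ := hm
  have h1 := hy (Submodule.mkQ _ v) (by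
    rw [← map_smul, Submodule.mkQ_apply, Submodule.Quotient.mk_eq_zero, mem_xM]
    exact ⟨u, hv.symm⟩)
  rw [Submodule.mkQ_apply, Submodule.Quotient.mk_eq_zero, mem_xM] at h1
  obtain ⟨w, rfl⟩ := h1
  rw [Submodule.mkQ_apply, Submodule.Quotient.mk_eq_zero, mem_xM]
  refine ⟨w, ?_⟩
  have := ha (u - y • w) (by rw [smul_sub, ← hv, smul_comm, sub_self])
  rw [sub_eq_zero] at this
  exact this.symm

lemma CMn.pure_quot [IsNoetherianRing A] (hJJ : J ≤ Ideal.jacobson ⊥) (y : List A) : 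
    ∀ (M : Type w) [AddCommGroup M] [Module A M] [Module k M] [IsScalarTower k A M] 
    [Module.Finite A M] [FL k J M] (𝔟 : Ideal A) (x : A) (_ : x ∈ J) (_ : ∀ a ∈ y, a ∈ J) 
    (_ : J ≤ Ideal.ofList (x :: y) ⊔ 𝔟) (_ : 𝔟 • (⊤ : Submodule A M) = ⊥) 
    (_ : CMn k J M (y.length + 1)) (a : A) (_ : Function.Injective (mx M a)), 
    Pure k J (M ⧸ xM M a) y.length := by
  induction y with
  | nil =>
    intro M _ _ _ _ _ _ 𝔟 x hx hy hJ hb h a ha W hW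
    exact hW.eq_bot J hJJ
  | cons y2 ys ih =>
    intro M _ _ _ _ _ _ 𝔟 y1 hy1 hy hJ hb h a ha
    have hy2 : y2 ∈ J := hy y2 (by simp)
    have hys : ∀ a ∈ ys, a ∈ J := fun a ha => hy a (by simp [ha])
    obtain ⟨r1, c1⟩ := CMn.regular J hJJ hy1 hy hJ hb h
    obtain ⟨r2, -⟩ := CMn.regular J hJJ hy2 hys (le_cons J hJ) (smul_top_quot_x hb y1) c1
    have htors : ∀ v : M, (∀ j ∈ J, j • v ∈ xM M a) → v ∈ xM M a := by
      intro v hv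
      obtain ⟨u1, hu1⟩ := mem_xM.1 (hv y1 hy1)
      obtain ⟨u2, hu2⟩ := mem_xM.1 (hv y2 hy2)
      have e1 : y2 • u1 = y1 • u2 := by
        apply ha
        change a • y2 • u1 = a • y1 • u2
        rw [smul_comm a, hu1, smul_comm a, hu2, smul_comm]
      rw [inj_iff] at r2
      have h3 := r2 (Submodule.mkQ _ u1) (by
        rw [← map_smul, Submodule.mkQ_apply, Submodule.Quotient.mk_eq_zero, mem_xM]
        exact ⟨u2, e1.symm⟩)
      rw [Submodule.mkQ_apply, Submodule.Quotient.mk_eq_zero, mem_xM] at h3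
      obtain ⟨u', rfl⟩ := h3
      refine mem_xM.2 ⟨u', ?_⟩
      apply r1
      change y1 • a • u' = y1 • v
      rw [← hu1, smul_comm]
    have hfin := associatedPrimes.finite A (M ⧸ xM M a)
    obtain ⟨i, hi, hi'⟩ := coset_avoid y1 (Ideal.ofList (y2 :: ys)) hfin.toFinset 
      (fun P hP => by
        rw [Set.Finite.mem_toFinset] at hP
        exact hP.1) (fun P hP => by
        rw [Set.Finite.mem_toFinset] at hP
        rintro ⟨hxP, hIP⟩
        obtain ⟨hPp, z, hz⟩ := isAssociatedPrime_iff.1 hP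
        have hann := IsAssociatedPrime.annihilator_le hP
        have hbP : 𝔟 ≤ P := by
          refine le_trans ?_ hann
          intro b hb'
          rw [Submodule.mem_annihilator]
          intro m _
          have : b • m ∈ 𝔟 • (⊤ : Submodule A (M ⧸ xM M a)) := Submodule.smul_mem_smul hb' Submodule.mem_top
          rw [smul_top_quot hb] at this
          simpa using this
        have hJP : J ≤ P := by
          refine hJ.trans (sup_le ?_ hbP)
          rw [Ideal.ofList_cons]
          refine sup_le ?_ hIP
          rwa [Ideal.span_singleton_le_iff_mem]
        obtain ⟨v, rfl⟩ := Submodule.mkQ_surjective _ z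
        have hv := htors v (fun j hj => by
          have := hJP hj
          rw [hz, Submodule.mem_colon_singleton, ← map_smul, Submodule.mem_bot, Submodule.mkQ_apply, 
            Submodule.Quotient.mk_eq_zero] at this
          exact this)
        apply hPp.ne_top
        rw [Ideal.eq_top_iff_one, hz, Submodule.mem_colon_singleton, one_smul, Submodule.mem_bot, 
          Submodule.mkQ_apply, Submodule.Quotient.mk_eq_zero]
        exact hv)
    have hreg : Function.Injective (mx (M ⧸ xM M a) (y1 + i)) := by
      rw [inj_iff_ass]
      intro P hP
      exact hi' P (by rwa [Set.Finite.mem_toFinset])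
    have hiJ : i ∈ J := by
      have : Ideal.ofList (y2 :: ys) ≤ J := Ideal.span_le.2 hy
      exact this hi
    have hyJ := add_mem hy1 hiJ
    have hJ' : J ≤ Ideal.ofList ((y1 + i) :: y2 :: ys) ⊔ 𝔟 := by
      refine hJ.trans (sup_le_sup ?_ le_rfl)
      rw [Ideal.ofList_cons, Ideal.ofList_cons (y1 + i)]
      refine sup_le ?_ le_sup_right
      rw [Ideal.span_singleton_le_iff_mem]
      have hh : (y1 + i) - i ∈ Ideal.span {y1 + i} ⊔ Ideal.ofList (y2 :: ys) := sub_mem (Ideal.mem_sup_left (Ideal.mem_span_singleton_self _)) (Ideal.mem_sup_right hi)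
      simpa using hh
    obtain ⟨r3, c3⟩ := CMn.regular J hJJ hyJ hy hJ' hb h
    have h5 := ih (M ⧸ xM M (y1 + i)) _ y2 hy2 hys (le_cons J hJ') (smul_top_quot_x hb (y1 + i)) 
      c3 a (regular_swap ha hreg)
    exact Pure.of_quot J hJJ hyJ hreg (h5.of_injective J (swapEquiv M a (y1 + i)).toLinearMap 
      (swapEquiv M a (y1 + i)).injective)

end pure
end CM
end part_6

section part_7
open Filter
namespace CM
universe u v w

section lift
variable {k : Type u} {A : Type v} [CommRing k] [CommRing A] [Algebra k A]
variable {M : Type w} [AddCommGroup M] [Module A M] [Module k M] [IsScalarTower k A M]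
variable {M' : Type*} [AddCommGroup M'] [Module A M'] [Module k M'] [IsScalarTower k A M']
variable (J : Ideal A)

lemma small_cyc [IsNoetherianRing A] [Module.Finite A M] [FL k J M] [Module.Finite A M'] [FL k J M'] 
    {s : ℕ} {w : M} {m : M'} 
    (h : Small k J s (Submodule.span A {w})) (hm : ∀ a : A, a • w = 0 → a • m = 0) : 
    Small k J s (Submodule.span A {m}) := by
  rw [LinearMap.span_singleton_eq_range] at h
  let e := (LinearMap.toSpanSingleton A M w).quotKerEquivRange
  let g : (A ⧸ LinearMap.ker (LinearMap.toSpanSingleton A M w)) →ₗ[A] M' := 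
    Submodule.liftQ _ (LinearMap.toSpanSingleton A M' m) (fun a ha => hm a (by simpa using ha))
  let f : LinearMap.range (LinearMap.toSpanSingleton A M w) →ₗ[A] M' := g ∘ₗ e.symm.toLinearMap
  have h1 : Small k J s (⊤ : Submodule A (LinearMap.range (LinearMap.toSpanSingleton A M w))) := by
    rw [← small_map_iff J (Submodule.subtype _) (Submodule.injective_subtype _), 
      Submodule.map_subtype_top]; exact h
  have h2 := h1.map J f
  refine h2.le J ?_
  rw [Submodule.span_singleton_le_iff_mem]
  refine ⟨e (Submodule.Quotient.mk 1), trivial, ?_⟩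
  change g (e.symm (e _)) = m
  rw [e.symm_apply_apply]
  change (1 : A) • m = m
  rw [one_smul]

lemma exists_regular [IsNoetherianRing A] [Module.Finite A M] [FL k J M] [Module.Finite A M'] 
    [FL k J M'] {s : ℕ} {w : M} (h : Small k J s (Submodule.span A {w})) (hp : Pure k J M' s) : 
    ∃ a : A, a • w = 0 ∧ Function.Injective (mx M' a) := by
  have hfin := associatedPrimes.finite A M'
  obtain ⟨i, hi, hi'⟩ := coset_avoid 0 (LinearMap.ker (LinearMap.toSpanSingleton A M w)) hfin.toFinset 
    (fun P hP => by
      rw [Set.Finite.mem_toFinset] at hP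
      exact hP.1) (fun P hP => by
      rw [Set.Finite.mem_toFinset] at hP
      rintro ⟨-, hIP⟩
      obtain ⟨hPp, z, hz⟩ := isAssociatedPrime_iff.1 hP
      have h1 : Submodule.span A {z} = ⊥ := hp _ (small_cyc J h (fun a ha => by
        have : a ∈ P := hIP (by simpa using ha)
        rwa [hz, Submodule.mem_colon_singleton] at this))
      rw [Submodule.span_singleton_eq_bot] at h1
      apply hPp.ne_top
      rw [Ideal.eq_top_iff_one, hz, Submodule.mem_colon_singleton, h1]
      simp)
  refine ⟨i, by simpa using hi, ?_⟩
  rw [inj_iff_ass]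
  intro P hP
  have := hi' P (by rwa [Set.Finite.mem_toFinset])
  rwa [zero_add] at this

lemma mk_eq_zero' {x : A} {m : M} : (xM M x).mkQ m = 0 ↔ ∃ m', x • m' = m := by
  rw [Submodule.mkQ_apply, Submodule.Quotient.mk_eq_zero, mem_xM]

lemma inj_pow {x : A} (hx : Function.Injective (mx M x)) (n : ℕ) : Function.Injective (mx M (x ^ n)) := by
  rw [inj_iff] at *
  induction n with
  | zero => simp
  | succ n ih =>
    intro m hm
    rw [pow_succ, mul_smul] at hm
    exact hx _ (ih _ hm)

lemma lifting [IsNoetherianRing A] (hJJ : J ≤ Ideal.jacobson ⊥) [Module.Finite A M] [FL k J M]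
    {x y : A} {ys : List A} {𝔟 : Ideal A} (hreg : Function.Injective (mx M x)) (hy : y ∈ J) 
    (hys : ∀ a ∈ ys, a ∈ J) (hJ : J ≤ Ideal.ofList (y :: ys) ⊔ 𝔟) 
    (hb : 𝔟 • (⊤ : Submodule A (M ⧸ xM M x)) = ⊥) (V : Submodule A (M ⧸ xM M x)) 
    (hV : Small k J ys.length V) (hC : CMn k J ((M ⧸ xM M x) ⧸ V) (ys.length + 1)) 
    (n : ℕ) (w : M) (hw : Small k J ys.length (Submodule.span A {(xM M (x ^ n)).mkQ w})) : 
    ∃ c : M, Small k J ys.length (Submodule.span A {(xM M (x ^ (n + 1))).mkQ (w + x ^ n • c)}) := by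
  have hb' := smul_top_quot hb V
  have hpure := CMn.pure J hJJ (y :: ys) _ 𝔟 (by simpa using ⟨hy, hys⟩) hJ hb' hC
  have hregn := inj_iff.1 (inj_pow hreg n)
  obtain ⟨a, haw, ha⟩ := exists_regular J hw (fun W hW => hpure W (hW.mono J (by simp)))
  have hpq := CMn.pure_quot J hJJ ys _ 𝔟 y hy hys hJ hb' hC a ha
  rw [inj_iff] at ha
  rw [← map_smul, mk_eq_zero'] at haw
  obtain ⟨φa, hφa⟩ := haw
  let π : M →ₗ[A] ((M ⧸ xM M x) ⧸ V) := V.mkQ ∘ₗ (xM M x).mkQ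
  have hπ : Function.Surjective π := V.mkQ_surjective.comp (xM M x).mkQ_surjective
  have key : ∀ (b : A) (φb : M), x ^ n • φb = b • w → b • φa = a • φb := by
    intro b φb hφb
    have := hregn (b • φa - a • φb) (by
      rw [smul_sub, smul_comm _ b, hφa, smul_comm _ a φb, hφb, smul_comm, sub_self])
    exact sub_eq_zero.1 this
  have h1 : Submodule.span A {(xM _ a).mkQ (π φa)} = ⊥ := hpq _ (small_cyc J hw (fun b hbw => by
    rw [← map_smul, mk_eq_zero'] at hbw
    obtain ⟨φb, hφb⟩ := hbw
    rw [← map_smul, mk_eq_zero', ← map_smul]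
    exact ⟨π φb, by rw [← map_smul, key b φb hφb]⟩))
  rw [Submodule.span_singleton_eq_bot, mk_eq_zero'] at h1
  obtain ⟨c, hc⟩ := h1
  obtain ⟨c, rfl⟩ := hπ c
  refine ⟨-c, ?_⟩
  let g : (M ⧸ xM M x) →ₗ[A] (M ⧸ xM M (x ^ (n + 1))) := Submodule.mapQ _ _ (mx M (x ^ n)) (by
    rw [← Submodule.map_le_iff_le_comap]
    rintro _ ⟨_, ⟨m, -, rfl⟩, rfl⟩
    exact mem_xM.2 ⟨m, by rw [pow_succ, mul_smul]; rfl⟩)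
  have hU := hV.map J g
  have h2 : Small k J ys.length (Submodule.span A {(V.map g).mkQ ((xM M (x ^ (n + 1))).mkQ (w + x ^ n • (-c)))}) := by
    refine small_cyc J hw (fun b hbw => ?_)
    rw [← map_smul, mk_eq_zero'] at hbw
    obtain ⟨φb, hφb⟩ := hbw
    rw [← map_smul, Submodule.mkQ_apply, Submodule.Quotient.mk_eq_zero]
    refine ⟨(xM M x).mkQ (φb - b • c), ?_, ?_⟩
    · have : π (φb - b • c) = 0 := ha _ (by
        rw [← map_smul, smul_sub, ← key b φb hφb, smul_comm, ← smul_sub, map_smul, map_sub, map_smul, hc, sub_self, smul_zero])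
      have h3 : V.mkQ ((xM M x).mkQ (φb - b • c)) = 0 := this
      rwa [Submodule.mkQ_apply, Submodule.Quotient.mk_eq_zero] at h3
    · rw [← map_smul]
      change (xM M (x ^ (n + 1))).mkQ (x ^ n • (φb - b • c)) = _
      congr 1
      rw [smul_sub, hφb, smul_add, smul_neg, smul_neg, smul_comm b, sub_eq_add_neg]
  have h3 : Small k J ys.length (V.map g ⊔ Submodule.span A {(xM M (x ^ (n + 1))).mkQ (w + x ^ n • (-c))}) := by
    refine Small.ext J hU ?_ le_sup_left
    rw [Submodule.map_sup, Submodule.mkQ_map_self, bot_sup_eq, Submodule.map_span, Set.image_singleton]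
    exact h2
  exact h3.le J le_sup_right

lemma W_argument [IsNoetherianRing A] (hJJ : J ≤ Ideal.jacobson ⊥) [Module.Finite A M] [FL k J M] 
    [IsPrecomplete J M]
    {x y : A} {ys : List A} {𝔟 : Ideal A} (hxJ : x ∈ J) (hreg : Function.Injective (mx M x)) (hy : y ∈ J) 
    (hys : ∀ a ∈ ys, a ∈ J) (hJ : J ≤ Ideal.ofList (y :: ys) ⊔ 𝔟) 
    (hb : 𝔟 • (⊤ : Submodule A (M ⧸ xM M x)) = ⊥) (V : Submodule A (M ⧸ xM M x)) 
    (hV : Small k J ys.length V) (hC : CMn k J ((M ⧸ xM M x) ⧸ V) (ys.length + 1)) 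
    (hpure : Pure k J M (ys.length + 1)) : V = ⊥ := by
  set s := ys.length with hs
  choose c hc using lifting J hJJ hreg hy hys hJ hb V hV hC
  have hlarge := fun n => exists_largest (k := k) (M := M ⧸ xM M (x ^ n)) J s ⊤
  choose U _ hU1 hU2 using hlarge
  have hQU : ∀ n (w : M), w ∈ (U n).comap (xM M (x ^ n)).mkQ ↔ 
      Small k J s (Submodule.span A {(xM M (x ^ n)).mkQ w}) := by
    intro n w
    rw [Submodule.mem_comap]
    constructor
    · intro h
      exact (hU1 n).le J (by rwa [Submodule.span_singleton_le_iff_mem])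
    · intro h
      have := hU2 n _ le_top h
      rwa [Submodule.span_singleton_le_iff_mem] at this
  let W : Submodule A M := ⨅ n, (U (n + 1)).comap (xM M (x ^ (n + 1))).mkQ
  have hW : ∀ w, w ∈ W ↔ ∀ n, Small k J s (Submodule.span A {(xM M (x ^ (n + 1))).mkQ w}) := by
    intro w
    simp only [W, Submodule.mem_iInf, hQU]
  have hsat : ∀ m, x • m ∈ W → m ∈ W := by
    intro m hm
    rw [hW] at hm ⊢
    intro n
    refine small_cyc J (hm (n + 1)) (fun a ha => ?_)
    rw [← map_smul, mk_eq_zero'] at ha ⊢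
    obtain ⟨m', hm'⟩ := ha
    refine ⟨m', ?_⟩
    apply hreg
    change x • (x ^ (n + 1) • m') = x • (a • m)
    rw [smul_comm x a, ← hm', pow_succ' x (n + 1), mul_smul]
  have hVW : V ≤ W.map (xM M x).mkQ := by
    intro v hv
    obtain ⟨w0, rfl⟩ := (xM M x).mkQ_surjective v
    have hw0 : Small k J s (Submodule.span A {(xM M (x ^ (0 + 1))).mkQ w0}) := by
      have : Small k J s (Submodule.span A {(xM M x).mkQ w0}) := 
        hV.le J (by rwa [Submodule.span_singleton_le_iff_mem])
      refine small_cyc J this (fun a ha => ?_)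
      rw [← map_smul, mk_eq_zero'] at ha ⊢
      simpa using ha
    let g : ∀ n : ℕ, {w : M // Small k J s (Submodule.span A {(xM M (x ^ (n + 1))).mkQ w})} := 
      fun n => Nat.rec ⟨w0, hw0⟩ (fun n p => ⟨p.1 + x ^ (n + 1) • c (n + 1) p.1 p.2, hc _ _ _⟩) n
    have hg0 : (g 0).1 = w0 := rfl
    have hg : ∀ n, (g (n + 1)).1 = (g n).1 + x ^ (n + 1) • c (n + 1) (g n).1 (g n).2 := fun n => rfl
    have hg2 : ∀ n p, ∃ m, (g (n + p)).1 = (g n).1 + x ^ (n + 1) • m := by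
      intro n p
      induction p with
      | zero => exact ⟨0, by simp⟩
      | succ p ih =>
        obtain ⟨m, hm⟩ := ih
        refine ⟨m + x ^ p • c (n + p + 1) (g (n + p)).1 (g (n + p)).2, ?_⟩
        have h1 := hg (n + p)
        generalize c (n + p + 1) (g (n + p)).1 (g (n + p)).2 = z at h1 ⊢
        rw [← add_assoc, h1, hm, smul_add, smul_smul, ← pow_add, add_assoc, 
          show n + 1 + p = n + p + 1 by omega]
    obtain ⟨L, hL⟩ := IsPrecomplete.prec' (I := J) (M := M) (fun n => (g n).1) (by
      intro m n hmn
      obtain ⟨p, rfl⟩ := Nat.exists_eq_add_of_le hmn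
      obtain ⟨z, hz⟩ := hg2 m p
      rw [hz, SModEq.sub_mem]
      have : (g m).1 - ((g m).1 + x ^ (m + 1) • z) = x ^ (m + 1) • (-z) := by rw [smul_neg]; abel
      rw [this]
      exact pow_smul_anti J ⊤ (Nat.le_succ m) (Submodule.smul_mem_smul (Ideal.pow_mem_pow hxJ _) trivial))
    have hL2 : ∀ n, (xM M (x ^ (n + 1))).mkQ L = (xM M (x ^ (n + 1))).mkQ (g n).1 := by
      intro n
      rw [← sub_eq_zero, ← map_sub]
      refine krull J hJJ (fun p => ?_)
      obtain ⟨z, hz⟩ := hg2 n p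
      have h1 : (xM M (x ^ (n + 1))).mkQ (L - (g n).1) = (xM M (x ^ (n + 1))).mkQ (L - (g (n + p)).1) := by
        rw [← sub_eq_zero, ← map_sub, mk_eq_zero']
        exact ⟨z, by rw [hz]; abel⟩
      rw [h1]
      have h2 : L - (g (n + p)).1 ∈ (J ^ p • ⊤ : Submodule A M) := by
        refine pow_smul_anti J ⊤ (by omega : p ≤ n + p) ?_
        rw [← SModEq.sub_mem]
        exact (hL (n + p)).symm
      have h3 := Submodule.mem_map_of_mem (f := (xM M (x ^ (n + 1))).mkQ) h2
      rw [Submodule.map_smul''] at h3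
      exact Submodule.smul_mono le_rfl le_top h3
    refine ⟨L, ?_, ?_⟩
    · rw [SetLike.mem_coe, hW]
      intro n
      rw [hL2]
      exact (g n).2
    · have := hL2 0
      rw [← sub_eq_zero, ← map_sub, mk_eq_zero'] at this ⊢
      rw [hg0] at this
      simpa using this
  let f : (W ⧸ xM W x) →ₗ[A] (M ⧸ xM M x) := Submodule.mapQ _ _ W.subtype (by
    rw [← Submodule.map_le_iff_le_comap]
    rintro _ ⟨_, ⟨m, -, rfl⟩, rfl⟩
    exact ⟨m, trivial, rfl⟩)
  have hf : Function.Injective f := by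
    rw [← LinearMap.ker_eq_bot, LinearMap.ker_eq_bot']
    intro m hm
    obtain ⟨⟨m, hmW⟩, rfl⟩ := Submodule.mkQ_surjective _ m
    have h1 : (xM M x).mkQ m = 0 := hm
    rw [mk_eq_zero'] at h1
    obtain ⟨m', rfl⟩ := h1
    rw [mk_eq_zero']
    exact ⟨⟨m', hsat m' hmW⟩, rfl⟩
  have hWs : Small k J s (⊤ : Submodule A (W ⧸ xM W x)) := by
    rw [← small_map_iff J f hf]
    obtain ⟨U', -, hU1', hU2'⟩ := exists_largest (k := k) (M := M ⧸ xM M x) J s ⊤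
    refine hU1'.le J ?_
    rintro _ ⟨m, -, rfl⟩
    obtain ⟨⟨m, hmW⟩, rfl⟩ := Submodule.mkQ_surjective _ m
    change (xM M x).mkQ m ∈ U'
    rw [← Submodule.span_singleton_le_iff_mem]
    refine hU2' _ le_top (small_cyc J ((hW m).1 hmW 0) (fun a ha => ?_))
    rw [← map_smul, mk_eq_zero'] at ha ⊢
    simpa using ha
  have hWs2 := hWs.of_quot J x hxJ
  have hW0 : W = ⊥ := hpure W (by
    rw [← small_map_iff J W.subtype W.injective_subtype, Submodule.map_subtype_top] at hWs2
    exact hWs2)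
  rw [hW0, Submodule.map_bot] at hVW
  exact eq_bot_iff.2 hVW

end lift
end CM
end part_7

section part_8
open Filter
namespace CM
universe u v w

section chern
variable {k : Type u} {A : Type v} [CommRing k] [CommRing A] [Algebra k A]
variable {M : Type w} [AddCommGroup M] [Module A M] [Module k M] [IsScalarTower k A M]
variable (J : Ideal A)

/-- Hilbert Samuel function -/
noncomputable def HS (k : Type u) {A : Type v} [CommRing k] [CommRing A] [Algebra k A] (J : Ideal A)
    (M : Type w) [AddCommGroup M] [Module A M] [Module k M] [IsScalarTower k A M] (n : ℕ) : ℤ :=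
  zl k (J ^ (n + 1) • ⊤ : Submodule A M) ⊤

/-- first two Hilbert coefficients -/
def Ch (s : ℕ) (H : ℕ → ℤ) (e0 e1 : ℤ) : Prop :=
  EvP s (fun n => H n - e0 * ((n + (s + 1)).choose (s + 1) : ℤ) + e1 * ((n + s).choose s : ℤ))

lemma exists_evP [IsNoetherianRing A] [Module.Finite A M] [FL k J M] (W : Submodule A M) :
    ∃ t, EvP t (fun n => zl k (J ^ n • ⊤) W) := by
  obtain ⟨y, hy, hJ⟩ := exists_list J (IsNoetherian.noetherian _)
  exact ⟨_, evP_filt (k := k) J y hy ⊥ (by simpa using hJ) W (by simp)⟩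

lemma top_map_mkQ (U : Submodule A M) : (⊤ : Submodule A M).map U.mkQ = ⊤ := by
  rw [Submodule.map_top, Submodule.range_mkQ]

lemma HS_quot (U : Submodule A M) (n : ℕ) : 
    HS k J (M ⧸ U) n = zl k (J ^ (n + 1) • ⊤ ⊔ U) ⊤ := by
  have := zl_quot (k := k) J (n + 1) (le_top : U ≤ ⊤)
  rw [top_map_mkQ] at this
  exact this

lemma HS_add [IsNoetherianRing A] [FL k J M] (U : Submodule A M) (n : ℕ) : 
    HS k J M n = HS k J (M ⧸ U) n + zl k (J ^ (n + 1) • ⊤) U := by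
  rw [HS_quot, ← zl_congr (rl_sup (k := k) (P := J ^ (n + 1) • ⊤) (Q := U)), add_comm]
  exact zl_add le_sup_left le_top (fl_pow J _)

lemma reduction [IsNoetherianRing A] [Module.Finite A M] [FL k J M] {s : ℕ} {e0 e1 : ℤ} 
    (h : Ch s (HS k J M) e0 e1) : ∃ (U : Submodule A M) (c : ℤ), 0 ≤ c ∧ Pure k J (M ⧸ U) (s + 1) ∧ 
    Ch s (HS k J (M ⧸ U)) e0 (e1 + c) ∧ (c = 0 → Small k J s U) := by
  obtain ⟨U, -, hU, hmax⟩ := exists_largest (k := k) (M := M) J (s + 1) ⊤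
  have hg : EvP (s + 1) (fun n => zl k (J ^ n • ⊤) U) := by
    obtain ⟨t, ht⟩ := exists_evP (k := k) J U
    refine EvP.of_le ht hU (Eventually.of_forall fun n => zl_nonneg _ _) 
      (Eventually.of_forall fun n => zl_le (rl_anti (Submodule.smul_mono le_rfl le_top)) (fl_sub J U n))
  obtain ⟨c, hc⟩ := hg.exists_lead
  refine ⟨U, c, hc.nonneg (Eventually.of_forall fun n => zl_nonneg _ _), ?_, ?_, ?_⟩
  · intro W hW
    have h1 : Small k J (s + 1) (W.comap U.mkQ) := by
      refine Small.ext J hU ?_ ?_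
      · rwa [Submodule.map_comap_eq_of_surjective U.mkQ_surjective]
      · exact Submodule.le_comap_mkQ U W
    have h2 := hmax _ le_top h1
    rw [← Submodule.map_comap_eq_of_surjective U.mkQ_surjective W, eq_bot_iff, 
      Submodule.map_le_iff_le_comap]
    simpa using h2
  · have h1 := EvP.sub h (Lead.sub_choose (hc.shift 1))
    refine h1.congr (Eventually.of_forall fun n => ?_)
    rw [HS_add J U n]; ring
  · rintro rfl
    obtain ⟨a, ha⟩ := artin_rees J U
    refine small_of_le J (Lead.shift a hc) (Eventually.of_forall fun n => 
      zl_le ?_ (fl_pow' J _ _))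
    rw [← rl_inf (P := J ^ (n + a) • ⊤)]
    exact rl_anti (ha n)

lemma base_case [IsNoetherianRing A] [Module.Finite A M] [FL k J M] {x : A} (hx : x ∈ J) 
    {𝔟 : Ideal A} (hJ : J ≤ Ideal.ofList [x] ⊔ 𝔟) (hb : 𝔟 • (⊤ : Submodule A M) = ⊥) 
    (hp : Pure k J M 1) : CMn k J M 1 := by
  have hreg : Function.Injective (mx M x) := by
    rw [← LinearMap.ker_eq_bot]
    apply hp
    have h0 : J • (LinearMap.ker (mx M x)) = ⊥ := by
      rw [eq_bot_iff]
      refine (Submodule.smul_mono hJ le_rfl).trans ?_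
      rw [Submodule.sup_smul]
      refine sup_le ?_ ((Submodule.smul_mono le_rfl le_top).trans hb.le)
      rw [Ideal.ofList_singleton, ← map_mx_eq]
      rintro _ ⟨m, hm, rfl⟩
      exact hm
    have h1 : ∀ n ≥ 1, J ^ n • LinearMap.ker (mx M x) = ⊥ := by
      intro n hn
      obtain ⟨m, rfl⟩ : ∃ m, n = m + 1 := ⟨n - 1, by omega⟩
      rw [pow_succ, mul_smul, h0, Submodule.smul_bot]
    have h2 : ∀ᶠ n in atTop, fd (fun n => zl k (J ^ n • LinearMap.ker (mx M x)) (LinearMap.ker (mx M x))) n = 0 := by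
      refine eventually_atTop.2 ⟨1, fun n hn => ?_⟩
      simp only [fd]
      rw [h1 n hn, h1 (n + 1) (by omega), sub_self]
    exact h2
  refine CMn.of_quot J hx (y := []) (by simp) hJ hb hreg ?_
  have hJN : J • (⊤ : Submodule A (M ⧸ xM M x)) = ⊥ := by
    rw [eq_bot_iff, ← smul_top_quot_x hb x]
    refine Submodule.smul_mono ?_ le_rfl
    rwa [Ideal.ofList_singleton] at hJ
  intro n
  cases n with
  | zero => simp
  | succ n =>
    have : J ^ (n + 1) • (⊤ : Submodule A (M ⧸ xM M x)) = ⊥ := by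
      rw [pow_succ, mul_smul, hJN, Submodule.smul_bot]
    rw [this, rl_bot]
    simp

lemma HS_colon [IsNoetherianRing A] [FL k J M] {x : A} (hx : x ∈ J) (n : ℕ) :
    HS k J (M ⧸ xM M x) (n + 1) = 
    fd (HS k J M) n + zl k (J ^ (n + 1) • ⊤) ((J ^ (n + 2) • ⊤ : Submodule A M).comap (mx M x)) := by
  have h1 := HS_add (k := k) J (xM M x) (n + 1)
  have h2 : zl k (J ^ (n + 2) • ⊤) (xM M x) = 
      zl k ((J ^ (n + 2) • ⊤ : Submodule A M).comap (mx M x)) ⊤ := zl_congr (rl_comap _ _ _).symm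
  have h3 : HS k J M n = zl k (J ^ (n + 1) • ⊤) ((J ^ (n + 2) • ⊤ : Submodule A M).comap (mx M x)) + 
      zl k ((J ^ (n + 2) • ⊤ : Submodule A M).comap (mx M x)) ⊤ := 
    zl_add (comap_mx_ge J x hx (n + 1)) le_top (fl_pow J _)
  simp only [fd]
  rw [h3, ← h2, h1]; ring

lemma rl_le_sum [IsNoetherianRing A] [FL k J M] (D : Submodule A M) (n c : ℕ) (hD : D ≤ J ^ n • ⊤) : 
    zl k (J ^ (n + c) • ⊤) D ≤ 
      ∑ i ∈ Finset.range c, zl k (J ^ (n + i + 1) • ⊤) (J ^ (n + i) • ⊤ ⊓ D) := by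
  induction c with
  | zero => simp [zl_eq_zero hD]
  | succ c ih =>
    rw [Finset.sum_range_succ]
    refine le_trans ?_ (add_le_add ih le_rfl)
    refine zl_le_add ?_ (fl_pow' J _ _) (fl_pow' J _ _)
    rw [add_comm (rl k _ _), ← add_assoc n c 1, rl_add_le (pow_smul_anti J ⊤ (Nat.le_succ (n + c)))]

lemma superficial [IsNoetherianRing A] [Module.Finite A M] [FL k J M] {x : A} (hx : x ∈ J) {s : ℕ}
    (h : EvP s (fun n => zl k (J ^ (n + 1) • ⊤ : Submodule A M) 
      (J ^ n • ⊤ ⊓ (J ^ (n + 2) • ⊤ : Submodule A M).comap (mx M x)))) (hp : Pure k J M (s + 1)) : 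
    Function.Injective (mx M x) ∧ 
    EvP s (fun n => HS k J (M ⧸ xM M x) (n + 1) - fd (HS k J M) n) := by
  have hreg : Function.Injective (mx M x) := by
    rw [← LinearMap.ker_eq_bot]
    apply hp
    set Z := LinearMap.ker (mx M x)
    obtain ⟨t, ht⟩ := exists_evP (k := k) J Z
    have hZ : EvP (s + 1) (fun n => zl k (J ^ n • ⊤) Z) := by
      have h2 : ∀ n, fd (fun n => zl k (J ^ n • ⊤) Z) n = zl k (J ^ (n + 1) • ⊤) (J ^ n • ⊤ ⊓ Z) := by
        intro n
        have h3 : rl k (J ^ (n + 1) • ⊤) Z = _ := rl_add_le (pow_smul_anti J ⊤ (Nat.le_succ n))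
        have h4 : zl k (J ^ (n + 1) • ⊤) Z = zl k (J ^ (n + 1) • ⊤) (J ^ n • ⊤ ⊓ Z) + zl k (J ^ n • ⊤) Z := by
          unfold zl
          rw [h3, ENat.toNat_add (fl_pow' J _ _) (fl_pow' J _ _)]
          push_cast; rfl
        simp only [fd]; rw [h4]; ring
      refine (EvP.of_le (t := t) (f := fd (fun n => zl k (J ^ n • ⊤) Z)) (EvP.succ ht) h ?_ ?_ : EvP s _)
      · exact Eventually.of_forall fun n => by rw [h2]; exact zl_nonneg _ _
      · refine Eventually.of_forall fun n => ?_
        rw [h2]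
        refine zl_le (rl_mono (inf_le_inf_left _ ?_)) (fl_pow' J _ _)
        intro m hm
        have : mx M x m = 0 := hm
        rw [Submodule.mem_comap, this]; exact zero_mem _
    obtain ⟨a, ha⟩ := artin_rees J Z
    refine small_of_le J (Lead.shift a hZ) (Eventually.of_forall fun n => 
      zl_le ?_ (fl_pow' J _ _))
    rw [← rl_inf (P := J ^ (n + a) • ⊤)]
    exact rl_anti (ha n)
  refine ⟨hreg, ?_⟩
  set δ : ℕ → ℤ := fun n => HS k J (M ⧸ xM M x) (n + 1) - fd (HS k J M) n with hδ
  have hδ' : ∀ n, δ n = zl k (J ^ (n + 1) • ⊤) ((J ^ (n + 2) • ⊤ : Submodule A M).comap (mx M x)) := 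
    fun n => by simp only [hδ]; rw [HS_colon J hx]; ring
  obtain ⟨t1, ht1⟩ := exists_evP (k := k) (M := M) J ⊤
  obtain ⟨t2, ht2⟩ := exists_evP (k := k) (M := M ⧸ xM M x) J ⊤
  have hδt : EvP (max t1 t2) δ := by
    refine EvP.sub (EvP.mono (Lead.shift 2 ht2) (le_max_right _ _)) ?_
    have : EvP t1 (fd (HS k J M)) := EvP.succ (Lead.shift 1 ht1)
    exact this.mono (le_max_left _ _)
  obtain ⟨c, hc⟩ := mx_ar J x hreg
  refine Lead.unshift c ?_
  have hsum := Lead.sum (s := s) (f := fun i n => zl k (J ^ ((n + (i + 1)) + 1) • ⊤ : Submodule A M) 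
      (J ^ (n + (i + 1)) • ⊤ ⊓ (J ^ ((n + (i + 1)) + 2) • ⊤ : Submodule A M).comap (mx M x))) (c := fun _ => 0) 
      (Finset.range c) (fun i _ => Lead.shift (i + 1) h)
  rw [Finset.sum_const_zero] at hsum
  refine EvP.of_le (Lead.shift c hδt) hsum (Eventually.of_forall fun n => by rw [hδ']; exact zl_nonneg _ _)
    (Eventually.of_forall fun n => ?_)
  rw [hδ']
  have h5 := rl_le_sum (k := k) J ((J ^ (n + c + 2) • ⊤ : Submodule A M).comap (mx M x)) (n + 1) c 
    (le_trans (Submodule.comap_mono (pow_smul_anti J ⊤ (by omega))) (hc (n + 1)))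
  rw [show n + c + 1 = n + 1 + c by omega]
  refine h5.trans (Finset.sum_le_sum fun i hi => ?_)
  rw [Finset.mem_range] at hi
  rw [show n + 1 + i = n + (i + 1) by omega]
  exact zl_le (rl_mono (inf_le_inf_left _ (Submodule.comap_mono (pow_smul_anti J ⊤ (by omega))))) 
    (fl_pow' J _ _)

lemma Ch.quot {s : ℕ} {H H' : ℕ → ℤ} {e0 e1 : ℤ} (h : Ch (s + 1) H e0 e1) 
    (h' : EvP s (fun n => H' (n + 1) - fd H n)) : Ch s H' e0 e1 := by
  refine Lead.unshift 1 ?_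
  refine (EvP.add (EvP.fd h) h').congr (Eventually.of_forall fun n => ?_)
  simp only [fd]
  have e1' : (n + 1 + (s + 1 + 1)).choose (s + 1 + 1) = 
      (n + 1 + (s + 1)).choose (s + 1) + (n + (s + 1 + 1)).choose (s + 1 + 1) := by
    rw [show n + 1 + (s + 1 + 1) = (n + (s + 1 + 1)) + 1 by omega, Nat.choose_succ_succ, 
      show n + 1 + (s + 1) = n + (s + 1 + 1) by omega]
  have e2' : (n + 1 + (s + 1)).choose (s + 1) = 
      (n + 1 + s).choose s + (n + (s + 1)).choose (s + 1) := by
    rw [show n + 1 + (s + 1) = (n + (s + 1)) + 1 by omega, Nat.choose_succ_succ, 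
      show n + 1 + s = n + (s + 1) by omega]
  rw [e1']
  nth_rw 2 [e2']
  push_cast; ring

lemma base_e1 [IsNoetherianRing A] [FL k J M] {e0 e1 : ℤ} (hc : CMn k J M 1) 
    (h : Ch 0 (HS k J M) e0 e1) : e1 = 0 := by
  have hH : ∀ n : ℕ, HS k J M n = (n + 1) * zl k (J • ⊤ : Submodule A M) ⊤ := by
    intro n
    induction n with
    | zero => simp [HS]
    | succ n ih =>
      have h1 : HS k J M (n + 1) = zl k (J ^ (n + 1 + 1) • ⊤ : Submodule A M) (J ^ (n + 1) • ⊤) + 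
          HS k J M n := zl_add (pow_smul_anti J ⊤ (by omega)) le_top (fl_pow J _)
      have h2 : zl k (J ^ (n + 1 + 1) • ⊤ : Submodule A M) (J ^ (n + 1) • ⊤) = 
          zl k (J • ⊤ : Submodule A M) ⊤ := by
        apply zl_congr
        rw [hc (n + 1)]; simp
      rw [h1, h2, ih]; push_cast; ring
  obtain ⟨N, hN⟩ := eventually_atTop.1 (show ∀ᶠ n in atTop, _ = (0 : ℤ) from h)
  have h1 := hN N le_rfl
  have h2 := hN (N + 1) (by omega)
  rw [hH] at h1 h2
  simp only [zero_add, Nat.choose_one_right, add_zero, Nat.choose_zero_right] at h1 h2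
  push_cast at h1 h2
  generalize zl k (J • ⊤ : Submodule A M) ⊤ = l at h1 h2
  have h3 : l = e0 := by linear_combination h2 - h1
  subst h3
  linear_combination h1

end chern
end CM
end part_8

section part_9
open Filter
namespace CM
universe u v w

section generic
variable {k : Type u} {A : Type v} [CommRing k] [CommRing A] [Algebra k A]
variable {M : Type w} [AddCommGroup M] [Module A M] [Module k M] [IsScalarTower k A M]
variable {J : Ideal A}

/-- filtration between consecutive adic steps -/
structure Bet (G : J.Filtration M) : Prop where
  lo : ∀ n, J ^ (n + 1) • ⊤ ≤ G.N n
  hi : ∀ n, G.N n ≤ J ^ n • ⊤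

/-- length function -/
noncomputable def gl (k : Type u) {A : Type v} [CommRing k] [CommRing A] [Algebra k A]
    {M : Type w} [AddCommGroup M] [Module A M] [Module k M] [IsScalarTower k A M]
    {J : Ideal A} (G : J.Filtration M) (n : ℕ) : ℤ := zl k (J ^ (n + 1) • ⊤) (G.N n)

lemma gl_nonneg (G : J.Filtration M) : ∀ᶠ n in atTop, 0 ≤ gl k G n :=
  Eventually.of_forall fun _ => zl_nonneg _ _

lemma Bet.sup {G G' : J.Filtration M} (h : Bet G) (h' : Bet G') : Bet (G ⊔ G') :=
  ⟨fun n => (h.lo n).trans le_sup_left, fun n => sup_le (h.hi n) (h'.hi n)⟩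

lemma Bet.inf {G G' : J.Filtration M} (h : Bet G) (h' : Bet G') : Bet (G ⊓ G') :=
  ⟨fun n => le_inf (h.lo n) (h'.lo n), fun n => inf_le_left.trans (h.hi n)⟩

variable [IsNoetherianRing A] [Module.Finite A M] [FL k J M]

lemma Bet.stable {G : J.Filtration M} (h : Bet G) : G.Stable :=
  (Ideal.stableFiltration_stable J ⊤).of_le (fun n => h.hi n)

lemma Bet.evP {G : J.Filtration M} (h : Bet G) {y : List A} {𝔟 : Ideal A} (hy : ∀ a ∈ y, a ∈ J)
    (hJ : J ≤ Ideal.ofList y ⊔ 𝔟) (hb : ∀ n, 𝔟 • G.N n ≤ J ^ (n + 2) • ⊤) :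
    EvP y.length (gl k G) :=
  hilbert (k := k) y 𝔟 hy hJ G (shiftFilt (J.stableFiltration ⊤)) h.stable h.lo
    (fun n => fl_pow' J (n + 1) _) hb

lemma Bet.evP' {G : J.Filtration M} (h : Bet G) {y : List A} {𝔟 : Ideal A} (hy : ∀ a ∈ y, a ∈ J)
    (hJ : J ≤ Ideal.ofList y ⊔ 𝔟) (hb : 𝔟 • (⊤ : Submodule A M) = ⊥) :
    EvP y.length (gl k G) :=
  h.evP hy hJ fun _ => ((Submodule.smul_mono le_rfl le_top).trans hb.le).trans bot_le

lemma bet_ker {x : A} (hx : x ∈ J) :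
    Bet (kerFilt x (J.stableFiltration (⊤ : Submodule A M)) 
      (shiftFilt (J.stableFiltration ⊤))) :=
  ⟨fun n => le_inf (pow_smul_anti J _ (by omega)) (comap_mx_ge J x hx (n + 1)),
    fun n => inf_le_left⟩

/-- greatest filtration with small growth -/
lemma exists_greatest {y : List A} {𝔟 : Ideal A} (hy : ∀ a ∈ y, a ∈ J)
    (hJ : J ≤ Ideal.ofList y ⊔ 𝔟) (hb : 𝔟 • (⊤ : Submodule A M) = ⊥) (s : ℕ) :
    ∃ T : J.Filtration M, Bet T ∧ EvP s (gl k T) ∧ 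
      ∀ G : J.Filtration M, Bet G → EvP s (gl k G) → ∀ n, G.N n ≤ T.N n := by
  classical
  let S : Set (J.Filtration M) := {G | Bet G ∧ EvP s (gl k G)}
  have h0 : shiftFilt (J.stableFiltration ⊤) ∈ S := by
    refine ⟨⟨fun n => le_rfl, fun n => pow_smul_anti J _ (by omega)⟩, ?_⟩
    exact (lead_zero s).congr (Eventually.of_forall fun n => (zl_eq_zero le_rfl).symm)
  have hsup : ∀ G ∈ S, ∀ G' ∈ S, G ⊔ G' ∈ S := by
    rintro G ⟨hG, hG1⟩ G' ⟨hG', hG1'⟩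
    refine ⟨hG.sup hG', ((hG.sup hG').evP' hy hJ hb).of_le (hG1.add hG1') (gl_nonneg _) ?_⟩
    exact Eventually.of_forall fun n => 
      zl_le_add rl_sup_le (fl_pow' J (n + 1) _) (fl_pow' J (n + 1) _)
  have hle : ∀ G ∈ S, ∀ n, G.N n ≤ (sSup S).N n := fun G hG n => 
    (show G ≤ sSup S from le_sSup hG) n
  have hT : Bet (sSup S) := by
    refine ⟨fun n => hle _ h0 n, ?_⟩
    exact (show sSup S ≤ J.stableFiltration ⊤ from sSup_le fun G hG => hG.1.hi)
  obtain ⟨n0, hn0⟩ := hT.stable.exists_pow_smul_eq_of_ge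
  obtain ⟨P, ⟨G, hG, rfl⟩, hP⟩ := exists_maximal_of_wellFoundedGT
    (fun P : Submodule A M => ∃ G ∈ S, G.N n0 = P) ⟨_, _, h0, rfl⟩
  have hTG : (sSup S).N n0 ≤ G.N n0 := by
    rw [Ideal.Filtration.sSup_N, sSup_apply, iSup_le_iff]
    rintro ⟨_, G', hG', rfl⟩
    exact le_sup_right.trans (hP ⟨_, hsup G hG G' hG', rfl⟩ le_sup_left)
  refine ⟨sSup S, hT, hG.2.congr (eventually_atTop.2 ⟨n0, fun n hn => ?_⟩), 
    fun G hG hG' => hle G ⟨hG, hG'⟩⟩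
  have : G.N n = (sSup S).N n := by
    apply le_antisymm (hle G hG n)
    rw [hn0 n hn]
    refine (Submodule.smul_mono le_rfl hTG).trans ((G.pow_smul_le _ _).trans ?_)
    rw [Nat.sub_add_cancel hn]
  simp only [gl, this]

/-- kernel filtration of an element -/
noncomputable abbrev KF (J : Ideal A) (M : Type w) [AddCommGroup M] [Module A M] (x : A) :
    J.Filtration M :=
  kerFilt x (J.stableFiltration (⊤ : Submodule A M)) (shiftFilt (J.stableFiltration ⊤))

/-- join of the kernel filtrations -/
noncomputable def XF (J : Ideal A) (M : Type w) [AddCommGroup M] [Module A M] (x1 x2 : A) :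
    List A → J.Filtration M
  | [] => shiftFilt (J.stableFiltration ⊤)
  | t :: l => XF J M x1 x2 l ⊔ KF J M (x1 + t * x2)

lemma XF_bet {x1 x2 : A} (h1 : x1 ∈ J) (h2 : x2 ∈ J) (l : List A) :
    Bet (XF J M x1 x2 l) := by
  induction l with
  | nil => exact ⟨fun n => le_rfl, fun n => pow_smul_anti J _ (by omega)⟩
  | cons t l ih => exact ih.sup (bet_ker (J.add_mem h1 (J.mul_mem_left _ h2)))

lemma KF_smul (x : A) (n : ℕ) : Ideal.span {x} • (KF J M x).N n ≤ J ^ (n + 2) • ⊤ := by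
  rw [← map_mx_eq, Submodule.map_le_iff_le_comap]; exact inf_le_right

lemma KF_inf_small {x1 x2 t s : A} {ys : List A} {𝔟 : Ideal A} (h1 : x1 ∈ J) (h2 : x2 ∈ J)
    (hys : ∀ a ∈ ys, a ∈ J) (hJ : J ≤ Ideal.ofList (x1 :: x2 :: ys) ⊔ 𝔟) 
    (hb : 𝔟 • (⊤ : Submodule A M) = ⊥) (hts : IsUnit (t - s)) :
    EvP ys.length (gl k (KF J M (x1 + t * x2) ⊓ KF J M (x1 + s * x2))) := by
  have ht := J.add_mem h1 (J.mul_mem_left t h2)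
  have hs := J.add_mem h1 (J.mul_mem_left s h2)
  refine ((bet_ker ht).inf (bet_ker hs)).evP (𝔟 := 
    Ideal.span {x1 + t * x2} ⊔ Ideal.span {x1 + s * x2} ⊔ 𝔟) hys ?_ fun n => ?_
  · obtain ⟨v, hv⟩ := hts
    have hx2 : x2 ∈ Ideal.span {x1 + t * x2} ⊔ Ideal.span {x1 + s * x2} := by
      have : (↑v⁻¹ : A) * ((x1 + t * x2) - (x1 + s * x2)) = x2 := by
        rw [show (x1 + t * x2) - (x1 + s * x2) = (t - s) * x2 by ring, ← hv, ← mul_assoc]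
        simp
      have h3 := Ideal.mul_mem_left (Ideal.span {x1 + t * x2} ⊔ Ideal.span {x1 + s * x2}) 
        (↑v⁻¹ : A) (Ideal.sub_mem _ 
        (Ideal.mem_sup_left (Ideal.mem_span_singleton_self (x1 + t * x2))) 
        (Ideal.mem_sup_right (Ideal.mem_span_singleton_self (x1 + s * x2))))
      rwa [this] at h3
    have hx1 : x1 ∈ Ideal.span {x1 + t * x2} ⊔ Ideal.span {x1 + s * x2} := by
      have : (x1 + t * x2) - t * x2 = x1 := by ring
      refine (congrArg (· ∈ _) this).mp (Ideal.sub_mem _ (Ideal.mem_sup_left (Ideal.mem_span_singleton_self _))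
        (Ideal.mul_mem_left _ _ hx2))
    refine hJ.trans ?_
    simp only [Ideal.ofList_cons]
    refine sup_le (sup_le ?_ (sup_le ?_ le_sup_left)) (le_sup_right.trans le_sup_right)
    · exact ((Ideal.span_singleton_le_iff_mem _).2 hx1).trans (le_sup_left.trans le_sup_right)
    · exact ((Ideal.span_singleton_le_iff_mem _).2 hx2).trans (le_sup_left.trans le_sup_right)
  · rw [Submodule.sup_smul, Submodule.sup_smul]
    refine sup_le (sup_le ?_ ?_) ?_
    · exact (Submodule.smul_mono le_rfl inf_le_left).trans (KF_smul _ n)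
    · exact (Submodule.smul_mono le_rfl inf_le_right).trans (KF_smul _ n)
    · exact ((Submodule.smul_mono le_rfl le_top).trans hb.le).trans bot_le

lemma XF_inf_small {x1 x2 s : A} {ys : List A} {𝔟 : Ideal A} (h1 : x1 ∈ J) (h2 : x2 ∈ J)
    (hys : ∀ a ∈ ys, a ∈ J) (hJ : J ≤ Ideal.ofList (x1 :: x2 :: ys) ⊔ 𝔟) 
    (hb : 𝔟 • (⊤ : Submodule A M) = ⊥) (l : List A) (hl : ∀ t ∈ l, IsUnit (s - t)) :
    EvP ys.length (gl k (XF J M x1 x2 l ⊓ KF J M (x1 + s * x2))) := by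
  have hs := J.add_mem h1 (J.mul_mem_left s h2)
  have hyl : ∀ a ∈ x1 :: x2 :: ys, a ∈ J := by
    intro a ha; simp only [List.mem_cons] at ha
    rcases ha with rfl | rfl | ha
    exacts [h1, h2, hys a ha]
  induction l with
  | nil =>
    exact (lead_zero _).congr (Eventually.of_forall fun n => (zl_eq_zero inf_le_left).symm)
  | cons t l ih =>
    have ht := J.add_mem h1 (J.mul_mem_left t h2)
    have hK := KF_inf_small (k := k) (t := t) (s := s) h1 h2 hys hJ hb (by
      rw [← neg_sub]; exact (hl t (by simp)).neg)
    have hX := Lead.shift 1 (ih fun t ht => hl t (by simp [ht]))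
    refine (((XF_bet h1 h2 (t :: l)).inf (bet_ker hs)).evP' hyl hJ hb).of_le (hK.add hX) 
      (gl_nonneg _) (Eventually.of_forall fun n => ?_)
    refine zl_le_add ?_ (fl_pow' J (n + 1) _) (fl_pow' J (n + 1 + 1) _)
    have e := rl_add_le (k := k) (S := (XF J M x1 x2 (t :: l) ⊓ KF J M (x1 + s * x2)).N n) 
      (comap_mx_ge (M := M) J _ ht (n + 1))
    rw [e]
    refine add_le_add (rl_mono ?_) ?_
    · refine le_inf (le_inf (inf_le_right.trans (inf_le_right.trans inf_le_left)) ?_) ?_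
      · exact inf_le_left
      · exact inf_le_right.trans inf_le_right
    · rw [rl_comap]
      refine rl_mono (le_inf ?_ ?_)
      · refine (Submodule.map_mono inf_le_left).trans ?_
        change ((XF J M x1 x2 l).N n ⊔ (KF J M (x1 + t * x2)).N n).map _ ≤ _
        rw [Submodule.map_sup]
        refine sup_le ((map_mx_le ht _).trans ((XF J M x1 x2 l).smul_le n)) ?_
        rw [map_mx_eq]
        exact (KF_smul _ n).trans ((XF_bet h1 h2 l).lo (n + 1))
      · exact (Submodule.map_mono inf_le_right).trans ((map_mx_le ht _).trans 
          ((KF J M (x1 + s * x2)).smul_le n))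

lemma KF_evP {x1 x2 s : A} {ys : List A} {𝔟 : Ideal A} (h1 : x1 ∈ J) (h2 : x2 ∈ J)
    (hys : ∀ a ∈ ys, a ∈ J) (hJ : J ≤ Ideal.ofList (x1 :: x2 :: ys) ⊔ 𝔟) 
    (hb : 𝔟 • (⊤ : Submodule A M) = ⊥) :
    EvP (ys.length + 1) (gl k (KF J M (x1 + s * x2))) := by
  refine (bet_ker (J.add_mem h1 (J.mul_mem_left s h2))).evP (y := x2 :: ys) (𝔟 := 
    Ideal.span {x1 + s * x2} ⊔ 𝔟) (by simpa using ⟨h2, hys⟩) ?_ fun n => ?_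
  · have hx1 : x1 ∈ Ideal.span {x2} ⊔ Ideal.span {x1 + s * x2} := by
      have : (x1 + s * x2) - s * x2 = x1 := by ring
      refine (congrArg (· ∈ _) this).mp (Ideal.sub_mem _ (Ideal.mem_sup_right (Ideal.mem_span_singleton_self _))
        (Ideal.mul_mem_left _ _ (Ideal.mem_sup_left (Ideal.mem_span_singleton_self _))))
    refine hJ.trans ?_
    simp only [Ideal.ofList_cons]
    refine sup_le (sup_le ?_ le_sup_left) (le_sup_right.trans le_sup_right)
    refine ((Ideal.span_singleton_le_iff_mem _).2 hx1).trans ?_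
    exact sup_le (le_sup_left.trans le_sup_left) (le_sup_left.trans le_sup_right)
  · rw [Submodule.sup_smul]
    refine sup_le (KF_smul _ n) ?_
    exact ((Submodule.smul_mono le_rfl le_top).trans hb.le).trans bot_le

lemma XF_lead {x1 x2 : A} {ys : List A} {𝔟 : Ideal A} (h1 : x1 ∈ J) (h2 : x2 ∈ J)
    (hys : ∀ a ∈ ys, a ∈ J) (hJ : J ≤ Ideal.ofList (x1 :: x2 :: ys) ⊔ 𝔟) 
    (hb : 𝔟 • (⊤ : Submodule A M) = ⊥) (l : List A) (hl : l.Pairwise fun s t => IsUnit (s - t))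
    (hn : ∀ t ∈ l, ¬ EvP ys.length (gl k (KF J M (x1 + t * x2)))) :
    ∃ c : ℤ, l.length ≤ c ∧ Lead ys.length (gl k (XF J M x1 x2 l)) c := by
  induction l with
  | nil =>
    exact ⟨0, le_rfl, (lead_zero _).congr (Eventually.of_forall fun n => (zl_eq_zero le_rfl).symm)⟩
  | cons s l ih =>
    rw [List.pairwise_cons] at hl
    obtain ⟨c, hc, hL⟩ := ih hl.2 fun t ht => hn t (by simp [ht])
    obtain ⟨e, he⟩ := (KF_evP (k := k) (s := s) h1 h2 hys hJ hb).exists_lead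
    have he0 := he.nonneg (gl_nonneg _)
    have he1 : e ≠ 0 := by
      rintro rfl
      exact hn s (by simp) he
    refine ⟨c + e - 0, ?_, ((hL.add he).sub 
      (XF_inf_small (k := k) (s := s) h1 h2 hys hJ hb l hl.1)).congr ?_⟩
    · simp only [List.length_cons]; push_cast; omega
    · refine Eventually.of_forall fun n => ?_
      have hX := (XF_bet (M := M) h1 h2 l)
      have hK := (bet_ker (M := M) (J.add_mem h1 (J.mul_mem_left s h2)))
      have a1 : zl k (J ^ (n + 1) • ⊤) ((XF J M x1 x2 l).N n ⊔ (KF J M (x1 + s * x2)).N n) = 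
        zl k (J ^ (n + 1) • ⊤) ((XF J M x1 x2 l).N n) + 
        zl k ((XF J M x1 x2 l).N n) ((XF J M x1 x2 l).N n ⊔ (KF J M (x1 + s * x2)).N n) :=
        zl_add (hX.lo n) le_sup_left (fl_pow' J (n + 1) _)
      have a2 : zl k (J ^ (n + 1) • ⊤) ((KF J M (x1 + s * x2)).N n) = 
        zl k (J ^ (n + 1) • ⊤) ((XF J M x1 x2 l).N n ⊓ (KF J M (x1 + s * x2)).N n) + 
        zl k ((XF J M x1 x2 l).N n ⊓ (KF J M (x1 + s * x2)).N n) ((KF J M (x1 + s * x2)).N n) :=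
        zl_add (le_inf (hX.lo n) (hK.lo n)) inf_le_right (fl_pow' J (n + 1) _)
      have a3 := zl_congr (rl_sup (k := k) (P := (XF J M x1 x2 l).N n) 
        (Q := (KF J M (x1 + s * x2)).N n))
      have a4 := zl_congr (rl_inf (k := k) (P := (XF J M x1 x2 l).N n) 
        (Q := (KF J M (x1 + s * x2)).N n))
      change zl k (J ^ (n + 1) • ⊤) ((XF J M x1 x2 l).N n) + 
        zl k (J ^ (n + 1) • ⊤) ((KF J M (x1 + s * x2)).N n) - 
        zl k (J ^ (n + 1) • ⊤) ((XF J M x1 x2 l).N n ⊓ (KF J M (x1 + s * x2)).N n) = 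
        zl k (J ^ (n + 1) • ⊤) ((XF J M x1 x2 l).N n ⊔ (KF J M (x1 + s * x2)).N n)
      rw [a1, a2, a3, a4]; ring

end generic
end CM
end part_9

section part_10
open Filter
namespace CM
universe u v w

section transfer
variable {k : Type u} {A : Type v} [CommRing k] [CommRing A] [Algebra k A]
variable {M : Type w} [AddCommGroup M] [Module A M] [Module k M] [IsScalarTower k A M]

lemma rl_bot_left (N : Submodule A M) : rl k ⊥ N = Module.length k N := by
  unfold rl
  exact ((Submodule.equivMapOfInjective (⊥ : Submodule A M).mkQ 
    (by rw [← LinearMap.ker_eq_bot, Submodule.ker_mkQ]) N).restrictScalars k).symm.length_eq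

lemma rl_ker {N : Type*} [AddCommGroup N] [Module A N] [Module k N] [IsScalarTower k A N] 
    (f : M →ₗ[A] N) (P Q : Submodule A M) (hP : LinearMap.ker f = P) :
    rl k P Q = Module.length k (Q.map f) := by
  rw [← rl_bot_left, ← rl_comap, ← hP]; rfl

variable {A' : Type*} [CommRing A'] [Algebra A A'] [Algebra k A'] [IsScalarTower k A A']
variable {M' : Type*} [AddCommGroup M'] [Module A' M'] [Module A M'] [Module k M']
variable [IsScalarTower A A' M'] [IsScalarTower k A' M'] [IsScalarTower k A M']

lemma rl_rs (P Q : Submodule A' M') :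
    rl k P Q = rl k (P.restrictScalars A) (Q.restrictScalars A) := by
  haveI : IsScalarTower k A (M' ⧸ P) := ⟨fun a b c => by
    induction c using Submodule.Quotient.induction_on with
    | _ m => rw [← Submodule.Quotient.mk_smul, ← Submodule.Quotient.mk_smul, 
               ← Submodule.Quotient.mk_smul, smul_assoc]⟩
  rw [rl_ker (P.mkQ.restrictScalars A) (P.restrictScalars A) _ (by ext; simp)]
  unfold rl
  exact LinearEquiv.length_eq 
    { toFun := fun x => ⟨x.1, x.2⟩
      invFun := fun x => ⟨x.1, x.2⟩
      map_add' := fun _ _ => rfl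
      map_smul' := fun _ _ => rfl
      left_inv := fun _ => rfl
      right_inv := fun _ => rfl }

variable {ι : Type} [Fintype ι]

/-- constant product submodule -/
def piS (ι : Type) (P : Submodule A M) : Submodule A (ι → M) := Submodule.pi Set.univ fun _ => P

lemma mem_piS {P : Submodule A M} {f : ι → M} : f ∈ piS ι P ↔ ∀ i, f i ∈ P := by
  simp [piS, Submodule.mem_pi]

lemma rl_pi (P Q : Submodule A M) : 
    rl k (piS ι P) (piS ι Q) = Fintype.card ι * rl k P Q := by
  let f : (ι → M) →ₗ[A] (ι → M ⧸ P) := LinearMap.pi fun i => P.mkQ ∘ₗ LinearMap.proj i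
  have hf : ∀ m i, f m i = P.mkQ (m i) := fun _ _ => rfl
  rw [rl_ker f (piS ι P) _ (by
    ext m; simp only [LinearMap.mem_ker, mem_piS, funext_iff, hf]; simp)]
  unfold rl
  have := Module.length_pi (R := k) (M := Q.map P.mkQ) (ι := ι)
  rw [ENat.card_eq_coe_fintype_card] at this
  rw [← this]
  refine LinearEquiv.length_eq 
    { toFun := fun x i => ⟨x.1 i, ?_⟩
      invFun := fun x => ⟨fun i => (x i).1, ?_⟩
      map_add' := fun _ _ => rfl
      map_smul' := fun _ _ => rfl
      left_inv := fun _ => rfl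
      right_inv := fun _ => rfl }
  · obtain ⟨y, hy⟩ := x
    obtain ⟨m, hm, rfl⟩ := hy
    exact ⟨m i, mem_piS.1 hm i, rfl⟩
  · choose g hg hg' using fun i => (x i).2
    exact ⟨g, mem_piS.2 hg, funext hg'⟩

lemma smul_piS (I : Ideal A) : (I • ⊤ : Submodule A (ι → M)) = piS ι (I • ⊤) := by
  classical
  apply le_antisymm
  · rw [Submodule.smul_le]
    intro a ha m _
    rw [mem_piS]
    intro i
    exact Submodule.smul_mem_smul ha trivial
  · intro m hm
    rw [mem_piS] at hm
    rw [← Finset.univ_sum_single m]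
    refine Submodule.sum_mem _ fun i _ => ?_
    have h : (I • ⊤ : Submodule A M).map (LinearMap.single A (fun _ : ι => M) i) ≤ I • ⊤ := by
      rw [Submodule.map_smul'']
      exact Submodule.smul_mono le_rfl le_top
    exact h ⟨_, hm i, rfl⟩

variable (J : Ideal A)

/-- extended submodule -/
def exS (e : M' ≃ₗ[A] (ι → M)) (P : Submodule A M) : Submodule A M' := (piS ι P).comap (e : M' →ₗ[A] (ι → M))

lemma rl_ex (e : M' ≃ₗ[A] (ι → M)) (P Q : Submodule A M) : 
    rl k (exS e P) (exS e Q) = Fintype.card ι * rl k P Q := by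
  rw [exS, rl_comap, exS, Submodule.map_comap_eq_of_surjective e.surjective, rl_pi]

lemma map_pow_rs (A' : Type*) [CommRing A'] [Algebra A A'] {M' : Type*} [AddCommGroup M'] 
    [Module A' M'] [Module A M'] [IsScalarTower A A' M'] (n : ℕ) (W : Submodule A' M') : 
    ((J.map (algebraMap A A')) ^ n • W).restrictScalars A = 
      J ^ n • W.restrictScalars A := by
  rw [← Ideal.map_pow, Ideal.smul_restrictScalars]

lemma pow_rs (A' : Type*) [CommRing A'] [Algebra A A'] {M' : Type*} [AddCommGroup M'] 
    [Module A' M'] [Module A M'] [IsScalarTower A A' M'] (e : M' ≃ₗ[A] (ι → M)) (n : ℕ) : 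
    ((J.map (algebraMap A A')) ^ n • ⊤ : Submodule A' M').restrictScalars A = 
      exS e (J ^ n • ⊤) := by
  rw [map_pow_rs, exS, ← smul_piS, Submodule.restrictScalars_top]
  have := Submodule.map_smul'' (J ^ n) (⊤ : Submodule A M') (e : M' →ₗ[A] (ι → M))
  rw [Submodule.map_top, LinearMap.range_eq_top.2 e.surjective] at this
  rw [← this, Submodule.comap_map_eq_of_injective e.injective]

lemma rl_pow_ex (e : M' ≃ₗ[A] (ι → M)) (m n : ℕ) : 
    rl k ((J.map (algebraMap A A')) ^ m • ⊤ : Submodule A' M') 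
      ((J.map (algebraMap A A')) ^ n • ⊤) = 
      Fintype.card ι * rl k (J ^ m • ⊤ : Submodule A M) (J ^ n • ⊤) := by
  rw [rl_rs (A := A), pow_rs J A' e, pow_rs J A' e, rl_ex]

lemma rl_pow_ex_top (e : M' ≃ₗ[A] (ι → M)) (m : ℕ) : 
    rl k ((J.map (algebraMap A A')) ^ m • ⊤ : Submodule A' M') ⊤ = 
      Fintype.card ι * rl k (J ^ m • ⊤ : Submodule A M) ⊤ := by
  simpa using rl_pow_ex (k := k) (A' := A') J e m 0

lemma rl_pow_ex_one (e : M' ≃ₗ[A] (ι → M)) : 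
    rl k (J.map (algebraMap A A') • ⊤ : Submodule A' M') ⊤ = 
      Fintype.card ι * rl k (J • ⊤ : Submodule A M) ⊤ := by
  have := rl_pow_ex_top (k := k) (A' := A') J e 1
  rwa [pow_one, pow_one] at this

lemma fl_ex (e : M' ≃ₗ[A] (ι → M)) [FL k J M] : FL k (J.map (algebraMap A A')) M' := ⟨by
  rw [rl_pow_ex_one J e]
  exact WithTop.mul_ne_top (ENat.natCast_ne_top _) FL.out⟩

lemma HS_ex (e : M' ≃ₗ[A] (ι → M)) (n : ℕ) : HS k (J.map (algebraMap A A')) M' n = Fintype.card ι * HS k J M n := by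
  unfold HS zl
  rw [rl_pow_ex_top J e]
  simp

lemma CMn_ex (e : M' ≃ₗ[A] (ι → M)) [Nonempty ι] {r : ℕ} (h : CMn k (J.map (algebraMap A A')) M' r) : CMn k J M r := by
  intro n
  have := h n
  rw [rl_pow_ex J e, rl_pow_ex_one J e, mul_assoc] at this
  refine (ENat.mul_right_strictMono ?_ ?_).injective this
  · simp
  · simp

lemma Pure_ex (e : M' ≃ₗ[A] (ι → M)) [IsNoetherianRing A] [Module.Finite A M] [FL k J M] [IsNoetherianRing A']
    [Module.Finite A' M'] {s : ℕ} (h : Pure k J M s) : 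
    Pure k (J.map (algebraMap A A')) M' s := by
  haveI := fl_ex (k := k) J e (A' := A')
  intro W hW
  have key : ∀ i, (W.restrictScalars A).map (LinearMap.proj i ∘ₗ (e : M' →ₗ[A] (ι → M))) = ⊥ := by
    intro i
    apply h
    refine small_of_le J hW (Eventually.of_forall fun n => ?_)
    have h1 := fl_sub (k := k) (J.map (algebraMap A A')) W n
    have h2 := rl_rs (k := k) (A := A) ((J.map (algebraMap A A')) ^ n • W) W
    change (rl k _ _).toNat ≤ ((rl k _ _).toNat : ℤ)
    rw [h2]
    rw [h2] at h1
    have h3 := rl_map_le (k := k) (LinearMap.proj i ∘ₗ (e : M' →ₗ[A] (ι → M))) 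
      (((J.map (algebraMap A A')) ^ n • W).restrictScalars A) (W.restrictScalars A)
    rw [map_pow_rs, Submodule.map_smul'', ← map_pow_rs] at h3
    exact_mod_cast ENat.toNat_le_toNat h3 h1
  rw [Submodule.eq_bot_iff]
  intro m hm
  apply e.injective
  rw [map_zero]
  ext i
  exact (Submodule.mem_bot A).1 ((key i) ▸ ⟨m, hm, rfl⟩)

/-- projected filtration -/
def prF (e : M' ≃ₗ[A] (ι → M)) (G : (J.map (algebraMap A A')).Filtration M') (i : ι) : J.Filtration M where
  N n := ((G.N n).restrictScalars A).map (LinearMap.proj i ∘ₗ (e : M' →ₗ[A] (ι → M)))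
  mono n := Submodule.map_mono (show (G.N (n + 1)).restrictScalars A ≤ (G.N n).restrictScalars A from G.mono n)
  smul_le n := by
    rw [← Submodule.map_smul'', ← Ideal.smul_restrictScalars]
    exact Submodule.map_mono (show (J.map (algebraMap A A') • G.N n).restrictScalars A ≤ 
      (G.N (n + 1)).restrictScalars A from G.smul_le n)

lemma pow_pr (e : M' ≃ₗ[A] (ι → M)) (n : ℕ) (i : ι) : (((J.map (algebraMap A A')) ^ n • ⊤ : 
    Submodule A' M').restrictScalars A).map (LinearMap.proj i ∘ₗ (e : M' →ₗ[A] (ι → M))) = 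
    J ^ n • ⊤ := by
  classical
  rw [map_pow_rs, Submodule.map_smul'', Submodule.restrictScalars_top, Submodule.map_top, 
    LinearMap.range_eq_top.2]
  exact (LinearMap.proj_surjective (R := A) (φ := fun _ : ι => M) i).comp e.surjective

theorem exists_superficial [IsNoetherianRing A] [Module.Finite A M] [FL k J M] 
    {x1 x2 : A} {ys : List A} {𝔟 : Ideal A} (h1 : x1 ∈ J) (h2 : x2 ∈ J)
    (hys : ∀ a ∈ ys, a ∈ J) (hJ : J ≤ Ideal.ofList (x1 :: x2 :: ys) ⊔ 𝔟) 
    (hb : 𝔟 • (⊤ : Submodule A M) = ⊥) : ∃ B : ℕ, 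
    ∀ (A' : Type v) (_ : CommRing A') (_ : Algebra A A') (_ : Algebra k A') 
    (_ : IsScalarTower k A A') (M' : Type (max v w)) (_ : AddCommGroup M') (_ : Module A' M') 
    (_ : Module A M') (_ : Module k M')
    (_ : IsScalarTower A A' M') (_ : IsScalarTower k A' M') (_ : IsScalarTower k A M')
    (ι : Type) (_ : Fintype ι) (_ : M' ≃ₗ[A] (ι → M)) (_ : IsNoetherianRing A') 
    (_ : Module.Finite A' M') (l : List A') (_ : l.Pairwise fun s t => IsUnit (s - t)) 
    (_ : Fintype.card ι * B < l.length), ∃ t : A', 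
    EvP ys.length (gl k (KF (J.map (algebraMap A A')) M' 
      (algebraMap A A' x1 + t * algebraMap A A' x2))) := by
  have hyl : ∀ a ∈ x1 :: x2 :: ys, a ∈ J := by
    intro a ha; simp only [List.mem_cons] at ha
    rcases ha with rfl | rfl | ha
    exacts [h1, h2, hys a ha]
  obtain ⟨T, hT, hTe, hmax⟩ := exists_greatest (k := k) hyl hJ hb (ys.length + 1)
  obtain ⟨B, hB⟩ := hTe.exists_lead
  refine ⟨B.toNat, ?_⟩
  intro A' _ _ _ _ M' _ _ _ _ _ _ _ ι _ e _ _ l hl hlen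
  haveI := fl_ex (k := k) J e (A' := A')
  by_contra! hcon
  have h1' := Ideal.mem_map_of_mem (algebraMap A A') h1
  have h2' := Ideal.mem_map_of_mem (algebraMap A A') h2
  have hys' : ∀ a ∈ ys.map (algebraMap A A'), a ∈ J.map (algebraMap A A') := by
    intro a ha
    obtain ⟨b, hb, rfl⟩ := List.mem_map.1 ha
    exact Ideal.mem_map_of_mem _ (hys b hb)
  have hJ' : J.map (algebraMap A A') ≤ Ideal.ofList (algebraMap A A' x1 :: algebraMap A A' x2 :: 
      ys.map (algebraMap A A')) ⊔ 𝔟.map (algebraMap A A') := by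
    rw [← List.map_cons, ← List.map_cons, ← Ideal.map_ofList, ← Ideal.map_sup]
    exact Ideal.map_mono hJ
  have hb' : 𝔟.map (algebraMap A A') • (⊤ : Submodule A' M') = ⊥ := by
    have := pow_rs 𝔟 A' e 1
    rw [pow_one, pow_one, hb] at this
    rw [Submodule.eq_bot_iff]
    intro m hm
    have h3 : m ∈ exS e (⊥ : Submodule A M) := this ▸ hm
    apply e.injective
    rw [map_zero]
    ext i
    exact (Submodule.mem_bot A).1 (mem_piS.1 h3 i)
  have hlen' : (ys.map (algebraMap A A')).length = ys.length := by simp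
  obtain ⟨c, hc, hL⟩ := XF_lead (k := k) (M := M') h1' h2' hys' hJ' hb' l hl (fun t _ => by
    rw [hlen']; exact hcon t)
  rw [hlen'] at hL
  have hXT : ∀ n, ((XF (J.map (algebraMap A A')) M' (algebraMap A A' x1) 
      (algebraMap A A' x2) l).N n).restrictScalars A ≤ exS e (T.N n) := by
    have : ∀ t : A', ∀ n, ((KF (J.map (algebraMap A A')) M' (algebraMap A A' x1 + 
        t * algebraMap A A' x2)).N n).restrictScalars A ≤ exS e (T.N n) := by
      intro t n m hm
      set G := KF (J.map (algebraMap A A')) M' (algebraMap A A' x1 + t * algebraMap A A' x2) with hG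
      have hGb : Bet G := bet_ker (Ideal.add_mem _ h1' (Ideal.mul_mem_left _ t h2'))
      refine mem_piS.2 fun i => ?_
      have hpb : Bet (prF J e G i) := by
        refine ⟨fun n => ?_, fun n => ?_⟩
        · rw [← pow_pr (A' := A') J e (n + 1) i]; exact Submodule.map_mono (show Submodule.restrictScalars A _ ≤ Submodule.restrictScalars A _ from hGb.lo n)
        · rw [← pow_pr (A' := A') J e n i]; exact Submodule.map_mono (show Submodule.restrictScalars A _ ≤ Submodule.restrictScalars A _ from hGb.hi n)
      have hev := KF_evP (k := k) (M := M') (s := t) h1' h2' hys' hJ' hb'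
      rw [hlen'] at hev
      refine hmax (prF J e G i) hpb ((hpb.evP' hyl hJ hb).of_le hev (gl_nonneg _) 
        (Eventually.of_forall fun n => ?_)) n ⟨m, hm, rfl⟩
      have g1 := fl_pow' (k := k) (J.map (algebraMap A A')) (n + 1) (G.N n)
      have g2 := rl_map_le (k := k) (LinearMap.proj i ∘ₗ (e : M' →ₗ[A] (ι → M))) 
        (((J.map (algebraMap A A')) ^ (n + 1) • ⊤ : Submodule A' M').restrictScalars A) 
        ((G.N n).restrictScalars A)
      rw [pow_pr, ← rl_rs] at g2
      exact Int.ofNat_le.2 (ENat.toNat_le_toNat g2 g1)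
    clear hL hc hlen hl
    induction l with
    | nil =>
      intro n
      have : ((XF (J.map (algebraMap A A')) M' (algebraMap A A' x1) 
        (algebraMap A A' x2) []).N n).restrictScalars A = exS e (J ^ (n + 1) • ⊤) := pow_rs J A' e (n + 1)
      rw [this]
      exact fun m hm => mem_piS.2 fun i => hT.lo n (mem_piS.1 hm i)
    | cons t l ih =>
      intro n
      change (_ ⊔ _ : Submodule A' M').restrictScalars A ≤ _
      rw [Submodule.restrictScalars_sup]
      exact sup_le (ih n) (this t n)
  have hfin := (hB.mul (Fintype.card ι)).sub hL
  have hge := hfin.nonneg (Eventually.of_forall fun n => ?_)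
  · have hB0 := hB.nonneg (gl_nonneg _)
    zify at hlen
    rw [Int.toNat_of_nonneg hB0] at hlen
    linarith
  · rw [sub_nonneg]
    have g3 : rl k ((J.map (algebraMap A A')) ^ (n + 1) • ⊤ : Submodule A' M') ((XF (J.map (algebraMap A A')) M' (algebraMap A A' x1) 
      (algebraMap A A' x2) l).N n) ≤ Fintype.card ι * rl k (J ^ (n + 1) • ⊤) (T.N n) := by
      rw [rl_rs (A := A), pow_rs J A' e, ← rl_ex e]
      exact rl_mono (hXT n)
    have g4 := ENat.toNat_le_toNat g3 (WithTop.mul_ne_top (ENat.natCast_ne_top _) (fl_pow' J (n + 1) _))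
    rw [ENat.toNat_mul] at g4
    simp only [ENat.toNat_natCast] at g4
    unfold gl zl
    exact_mod_cast g4

end transfer
end CM
end part_10

section part_11
open Filter
namespace CM
universe u v w

section ext
open Polynomial

lemma exists_poly (κ : Type u) [Field κ] (B : ℕ) : ∃ f : κ[X], f.Monic ∧ Irreducible f ∧ 
    ∃ S : Finset (AdjoinRoot f), f.natDegree * B < S.card := by
  classical
  by_cases hκ : Finite κ
  · obtain ⟨p, hp⟩ := CharP.exists κ
    haveI : Fact p.Prime := ⟨(CharP.char_is_prime κ p)⟩
    let n := 2 * (2 * B + 1)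
    haveI : NeZero n := ⟨by simp [n]⟩
    obtain ⟨α, hα⟩ := Field.exists_primitive_element_of_finite_bot κ (FiniteField.Extension κ p n)
    have hint : IsIntegral κ α := Algebra.IsIntegral.isIntegral α
    have hirr := minpoly.irreducible hint
    have hdeg : (minpoly κ α).natDegree = n := by
      rw [(Field.primitive_element_iff_minpoly_natDegree_eq κ α).1 hα, 
        FiniteField.finrank_extension]
    refine ⟨minpoly κ α, minpoly.monic hint, hirr, ?_⟩
    haveI : Fact (Irreducible (minpoly κ α)) := ⟨hirr⟩
    let pb := AdjoinRoot.powerBasis hirr.ne_zero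
    haveI : Module.Finite κ (AdjoinRoot (minpoly κ α)) := pb.finite
    haveI : Finite (AdjoinRoot (minpoly κ α)) := Module.finite_of_finite κ
    haveI := Fintype.ofFinite (AdjoinRoot (minpoly κ α))
    haveI := Fintype.ofFinite κ
    refine ⟨Finset.univ, ?_⟩
    rw [Finset.card_univ, Module.card_eq_pow_finrank (K := κ), pb.finrank, 
      AdjoinRoot.powerBasis_dim, hdeg]
    have h2 : 2 ≤ Fintype.card κ := Fintype.one_lt_card
    refine lt_of_lt_of_le ?_ (Nat.pow_le_pow_left h2 n)
    have h3 : 2 * B + 1 < 2 ^ (2 * B + 1) := Nat.lt_two_pow_self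
    have : 2 ^ n = 2 ^ (2 * B + 1) * 2 ^ (2 * B + 1) := by rw [← pow_add]; congr 1; omega
    rw [this]
    simp only [n]
    nlinarith
  · haveI : Infinite κ := not_finite_iff_infinite.1 hκ
    refine ⟨X, monic_X, irreducible_X, ?_⟩
    haveI : Fact (Irreducible (X : κ[X])) := ⟨irreducible_X⟩
    haveI : Infinite (AdjoinRoot (X : κ[X])) := 
      Infinite.of_injective _ (algebraMap κ (AdjoinRoot (X : κ[X]))).injective
    obtain ⟨S, hS⟩ := Infinite.exists_subset_card_eq (AdjoinRoot (X : κ[X])) (B + 1)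
    exact ⟨S, by rw [hS]; simp⟩

lemma map_le_jacobson {A : Type*} {A' : Type*} [CommRing A] [CommRing A'] [Algebra A A'] 
    [Algebra.IsIntegral A A'] {I : Ideal A} (h : I ≤ Ideal.jacobson ⊥) :
    I.map (algebraMap A A') ≤ Ideal.jacobson ⊥ := by
  unfold Ideal.jacobson at h ⊢
  refine le_sInf ?_
  rintro P ⟨-, hP⟩
  rw [Ideal.map_le_iff_le_comap]
  exact h.trans (sInf_le ⟨bot_le, Ideal.isMaximal_comap_of_isIntegral_of_isMaximal P⟩)

lemma exists_ext (k : Type u) [CommRing k] [IsLocalRing k] (A : Type v) [CommRing A] [Algebra k A]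
    [Nontrivial A] 
    (hm : (IsLocalRing.maximalIdeal k).map (algebraMap k A) ≤ Ideal.jacobson ⊥) (B : ℕ) : 
    ∃ (A' : Type v) (_ : CommRing A') (_ : Algebra A A') (_ : Algebra k A') 
    (_ : IsScalarTower k A A') (r : ℕ) (_ : Module.Basis (Fin r) A A') (l : List A'), 0 < r ∧ 
    l.Pairwise (fun s t => IsUnit (s - t)) ∧ r * B < l.length := by
  classical
  obtain ⟨f0, hf0, hirr, S, hS⟩ := exists_poly (IsLocalRing.ResidueField k) B
  have hsurj : Function.Surjective (IsLocalRing.residue k) := IsLocalRing.residue_surjective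
  have hpsurj := Polynomial.map_surjective _ hsurj
  obtain ⟨f, hf, hfd, hfm⟩ := lifts_and_natDegree_eq_and_monic 
    ((Polynomial.mem_lifts (f := IsLocalRing.residue k) f0).2 (hpsurj f0)) hf0
  have hm' := hfm.map (algebraMap k A)
  let A' := AdjoinRoot (f.map (algebraMap k A))
  have hdim : (AdjoinRoot.powerBasis' hm').dim = f0.natDegree := by
    rw [AdjoinRoot.powerBasis'_dim, hfm.natDegree_map, hfd]
  choose g hg using fun z : AdjoinRoot f0 => AdjoinRoot.mk_surjective z
  choose G hG using fun z : (IsLocalRing.ResidueField k)[X] => hpsurj z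
  haveI : Module.Finite A A' := (AdjoinRoot.powerBasis' hm').finite
  have hj : (IsLocalRing.maximalIdeal k).map (algebraMap k A') ≤ Ideal.jacobson ⊥ := by
    rw [IsScalarTower.algebraMap_eq k A A', ← Ideal.map_map]
    exact map_le_jacobson hm
  refine ⟨A', inferInstance, inferInstance, inferInstance, inferInstance, _, 
    (AdjoinRoot.powerBasis' hm').basis, S.toList.map fun z => 
      AdjoinRoot.mk _ ((G (g z)).map (algebraMap k A)), ?_, ?_, ?_⟩
  · rw [hdim]; exact hirr.natDegree_pos
  · rw [List.pairwise_map]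
    refine List.Pairwise.imp ?_ S.nodup_toList
    intro z w hzw
    have hcop : IsCoprime f0 (g z - g w) := by
      rw [hirr.coprime_iff_not_dvd]
      intro hd
      rw [← AdjoinRoot.mk_eq_zero, map_sub, hg, hg, sub_eq_zero] at hd
      exact hzw hd
    obtain ⟨a, b, hab⟩ := hcop
    have hh : (G a * f + G b * (G (g z) - G (g w)) - 1).map (IsLocalRing.residue k) = 0 := by
      rw [Polynomial.map_sub, Polynomial.map_add, Polynomial.map_mul, Polynomial.map_mul, 
        Polynomial.map_sub, hG, hG, hG, hG, hf, Polynomial.map_one, hab, sub_self]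
    have hh2 : G a * f + G b * (G (g z) - G (g w)) - 1 ∈ 
        (IsLocalRing.maximalIdeal k).map (C : k →+* k[X]) := by
      rw [Ideal.mem_map_C_iff]
      intro n
      have := congrArg (fun q => Polynomial.coeff q n) hh
      simp only [Polynomial.coeff_map, Polynomial.coeff_zero] at this
      exact (IsLocalRing.residue_eq_zero_iff _).1 this
    let φ : k[X] →+* A' := (AdjoinRoot.mk (f.map (algebraMap k A))).comp 
      (Polynomial.mapRingHom (algebraMap k A))
    have hφ : φ.comp C = algebraMap k A' := by
      ext c
      simp only [φ, RingHom.comp_apply, coe_mapRingHom, map_C, AdjoinRoot.mk_C]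
      rfl
    have hh3 := Ideal.mem_map_of_mem φ hh2
    rw [Ideal.map_map, hφ] at hh3
    have hφf : φ f = 0 := by simp [φ]
    rw [map_sub, map_add, map_mul, map_mul, hφf, mul_zero, zero_add, map_one, map_sub] at hh3
    have h4 := Ideal.mem_jacobson_bot.1 (hj hh3) 1
    rw [mul_one, sub_add_cancel] at h4
    exact isUnit_of_mul_isUnit_right h4
  · rw [hdim, List.length_map, Finset.length_toList]; exact hS

end ext

/-- all finite modules are precomplete -/
def Cpl {A : Type v} [CommRing A] (J : Ideal A) : Prop :=
  ∀ (N : Type (max v w)) [AddCommGroup N] [Module A N] [Module.Finite A N], IsPrecomplete J N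

lemma Cpl.ext {A A' : Type v} [CommRing A] [CommRing A'] [Algebra A A'] [Module.Finite A A']
    {J : Ideal A} (h : Cpl.{v, w} J) : Cpl.{v, w} (J.map (algebraMap A A')) := by
  intro N _ _ _
  letI : Module A N := Module.compHom N (algebraMap A A')
  haveI : IsScalarTower A A' N := ⟨fun a b c => by 
    rw [Algebra.smul_def, mul_smul]; rfl⟩
  haveI : Module.Finite A N := Module.Finite.trans A' N
  have hN := h N
  refine ⟨fun f hf => ?_⟩
  obtain ⟨L, hL⟩ := hN.prec' f (fun {m n} hmn => by
    rw [SModEq.sub_mem]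
    have := hf hmn
    rw [SModEq.sub_mem] at this
    have h2 : f m - f n ∈ (((J.map (algebraMap A A')) ^ m • ⊤ : Submodule A' N).restrictScalars A) := this
    rwa [map_pow_rs] at h2)
  refine ⟨L, fun n => ?_⟩
  have := hL n
  rw [SModEq.sub_mem] at this ⊢
  have h2 : f n - L ∈ (((J.map (algebraMap A A')) ^ n • ⊤ : Submodule A' N).restrictScalars A) := by
    rwa [map_pow_rs]
  exact h2

end CM
end part_11

section part_12
open Filter
namespace CM
universe u v w
open TensorProduct

section main

lemma CMn.congr {k : Type u} {A : Type v} [CommRing k] [CommRing A] [Algebra k A]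
    {M : Type w} [AddCommGroup M] [Module A M] [Module k M] [IsScalarTower k A M]
    {M' : Type*} [AddCommGroup M'] [Module A M'] [Module k M'] [IsScalarTower k A M'] 
    (J : Ideal A) (e : M ≃ₗ[A] M') {r : ℕ} (h : CMn k J M r) : CMn k J M' r := by
  have ht : (⊤ : Submodule A M).map (e : M →ₗ[A] M') = ⊤ := by
    rw [Submodule.map_top]; exact LinearMap.range_eq_top.2 e.surjective
  intro n
  have := h n
  rw [← rl_map (k := k) (e : M →ₗ[A] M') e.injective, 
    ← rl_map (k := k) (e : M →ₗ[A] M') e.injective (J • ⊤)] at this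
  simpa only [Submodule.map_smul'', ht] using this

theorem main_ind (k : Type u) [CommRing k] [IsLocalRing k] (s : ℕ) : 
    ∀ (A : Type v) [CommRing A] [Algebra k A] [Nontrivial A] [IsNoetherianRing A] (J : Ideal A)
    (_ : (IsLocalRing.maximalIdeal k).map (algebraMap k A) ≤ Ideal.jacobson ⊥)
    (_ : J ≤ Ideal.jacobson ⊥) (_ : Cpl.{v, w} J) (y : List A) (_ : y.length = s + 1)
    (_ : ∀ a ∈ y, a ∈ J) (𝔟 : Ideal A) (_ : J ≤ Ideal.ofList y ⊔ 𝔟)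
    (M : Type (max v w)) [AddCommGroup M] [Module A M] [Module k M] [IsScalarTower k A M]
    [Module.Finite A M] [FL k J M] (_ : 𝔟 • (⊤ : Submodule A M) = ⊥) (e0 e1 : ℤ)
    (_ : Ch s (HS k J M) e0 e1) (_ : Pure k J M (s + 1)), 
    e1 ≤ 0 ∧ (e1 = 0 → CMn k J M (s + 1)) := by
  induction s with
  | zero =>
    intro A _ _ _ _ J hm hJJ hC y hlen hy 𝔟 hJ M _ _ _ _ _ _ hb e0 e1 hCh hp
    obtain ⟨x, rfl⟩ := List.length_eq_one_iff.1 hlen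
    have h := base_case (k := k) J (hy x (by simp)) hJ hb hp
    exact ⟨(base_e1 J h hCh).le, fun _ => h⟩
  | succ s ih =>
    intro A _ _ _ _ J hm hJJ hC y hlen hy 𝔟 hJ M _ _ _ _ _ _ hb e0 e1 hCh hp
    obtain ⟨x1, y, rfl⟩ := List.exists_cons_of_length_eq_add_one hlen
    obtain ⟨x2, ys, rfl⟩ := List.exists_cons_of_length_eq_add_one (by simpa using hlen : y.length = s + 1)
    have hs : ys.length = s := by simpa using hlen
    have h1 : x1 ∈ J := hy x1 (by simp)
    have h2 : x2 ∈ J := hy x2 (by simp)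
    have hys : ∀ a ∈ ys, a ∈ J := fun a ha => hy a (by simp [ha])
    obtain ⟨B, hB⟩ := exists_superficial (k := k) J h1 h2 hys hJ hb
    obtain ⟨A', _, _, _, _, r, b, l, hr, hl, hll⟩ := exists_ext k A hm B
    haveI : Module.Finite A A' := Module.Finite.of_basis b
    haveI : IsNoetherianRing A' := IsNoetherianRing.of_finite A A'
    haveI : Nonempty (Fin r) := ⟨⟨0, hr⟩⟩
    haveI : Nontrivial A' := ⟨b ⟨0, hr⟩, 0, b.ne_zero _⟩
    haveI : IsScalarTower k A (A' ⊗[A] M) := ⟨fun a c m => by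
      induction m using TensorProduct.induction_on with
      | zero => simp
      | add p q hp hq => rw [smul_add, smul_add, smul_add, hp, hq]
      | tmul p q => rw [TensorProduct.smul_tmul', TensorProduct.smul_tmul', 
                      TensorProduct.smul_tmul', smul_assoc]⟩
    let e : (A' ⊗[A] M) ≃ₗ[A] (Fin r → M) := (TensorProduct.equivFinsuppOfBasisLeft b).trans 
      (Finsupp.linearEquivFunOnFinite A M (Fin r))
    obtain ⟨t, ht⟩ := hB A' inferInstance inferInstance inferInstance inferInstance (A' ⊗[A] M) inferInstance inferInstance inferInstance inferInstance inferInstance inferInstance inferInstance (Fin r) inferInstance e inferInstance inferInstance l hl 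
      (by simpa using hll)
    set J' := J.map (algebraMap A A') with hJ'
    haveI : FL k J' (A' ⊗[A] M) := fl_ex J e
    have hm' : (IsLocalRing.maximalIdeal k).map (algebraMap k A') ≤ Ideal.jacobson ⊥ := by
      rw [IsScalarTower.algebraMap_eq k A A', ← Ideal.map_map]
      exact map_le_jacobson hm
    have hJJ' : J' ≤ Ideal.jacobson ⊥ := map_le_jacobson hJJ
    have hC' : Cpl.{v, w} J' := hC.ext
    set x1' := algebraMap A A' x1 with hx1'
    set x2' := algebraMap A A' x2 with hx2'
    set ℓ := x1' + t * x2' with hℓ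
    set ys' := ys.map (algebraMap A A') with hys0
    have h1' : x1' ∈ J' := Ideal.mem_map_of_mem (algebraMap A A') h1
    have h2' : x2' ∈ J' := Ideal.mem_map_of_mem (algebraMap A A') h2
    have hℓJ : ℓ ∈ J' := Ideal.add_mem _ h1' (Ideal.mul_mem_left _ _ h2')
    have hs' : ys'.length = s := by simp [hys0, hs]
    have hys' : ∀ a ∈ ys', a ∈ J' := by
      intro a ha
      obtain ⟨b, hb, rfl⟩ := List.mem_map.1 ha
      exact Ideal.mem_map_of_mem _ (hys b hb)
    have hJx : J' ≤ Ideal.ofList (x1' :: x2' :: ys') ⊔ 𝔟.map (algebraMap A A') := by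
      rw [hx1', hx2', hys0, ← List.map_cons, ← List.map_cons, ← Ideal.map_ofList, ← Ideal.map_sup]
      exact Ideal.map_mono hJ
    have hJℓ : J' ≤ Ideal.ofList (ℓ :: x2' :: ys') ⊔ 𝔟.map (algebraMap A A') := by
      refine hJx.trans (sup_le_sup_right ?_ _)
      simp only [Ideal.ofList_cons]
      refine sup_le ?_ le_sup_right
      rw [Ideal.span_singleton_le_iff_mem]
      have : ℓ - t * x2' = x1' := by rw [hℓ]; ring
      rw [← this]
      exact Ideal.sub_mem _ (Ideal.mem_sup_left (Ideal.mem_span_singleton_self _)) 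
        (Ideal.mul_mem_left _ _ (Ideal.mem_sup_right (Ideal.mem_sup_left 
          (Ideal.mem_span_singleton_self _))))
    have hb' : 𝔟.map (algebraMap A A') • (⊤ : Submodule A' (A' ⊗[A] M)) = ⊥ := by
      have := pow_rs 𝔟 A' e 1
      rw [pow_one, pow_one, hb] at this
      rw [Submodule.eq_bot_iff]
      intro m hm
      have h3 : m ∈ exS e (⊥ : Submodule A M) := this ▸ hm
      apply e.injective
      rw [map_zero]
      ext i
      exact (Submodule.mem_bot A).1 (mem_piS.1 h3 i)
    have hp' : Pure k J' (A' ⊗[A] M) (s + 1) := fun W hW => Pure_ex J e hp W (hW.mono _ (by omega))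
    rw [hs] at ht
    obtain ⟨hinj, hEv⟩ := superficial (k := k) J' hℓJ ht hp'
    have hCh' : Ch (s + 1) (HS k J' (A' ⊗[A] M)) (r * e0) (r * e1) := by
      refine (Lead.congr (hCh.mul (r : ℤ)) (Eventually.of_forall fun n => ?_) : Lead _ _ (r * 0)) |> 
        fun h => by simpa [Ch, EvP] using h
      simp only [HS_ex (k := k) J e, hJ', Fintype.card_fin]
      push_cast
      ring
    have hChN := hCh'.quot hEv
    have hbN := smul_top_quot_x hb' ℓ
    have hJN := le_cons J' hJℓ
    obtain ⟨U, c, hc0, hUp, hUCh, hUs⟩ := reduction (k := k) J' hChN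
    have hih := ih A' J' hm' hJJ' hC' (x2' :: ys') (by simp [hs']) (by simpa using ⟨h2', hys'⟩) 
      _ hJN (((A' ⊗[A] M) ⧸ xM (A' ⊗[A] M) ℓ) ⧸ U) (smul_top_quot hbN U) _ _ hUCh hUp
    have hr' : (0 : ℤ) < r := by exact_mod_cast hr
    constructor
    · by_contra! hpos
      have := mul_pos hr' hpos
      linarith [hih.1]
    · rintro rfl
      have hc : c = 0 := by linarith [hih.1]
      subst hc
      have hCM := hih.2 (by simp)
      haveI : IsPrecomplete J' (A' ⊗[A] M) := hC' _
      have hU := W_argument (k := k) J' hJJ' hℓJ hinj h2' hys' hJN hbN U (by rw [hs']; exact hUs rfl) 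
        (by rw [hs']; exact hCM) (by rw [hs']; exact hp')
      subst hU
      have hN := CMn.congr J' (Submodule.quotEquivOfEqBot _ rfl) hCM
      have := CMn.of_quot (k := k) J' hℓJ (y := x2' :: ys') (by simpa using ⟨h2', hys'⟩) hJℓ hb' hinj 
        (by simpa [hs'] using hN)
      rw [List.length_cons, hs'] at this
      exact CMn_ex J e this

end main
end CM
end part_12

section part_13
open Filter
namespace CM
universe u v w

section dim
variable {k : Type u} {A : Type v} [CommRing k] [CommRing A] [Algebra k A] [IsNoetherianRing A]

lemma dim_link (J : Ideal A) (hJJ : J ≤ Ideal.jacobson ⊥) (s : ℕ) : ∀ (P : Ideal A) [P.IsPrime] [FL k J (A ⧸ P)]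
    (_ : Small k J s (⊤ : Submodule A (A ⧸ P))) (l : LTSeries (PrimeSpectrum A)) 
    (_ : P ≤ l.head.asIdeal), l.length < s := by
  induction s with
  | zero =>
    intro P _ _ h l _
    have := h.eq_bot J hJJ
    exact absurd this top_ne_bot
  | succ s ih =>
    intro P _ _ h l hP
    by_cases hl : l.length = 0
    · omega
    have hlt : l.head < (l.tail hl).head := by
      rw [RelSeries.head_tail]
      exact l.strictMono (by rw [Fin.lt_def, Fin.val_one', Nat.mod_eq_of_lt (by omega)]; simp)
    set P1 := (l.tail hl).head.asIdeal with hP1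
    obtain ⟨x, hx1, hx0⟩ := SetLike.exists_of_lt (show l.head.asIdeal < P1 from hlt)
    have hPP : P ≤ P1 := hP.trans hlt.le
    have hinj : Function.Injective (mx (A ⧸ P) x) := by
      rw [inj_iff]
      intro m hm
      obtain ⟨a, rfl⟩ := Ideal.Quotient.mk_surjective m
      rw [Algebra.smul_def, Ideal.Quotient.algebraMap_eq, ← map_mul, Ideal.Quotient.eq_zero_iff_mem] at hm
      rw [Ideal.Quotient.eq_zero_iff_mem]
      exact (Ideal.IsPrime.mem_or_mem ‹_› hm).resolve_left (fun h => hx0 (hP h))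
    have h2 := h.quot_regular J x hinj
    let f0 : (A ⧸ P) →ₗ[A] (A ⧸ P1) := Submodule.factor hPP
    have hf0 : Function.Surjective f0 := Submodule.factor_surjective hPP
    have hker : (⊤ : Submodule A (A ⧸ P)).map (mx (A ⧸ P) x) ≤ LinearMap.ker f0 := by
      rintro _ ⟨m, -, rfl⟩
      obtain ⟨a, rfl⟩ := Ideal.Quotient.mk_surjective m
      rw [LinearMap.mem_ker]
      change f0 (x • _) = 0
      rw [map_smul]
      change x • (Ideal.Quotient.mk P1 a) = 0
      rw [Algebra.smul_def, Ideal.Quotient.algebraMap_eq, ← map_mul, Ideal.Quotient.eq_zero_iff_mem]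
      exact Ideal.mul_mem_right _ _ hx1
    let f : ((A ⧸ P) ⧸ (⊤ : Submodule A (A ⧸ P)).map (mx (A ⧸ P) x)) →ₗ[A] (A ⧸ P1) := 
      Submodule.liftQ _ f0 hker
    have hf : Function.Surjective f := by
      intro b
      obtain ⟨a, rfl⟩ := hf0 b
      exact ⟨Submodule.Quotient.mk a, rfl⟩
    haveI : FL k J (A ⧸ P1) := fl_surj J f hf
    have h3 := h2.map J f
    rw [Submodule.map_top, LinearMap.range_eq_top.2 hf] at h3
    have := ih P1 h3 (l.tail hl) le_rfl
    rw [RelSeries.tail_length] at this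
    omega

lemma dim_lt (J : Ideal A) (hJJ : J ≤ Ideal.jacobson ⊥) (s : ℕ) (P : Ideal A) [P.IsPrime] [FL k J (A ⧸ P)]
    (h : Small k J s (⊤ : Submodule A (A ⧸ P))) : ringKrullDim (A ⧸ P) ≠ s := by
  intro hd
  rw [ringKrullDim_quotient] at hd
  haveI : Nonempty (PrimeSpectrum.zeroLocus (R := A) P) := 
    ⟨⟨⟨P, inferInstance⟩, fun a ha => ha⟩⟩
  obtain ⟨l, hl⟩ := Order.le_krullDim_iff.1 hd.ge
  have := dim_link J hJJ s P h (l.map (Subtype.val) (fun a b h => h)) (by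
    exact l.head.2)
  have h2 : l.length < s := this
  omega

lemma pure_of_ass (J : Ideal A) (hJJ : J ≤ Ideal.jacobson ⊥) {M : Type w} [AddCommGroup M] [Module A M]
    [Module k M] [IsScalarTower k A M] [Module.Finite A M] [FL k J M] {d : ℕ}
    (h : ∀ P ∈ associatedPrimes A M, ringKrullDim (A ⧸ P) = d) : Pure k J M d := by
  intro W hW
  by_contra hne
  haveI : Nontrivial W := (Submodule.nontrivial_iff_ne_bot).2 hne
  obtain ⟨P, hP⟩ := associatedPrimes.nonempty A W
  haveI : P.IsPrime := hP.1
  obtain ⟨f, hf⟩ := ((isAssociatedPrime_iff_exists_injective_linearMap P W).1 hP).2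
  have hsur : Function.Surjective (LinearMap.rangeRestrict f) := LinearMap.surjective_rangeRestrict f
  let e := LinearEquiv.ofInjective f hf
  haveI : FL k J (A ⧸ P) := fl_surj (M := LinearMap.range f) J e.symm.toLinearMap e.symm.surjective
  have h1 : Small k J d ((⊤ : Submodule A (A ⧸ P)).map (W.subtype.comp f)) := by
    refine hW.le J ?_
    rintro _ ⟨a, -, rfl⟩
    exact (f a).2
  have h2 := (small_map_iff J (W.subtype.comp f) (W.injective_subtype.comp hf)).1 h1
  exact dim_lt J hJJ d P h2 (h P (associatedPrimes.subset_of_injective W.injective_subtype hP))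

end dim
end CM
end part_13

section part_14
open Filter
namespace CM
universe u v w

section noeth

lemma hat_noeth_aux {S : Type u} {R : Type v} [CommRing S] [CommRing R] (I : Ideal S) (φ : S →+* R) 
    (hφ : Function.Surjective φ) (m : Ideal R)
    (hI : I.map φ = m) (hIfg : I.FG) [IsNoetherianRing (AdicCompletion I S)] : 
    IsNoetherianRing (AdicCompletion m R) := by
  have hIn : ∀ k, I ^ k ≤ (m ^ k).comap φ := fun k => by
    rw [← Ideal.map_le_iff_le_comap, Ideal.map_pow, hI]
  have hmfg : m.FG := hI ▸ hIfg.map φ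
  let f : (k : ℕ) → AdicCompletion I S →+* R ⧸ m ^ k := fun k => 
    (Ideal.quotientMap (m ^ k) φ (hIn k)).comp (AdicCompletion.evalₐ I k : AdicCompletion I S →+* S ⧸ I ^ k)
  have hfm : ∀ k x, f k (AdicCompletion.mk I S x) = Ideal.Quotient.mk _ (φ (x k)) := by
    intro k x
    simp only [f, RingHom.comp_apply, RingHom.coe_coe]
    rw [AdicCompletion.evalₐ_mk, Ideal.quotientMap_mk]
  have hf : ∀ {a b : ℕ} (hle : a ≤ b), (Ideal.Quotient.factorPow m hle).comp (f b) = f a := by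
    intro a b hle
    ext x
    obtain ⟨x, rfl⟩ := AdicCompletion.mk_surjective I S x
    rw [RingHom.comp_apply, hfm, hfm]
    change Ideal.Quotient.mk _ _ = _
    rw [Ideal.Quotient.eq, ← map_sub]
    refine hIn a ?_
    rw [← Ideal.Quotient.eq]
    exact AdicCompletion.Ideal.mk_eq_mk I hle x
  let F : AdicCompletion I S →+* AdicCompletion m R := AdicCompletion.liftRingHom m f hf
  have hF : F.comp (algebraMap S _) = (algebraMap R (AdicCompletion m R)).comp φ := by
    ext1 x
    apply AdicCompletion.ext_evalₐ
    intro k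
    simp only [F, RingHom.comp_apply]
    rw [AdicCompletion.evalₐ_liftRingHom]
    simp only [f, RingHom.comp_apply, RingHom.coe_coe]
    rw [AlgHom.commutes, AlgHom.commutes]
    rfl
  have hJ : (I.map (algebraMap S (AdicCompletion I S))).map F = m.map (algebraMap R (AdicCompletion m R)) := by
    rw [Ideal.map_map, hF, ← Ideal.map_map, hI]
  have := AdicCompletion.isAdicComplete_self I hIfg
  have := AdicCompletion.isAdicComplete_self m hmfg
  haveI : IsHausdorff ((I.map (algebraMap S (AdicCompletion I S))).map F) (AdicCompletion m R) := by
    rw [hJ]; infer_instance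
  refine isNoetherianRing_of_surjective (AdicCompletion I S) _ F 
    (surjective_of_mk_map_comp_surjective (I := I.map (algebraMap S (AdicCompletion I S))) F ?_)
  intro y
  obtain ⟨y, rfl⟩ := Ideal.Quotient.mk_surjective y
  obtain ⟨r, hr⟩ := Ideal.Quotient.mk_surjective (AdicCompletion.evalOneₐ m y)
  obtain ⟨s, rfl⟩ := hφ r
  refine ⟨algebraMap S _ s, ?_⟩
  rw [RingHom.comp_apply, Ideal.Quotient.eq, hJ, ← AdicCompletion.ker_evalOneₐ_eq_map m hmfg, RingHom.mem_ker,
    ← RingHom.comp_apply, hF, map_sub, sub_eq_zero]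
  change AdicCompletion.evalOneₐ m (algebraMap R _ (φ s)) = AdicCompletion.evalOneₐ m y
  rw [← hr, AlgHom.commutes]
  rfl

variable (R : Type u) [CommRing R] [IsNoetherianRing R] [IsLocalRing R]
open IsLocalRing
theorem hat_noeth : IsNoetherianRing (AdicCompletion (maximalIdeal R) R) := by
  have hfg : (maximalIdeal R).FG := IsNoetherian.noetherian _
  obtain ⟨n, g, hg⟩ := Submodule.fg_iff_exists_fin_generating_family.1 hfg
  haveI : IsNoetherianRing (AdicCompletion (MvPolynomial.idealOfVars (Fin n) R) (MvPolynomial (Fin n) R)) := 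
    isNoetherianRing_of_ringEquiv (MvPowerSeries (Fin n) R)
    (MvPowerSeries.toAdicCompletionAlgEquiv (Fin n) R).toRingEquiv
  refine hat_noeth_aux (MvPolynomial.idealOfVars (Fin n) R) (MvPolynomial.eval g) 
    (fun r => ⟨MvPolynomial.C r, by simp⟩) _ ?_ (MvPolynomial.idealOfVars_fg (Fin n) R)
  rw [Ideal.map_span, ← hg]
  congr 1
  rw [← Set.range_comp]
  congr 1
  funext i
  simp
end noeth
end CM
end part_14

section part_15
open Filter
namespace CM
universe u v w

section cpl
variable {A : Type v} [CommRing A] [IsNoetherianRing A]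

lemma prec_pi (𝔪 : Ideal A) [IsPrecomplete 𝔪 A] (n : ℕ) : IsPrecomplete 𝔪 (Fin n → A) := by
  constructor
  intro f hf
  have key : ∀ (j : ℕ) (a b : Fin n → A), a ≡ b [SMOD (𝔪 ^ j • ⊤ : Submodule A (Fin n → A))] ↔ 
      ∀ i, a i ≡ b i [SMOD (𝔪 ^ j • ⊤ : Submodule A A)] := by
    intro j a b
    simp only [SModEq.sub_mem]
    rw [smul_piS, mem_piS]
    rfl
  have : ∀ i, ∃ L : A, ∀ j, f j i ≡ L [SMOD (𝔪 ^ j • ⊤ : Submodule A A)] := by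
    intro i
    exact IsPrecomplete.prec' (fun j => f j i) (fun h => (key _ _ _).1 (hf h) i)
  choose L hL using this
  exact ⟨L, fun j => (key _ _ _).2 fun i => hL i j⟩

lemma prec_fin (𝔪 : Ideal A) [IsPrecomplete 𝔪 A] (N : Type w) [AddCommGroup N] [Module A N] 
    [Module.Finite A N] : IsPrecomplete 𝔪 N := by
  obtain ⟨n, f, hf⟩ := Module.Finite.exists_fin' A N
  haveI := prec_pi 𝔪 n
  rw [← AdicCompletion.of_surjective_iff]
  intro y
  obtain ⟨z, rfl⟩ := AdicCompletion.map_surjective 𝔪 hf y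
  obtain ⟨a, rfl⟩ := AdicCompletion.of_surjective 𝔪 (Fin n → A) z
  exact ⟨f a, by rw [AdicCompletion.map_of]⟩

lemma prec_le (𝔪 J : Ideal A) (hJ : J ≤ 𝔪) (hm : 𝔪 ≤ Ideal.jacobson ⊥) (N : Type w) [AddCommGroup N] [Module A N] 
    [Module.Finite A N] [IsPrecomplete 𝔪 N] : IsPrecomplete J N := by
  constructor
  intro f hf
  obtain ⟨L, hL⟩ := IsPrecomplete.prec' (I := 𝔪) f (fun {a b} h => by
    have := hf h
    rw [SModEq.sub_mem] at this ⊢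
    exact Submodule.smul_mono_left (Ideal.pow_right_mono hJ a) this)
  refine ⟨L, fun n => ?_⟩
  rw [SModEq.sub_mem, ← Submodule.Quotient.mk_eq_zero]
  refine krull 𝔪 hm fun c => ?_
  have h1 := hf (Nat.le_max_left n c)
  have h2 := hL (max n c)
  rw [SModEq.sub_mem] at h1 h2
  have h3 : f n - L = (f n - f (max n c)) + (f (max n c) - L) := by abel
  rw [h3, Submodule.Quotient.mk_add, (Submodule.Quotient.mk_eq_zero _).2 h1, zero_add]
  have h4 := Submodule.mem_map_of_mem (f := (J ^ n • ⊤ : Submodule A N).mkQ) h2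
  rw [Submodule.map_smul''] at h4
  exact Submodule.smul_mono (Ideal.pow_le_pow_right (Nat.le_max_right n c)) le_top h4

lemma cpl_of (𝔪 J : Ideal A) (hJ : J ≤ 𝔪) (hm : 𝔪 ≤ Ideal.jacobson ⊥) [IsPrecomplete 𝔪 A] : Cpl.{v, w} J := by
  intro N _ _ _
  haveI := prec_fin 𝔪 N
  exact prec_le 𝔪 J hJ hm N

end cpl
end CM
end part_15

section part_16
open Filter
namespace CM
universe u v w
open TensorProduct

section cmp
variable {k : Type u} {A : Type v} [CommRing k] [CommRing A] [Algebra k A]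

lemma rl_pow_surj (J : Ideal A) {M : Type*} [AddCommGroup M] [Module A M] [Module k M] [IsScalarTower k A M]
    {N : Type*} [AddCommGroup N] [Module A N] [Module k N] [IsScalarTower k A N] (f : M →ₗ[A] N)
    (hf : Function.Surjective f) (p q : ℕ) (hk : LinearMap.ker f ≤ J ^ p • ⊤) :
    rl k (J ^ p • ⊤ : Submodule A M) (J ^ q • ⊤) = rl k (J ^ p • ⊤ : Submodule A N) (J ^ q • ⊤) := by
  have h : ∀ j, (J ^ j • ⊤ : Submodule A M).map f = J ^ j • ⊤ := fun j => by
    rw [Submodule.map_smul'', Submodule.map_top, LinearMap.range_eq_top.2 hf]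
  have h2 : (J ^ p • ⊤ : Submodule A N).comap f = J ^ p • ⊤ := by
    rw [← h p, Submodule.comap_map_eq, sup_eq_left.2 hk]
  rw [← h2, rl_comap, h q]

variable {R : Type u} [CommRing R] [IsNoetherianRing R] [IsLocalRing R]
open IsLocalRing

lemma exists_pow_le {M : Type v} [AddCommGroup M] [Module R M] [Module.Finite R M] (W : Submodule R M) 
    (h : Module.length R (M ⧸ W) ≠ ⊤) : ∃ c, maximalIdeal R ^ c • (⊤ : Submodule R M) ≤ W := by
  haveI := (isFiniteLength_iff_isNoetherian_isArtinian.1 (Module.length_ne_top_iff.1 h)).2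
  obtain ⟨c, hc⟩ := IsArtinian.monotone_stabilizes (R := R) (M := M ⧸ W)
    ⟨fun n => OrderDual.toDual (maximalIdeal R ^ n • (⊤ : Submodule R (M ⧸ W))), fun a b hab => 
      Submodule.smul_mono_left (Ideal.pow_le_pow_right hab)⟩
  refine ⟨c, fun y hy => ?_⟩
  rw [← Submodule.Quotient.mk_eq_zero]
  have h4 := Submodule.mem_map_of_mem (f := W.mkQ) hy
  rw [Submodule.map_smul''] at h4
  have h5 : W.mkQ y ∈ maximalIdeal R ^ c • (⊤ : Submodule R (M ⧸ W)) := Submodule.smul_mono le_rfl le_top h4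
  refine krull (maximalIdeal R) (maximalIdeal_le_jacobson _) fun n => ?_
  rcases le_total c n with hn | hn
  · have := hc n hn
    change maximalIdeal R ^ c • (⊤ : Submodule R (M ⧸ W)) = maximalIdeal R ^ n • ⊤ at this
    rw [← this]; exact h5
  · exact Submodule.smul_mono_left (Ideal.pow_le_pow_right hn) h5

lemma rl_hat (J : Ideal R) {M : Type v} [AddCommGroup M] [Module R M] [Module.Finite R M] (p q : ℕ)
    (h : Module.length R (M ⧸ (J ^ p • ⊤ : Submodule R M)) ≠ ⊤) : 
    rl R ((J.map (algebraMap R (AdicCompletion (maximalIdeal R) R))) ^ p • ⊤ : 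
      Submodule (AdicCompletion (maximalIdeal R) R) (AdicCompletion (maximalIdeal R) M)) 
      ((J.map (algebraMap R (AdicCompletion (maximalIdeal R) R))) ^ q • ⊤) = 
    rl R (J ^ p • ⊤ : Submodule R M) (J ^ q • ⊤) := by
  obtain ⟨c, hc⟩ := exists_pow_le _ h
  set m := maximalIdeal R with hm
  set A := AdicCompletion m R with hA
  have hfg : m.FG := IsNoetherian.noetherian _
  rw [rl_rs (A := R) , map_pow_rs, map_pow_rs, Submodule.restrictScalars_top]
  rw [rl_pow_surj J (AdicCompletion.eval m M c) (AdicCompletion.eval_surjective m M c) p q ?_, 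
    ← rl_pow_surj J (m ^ c • ⊤ : Submodule R M).mkQ (Submodule.mkQ_surjective _) p q (by
      rw [Submodule.ker_mkQ]; exact hc)]
  rw [← AdicCompletion.pow_smul_top_eq_ker_eval hfg, Submodule.smul_le]
  intro r hr y _
  obtain ⟨z, rfl⟩ := AdicCompletion.ofTensorProduct_surjective_of_finite m M y
  rw [← Submodule.restrictScalars_top R A, ← map_pow_rs J A]
  induction z using TensorProduct.induction_on with
  | zero => simp
  | add a b ha hb => rw [map_add, smul_add]; exact add_mem (ha trivial) (hb trivial)
  | tmul a x =>
    rw [AdicCompletion.ofTensorProduct_tmul, smul_comm]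
    have h1 : r • x ∈ (J ^ p • ⊤ : Submodule R M) := hc (Submodule.smul_mem_smul hr trivial)
    have h2 := Submodule.mem_map_of_mem (f := AdicCompletion.of m M) h1
    rw [Submodule.map_smul''] at h2
    have h3 : AdicCompletion.of m M (r • x) ∈ J ^ p • (⊤ : Submodule R (AdicCompletion m M)) := 
      Submodule.smul_mono le_rfl le_top h2
    rw [← Submodule.restrictScalars_top R A, ← map_pow_rs J A, map_smul] at h3
    exact Submodule.smul_mem (J.map (algebraMap R A) ^ p • ⊤ : Submodule A (AdicCompletion m M)) a h3

end cmp
end CM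
end part_16

section part_17
open Filter
namespace CM
universe u v w
open TensorProduct IsLocalRing

open scoped Pointwise in
lemma CMn.weakReg {A : Type u} [CommRing A] [IsNoetherianRing A] (J : Ideal A) (hJJ : J ≤ Ideal.jacobson ⊥) 
    (y : List A) : ∀ (M : Type v) [AddCommGroup M] [Module A M] [Module.Finite A M] [FL A J M]
    (𝔟 : Ideal A) (_ : ∀ a ∈ y, a ∈ J) (_ : J ≤ Ideal.ofList y ⊔ 𝔟)
    (_ : 𝔟 • (⊤ : Submodule A M) = ⊥) (_ : CMn A J M y.length), 
    RingTheory.Sequence.IsWeaklyRegular M y := by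
  induction y with
  | nil => intro M _ _ _ _ 𝔟 _ _ _ _; exact RingTheory.Sequence.IsWeaklyRegular.nil A M
  | cons x y ih =>
    intro M _ _ _ _ 𝔟 hy hJ hb h
    obtain ⟨h1, h2⟩ := CMn.regular J hJJ (hy x (by simp)) (fun a ha => hy a (by simp [ha])) hJ hb h
    rw [RingTheory.Sequence.isWeaklyRegular_cons_iff]
    refine ⟨fun a b hab => h1 hab, ?_⟩
    have h3 := ih (M ⧸ xM M x) (Ideal.span {x} ⊔ 𝔟) (fun a ha => hy a (by simp [ha])) (le_cons J hJ)
      (smul_top_quot_x hb x) h2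
    refine (LinearEquiv.isWeaklyRegular_congr (Submodule.quotEquivOfEq (xM M x) (x • (⊤ : Submodule A M)) ?_) y).1 h3
    ext m
    rw [mem_xM, Submodule.mem_smul_pointwise_iff_exists]
    simp

lemma ch_of_sum (s : ℕ) (H : ℕ → ℤ) (e : ℕ → ℤ) (n0 : ℕ)
    (he : ∀ n ≥ n0, H n = ∑ i ∈ Finset.range (s + 1 + 1), 
      (-1) ^ i * e i * ((n + (s + 1) - i).choose (s + 1 - i) : ℤ)) : Ch s H (e 0) (e 1) := by
  have h : ∀ i ∈ Finset.range s, EvP s (fun n => (-1) ^ (i + 2) * e (i + 2) * 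
      ((n + (s - 1 - i)).choose (s - 1 - i) : ℤ)) := fun i hi => by
    have := ((lead_choose (s - 1 - i)).mul ((-1) ^ (i + 2) * e (i + 2))).evP
    exact this.mono (by have := Finset.mem_range.1 hi; omega)
  have h2 : EvP s (fun n => ∑ i ∈ Finset.range s, (-1) ^ (i + 2) * e (i + 2) * 
      ((n + (s - 1 - i)).choose (s - 1 - i) : ℤ)) := by
    have := Lead.sum (Finset.range s) h
    simpa using this
  refine Lead.congr h2 ?_
  filter_upwards [eventually_ge_atTop n0] with n hn
  rw [he n hn, Finset.sum_range_succ', Finset.sum_range_succ']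
  have : ∑ i ∈ Finset.range s, (-1) ^ (i + 2) * e (i + 2) * 
      ((n + (s - 1 - i)).choose (s - 1 - i) : ℤ) = ∑ k ∈ Finset.range s, (-1) ^ (k + 1 + 1) * e (k + 1 + 1) * 
      ((n + (s + 1) - (k + 1 + 1)).choose (s + 1 - (k + 1 + 1)) : ℤ) := by
    refine Finset.sum_congr rfl fun i hi => ?_
    have := Finset.mem_range.1 hi
    rw [show n + (s + 1) - (i + 1 + 1) = n + (s - 1 - i) by omega, 
      show s + 1 - (i + 1 + 1) = s - 1 - i by omega]
  rw [this, show n + (s + 1) - (0 + 1) = n + s by omega, show s + 1 - (0 + 1) = s by omega]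
  simp

lemma final {R : Type u} {M : Type v} [CommRing R] [IsNoetherianRing R]
    [IsLocalRing R] [AddCommGroup M] [Module R M] [Module.Finite R M] (s : ℕ)
    (hunmixed : ∀ P ∈ associatedPrimes (AdicCompletion (maximalIdeal R) R)
        (AdicCompletion (maximalIdeal R) M),
      ringKrullDim (AdicCompletion (maximalIdeal R) R ⧸ P) = (s + 1 : ℕ))
    (x : List R) (hxl : x.length = s + 1) (hx : ∀ a ∈ x, a ∈ maximalIdeal R)
    (len : ℕ → ℕ) (hlen : ∀ n, Module.length R (M ⧸ ((Ideal.ofList x) ^ (n + 1) • ⊤ : Submodule R M)) = len n)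
    (e0 : ℤ) (hCh : Ch s (fun n => (len n : ℤ)) e0 0) : 
    RingTheory.Sequence.IsWeaklyRegular M x := by
  set J := Ideal.ofList x with hJdef
  have hJm : J ≤ maximalIdeal R := Ideal.span_le.2 fun a ha => hx a ha
  haveI := hat_noeth R
  set A := AdicCompletion (maximalIdeal R) R with hA
  set J' := J.map (algebraMap R A) with hJ'
  have hJ'm : J' ≤ maximalIdeal A := by
    rw [AdicCompletion.maximalIdeal_eq_map]; exact Ideal.map_mono hJm
  have hmj : maximalIdeal A ≤ Ideal.jacobson ⊥ := maximalIdeal_le_jacobson _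
  have hfin : ∀ p, Module.length R (M ⧸ (J ^ p • ⊤ : Submodule R M)) ≠ ⊤ := fun p => by
    cases p with
    | zero => 
      rw [pow_zero, Ideal.one_eq_top, Submodule.top_smul, Module.length_eq_zero]; simp
    | succ n => rw [hlen n]; simp
  haveI : Module.Finite A (AdicCompletion (maximalIdeal R) M) := 
    Module.Finite.of_surjective _ (AdicCompletion.ofTensorProduct_surjective_of_finite (maximalIdeal R) M)
  let T := ULift.{u} (AdicCompletion (maximalIdeal R) M)
  let E : T ≃ₗ[A] AdicCompletion (maximalIdeal R) M := ULift.moduleEquiv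
  haveI : Module.Finite A T := Module.Finite.equiv E.symm
  have hrl : ∀ p q, rl R (J' ^ p • ⊤ : Submodule A T) (J' ^ q • ⊤) = 
      rl R (J ^ p • ⊤ : Submodule R M) (J ^ q • ⊤) := fun p q => by
    rw [rl_pow_surj J' E.toLinearMap E.surjective p q (by simp), rl_hat J p q (hfin p)]
  have hrl0 : ∀ p, rl R (J' ^ p • ⊤ : Submodule A T) ⊤ = 
      rl R (J ^ p • ⊤ : Submodule R M) ⊤ := fun p => by
    have := hrl p 0
    simpa using this
  have hrl1 : rl R (J' • ⊤ : Submodule A T) ⊤ = rl R (J • ⊤ : Submodule R M) ⊤ := by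
    simpa using hrl0 1
  have hfl : rl R (J • ⊤ : Submodule R M) ⊤ ≠ ⊤ := by
    have := hfin 1
    rwa [pow_one, ← rl_top] at this
  haveI : FL R J M := ⟨hfl⟩
  haveI : FL R J' T := ⟨by rw [hrl1]; exact hfl⟩
  have hPure : Pure R J' T (s + 1) := by
    refine pure_of_ass J' (hJ'm.trans hmj) fun P hP => hunmixed P ?_
    rwa [LinearEquiv.AssociatedPrimes.eq E] at hP
  have hHS : HS R J' T = fun n => (len n : ℤ) := by
    funext n
    unfold HS
    have h1 := (hrl0 (n + 1)).trans ((rl_top _).trans (hlen n))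
    obtain ⟨a, ha, ha'⟩ := zl_eq (k := R) (P := J' ^ (n + 1) • ⊤) (Q := (⊤ : Submodule A T)) 
      (by rw [h1]; simp)
    rw [ha'] 
    rw [ha] at h1
    exact_mod_cast h1
  rw [← hHS] at hCh
  have hC : Cpl.{u, v} J' := cpl_of (maximalIdeal A) J' hJ'm hmj
  have hJy : J' = Ideal.ofList (x.map (algebraMap R A)) := by
    rw [hJ', hJdef, Ideal.map_ofList]
  have key := (main_ind R s A J' (by rw [← AdicCompletion.maximalIdeal_eq_map]; exact hmj) (hJ'm.trans hmj) hC 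
    (x.map (algebraMap R A)) (by simp [hxl]) (fun a ha => by
      rw [hJy]; exact Ideal.subset_span ha) ⊥ (by rw [hJy]; exact le_sup_left) T (by simp) e0 0 hCh 
      hPure).2 rfl
  have key2 : CMn R J M (s + 1) := fun n => by
    rw [← hrl, ← hrl1]; exact key n
  exact CMn.weakReg J (hJm.trans (maximalIdeal_le_jacobson _)) x M ⊥ (fun a ha => Ideal.subset_span ha) 
    le_sup_left (by simp) (hxl ▸ key2)

end CM
end part_17

/-- Let `(R, m)` be a Cohen–Macaulay Noetherian local ring and `M` a finite
unmixed `R`-module with `dim M = dim R = d` (unmixed: every associated prime `P` of the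
`m`-adic completion `M̂` over `R̂` satisfies `dim R̂/P = d`).  If `e₁(J, M) = 0` for some
parameter ideal `J` for `M`, then `M` is Cohen–Macaulay.  The Hilbert coefficients
`e i = eᵢ(J, M)` satisfy `λ(M/J^(n+1)M) = ∑ᵢ (−1)ⁱ eᵢ(J,M) · C(n + d − i, d − i)` for
`n ≫ 0`. -/
theorem cohenMacaulay_of_chern_number_zero {R M : Type*} [CommRing R] [IsNoetherianRing R]
    [IsLocalRing R] [AddCommGroup M] [Module R M] [Module.Finite R M]
    (d : ℕ) (hd : 1 ≤ d) (hdimR : ringKrullDim R = d)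
    (hdimM : ringKrullDim (R ⧸ Module.annihilator R M) = d)
    (hRCM : IsCMofDim R R d)
    (hunmixed : ∀ P ∈ associatedPrimes (AdicCompletion (IsLocalRing.maximalIdeal R) R)
        (AdicCompletion (IsLocalRing.maximalIdeal R) M),
      ringKrullDim (AdicCompletion (IsLocalRing.maximalIdeal R) R ⧸ P) = d)
    (x : Fin d → R) (hx : ∀ i, x i ∈ IsLocalRing.maximalIdeal R)
    (J : Ideal R) (hJ : J = Ideal.span (Set.range x))
    (len : ℕ → ℕ) (hlen : ∀ n, HasLength R (M ⧸ (J ^ (n + 1) • ⊤ : Submodule R M)) (len n))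
    (e : ℕ → ℤ) (n0 : ℕ)
    (he : ∀ n ≥ n0, (len n : ℤ) =
      ∑ i ∈ Finset.range (d + 1), (-1) ^ i * e i * ((n + d - i).choose (d - i) : ℤ))
    (h1 : e 1 = 0) :
    IsCMofDim R M d := by
  obtain ⟨s, rfl⟩ : ∃ s, d = s + 1 := ⟨d - 1, by omega⟩
  have hJx : J = Ideal.ofList (List.ofFn x) := by
    rw [hJ]; unfold Ideal.ofList; congr 1; ext a; exact List.mem_ofFn.symm
  have hm : ∀ a ∈ List.ofFn x, a ∈ IsLocalRing.maximalIdeal R := fun a ha => by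
    obtain ⟨i, rfl⟩ := List.mem_ofFn.1 ha
    exact hx i
  have hch := CM.ch_of_sum s (fun n => (len n : ℤ)) e n0 he
  rw [h1] at hch
  have hw := CM.final s hunmixed (List.ofFn x) (by simp) hm len (fun n => by
    obtain ⟨c, hc1, hc2, hc3⟩ := hlen n
    rw [← hJx, ← Module.length_compositionSeries c hc1 hc2, hc3]) (e 0) hch
  refine ⟨hdimM, List.ofFn x, by simp, hm, hw, fun htop => ?_⟩
  have hsub : (⊤ : Submodule R M) = ⊥ := by
    refine Submodule.eq_bot_of_le_smul_of_le_jacobson_bot (Ideal.ofList (List.ofFn x)) ⊤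
      Module.Finite.fg_top htop.le ?_
    exact le_trans (Ideal.span_le.2 fun a ha => hm a ha) (IsLocalRing.maximalIdeal_le_jacobson _)
  have hss : Subsingleton M := (Submodule.subsingleton_iff R).1 (subsingleton_of_bot_eq_top hsub.symm)
  have hann : Module.annihilator R M = ⊤ := Module.annihilator_eq_top_iff.2 hss
  have hq : Subsingleton (R ⧸ Module.annihilator R M) := Ideal.Quotient.subsingleton_iff.2 hann
  rw [ringKrullDim_eq_bot_of_subsingleton] at hdimM
  exact absurd hdimM.symm (WithBot.coe_ne_bot)
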